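/- arXiv:1509.04998 — 2 statements merged into one kernel-verified Lean document; each statement's English description precedes it below -/
import Mathlib

section
/- Let ε ∈ (0,1) and let ℓ be an integer satisfying ⌈(log(ℓ)+1)²⌉ < ⌈ℓ^ε⌉ ≤ ℓ − 2⌈log(ℓ)⌉. Let F be a finite field of odd order, and let H be a subgroup of GL_ℓ(F) containing SL_ℓ(F). Then the proportion of elements h ∈ H such that h has even order and h^{|h|/2} is an involution whose (−1)-eigenspace has dimension at most ⌈ℓ^ε⌉ is greater than ε/96. -/
open scoped MatrixGroups

/-- The dimension of the `(-1)`-eigenspace of a square matrix `M`, i.e. the dimension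
of the kernel of `M + I`. -/
noncomputable def negOneEigDim {m : Type*} [Fintype m] [DecidableEq m]
    (F : Type*) [Field F] (M : Matrix m m F) : ℕ :=
  Module.finrank F (LinearMap.ker (Matrix.toLin' (M + 1)))


namespace Aux12
open Polynomial Module

section Transitive
variable {F V N : Type*} [Field F] [AddCommGroup V] [Module F V] [AddCommGroup N] [Module F N]
  [FiniteDimensional F V] [FiniteDimensional F N]

/-- extend an injective map to an isomorphism from a product -/
lemma exists_equiv_of_injective (T T' : N →ₗ[F] V) (hT : Function.Injective T)
    (hT' : Function.Injective T') : ∃ g : V ≃ₗ[F] V, ∀ x, g (T x) = T' x := by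
  obtain ⟨C, hC⟩ := Submodule.exists_isCompl (LinearMap.range T)
  obtain ⟨C', hC'⟩ := Submodule.exists_isCompl (LinearMap.range T')
  have e1 := Submodule.finrank_add_eq_of_isCompl hC
  have e2 := Submodule.finrank_add_eq_of_isCompl hC'
  rw [LinearMap.finrank_range_of_inj hT] at e1
  rw [LinearMap.finrank_range_of_inj hT'] at e2
  have e : C ≃ₗ[F] C' := LinearEquiv.ofFinrankEq _ _ (by omega)
  let r := LinearEquiv.ofInjective T hT
  let r' := LinearEquiv.ofInjective T' hT'
  let g := (Submodule.prodEquivOfIsCompl _ _ hC).symm.trans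
    (((r.symm.trans r').prodCongr e).trans (Submodule.prodEquivOfIsCompl _ _ hC'))
  refine ⟨g, fun x => ?_⟩
  have h1 : (Submodule.prodEquivOfIsCompl _ _ hC).symm (T x) = (r x, 0) := by
    rw [LinearEquiv.symm_apply_eq]
    simp [r]
  simp only [g, LinearEquiv.trans_apply, h1]
  simp [r']

lemma exists_det_fix (T : N →ₗ[F] V) (hlt : finrank F N < finrank F V) (δ : Fˣ) :
    ∃ s : V ≃ₗ[F] V, LinearEquiv.det s = δ ∧ ∀ x, s (T x) = T x := by
  have hW : LinearMap.range T ≠ ⊤ := by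
    intro h
    have := LinearMap.finrank_range_le T
    rw [h, finrank_top] at this
    omega
  obtain ⟨u, hu⟩ : ∃ u, u ∉ LinearMap.range T := by
    by_contra hcon
    push Not at hcon
    exact hW (eq_top_iff.2 fun x _ => hcon x)
  obtain ⟨φ, hφu, hφ⟩ := Submodule.exists_le_ker_of_notMem hu
  let f : Module.Dual F V := ((δ : F) - 1) • (φ u)⁻¹ • φ
  have hdet : (LinearMap.transvection f u).det = δ := by
    rw [LinearMap.transvection.det]
    simp [f, hφu]
  have hunit : IsUnit (LinearMap.transvection f u).det := by rw [hdet]; exact δ.isUnit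
  refine ⟨LinearMap.equivOfIsUnitDet hunit, ?_, fun x => ?_⟩
  · ext
    rw [LinearEquiv.coe_det, ← hdet]
    congr 1
    ext v
    simp
  · have : φ (T x) = 0 := hφ ⟨x, rfl⟩
    simp [LinearMap.transvection.apply, f, this]

lemma exists_sl_of_injective (T T' : N →ₗ[F] V) (hT : Function.Injective T)
    (hT' : Function.Injective T') (hlt : finrank F N < finrank F V) :
    ∃ g : V ≃ₗ[F] V, LinearEquiv.det g = 1 ∧ ∀ x, g (T x) = T' x := by
  obtain ⟨g, hg⟩ := exists_equiv_of_injective T T' hT hT'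
  obtain ⟨s, hs, hs'⟩ := exists_det_fix T' hlt (LinearEquiv.det g)⁻¹
  refine ⟨s * g, by rw [map_mul, hs]; simp, fun x => ?_⟩
  rw [LinearEquiv.mul_apply, hg, hs']

lemma ofInj_apply (heq : finrank F N = finrank F V) (T : N →ₗ[F] V) (hT : Function.Injective T)
    (x : N) : LinearEquiv.ofInjectiveOfFinrankEq T hT heq x = T x := rfl

/-- pairs `(h,T)` with `h ∘ T = T ∘ σ` -/
abbrev Pairs (H : Subgroup (V ≃ₗ[F] V)) (σ : N →ₗ[F] N) : Type _ :=
  {p : H × (N →ₗ[F] V) // Function.Injective p.2 ∧ ∀ x, (p.1 : V ≃ₗ[F] V) (p.2 x) = p.2 (σ x)}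

lemma card_pairs (H : Subgroup (V ≃ₗ[F] V)) (hH : ∀ g : V ≃ₗ[F] V, LinearEquiv.det g = 1 → g ∈ H)
    (hlt : finrank F N < finrank F V) (σ : N →ₗ[F] N) (hσ : Function.Injective σ) :
    Nat.card (Pairs H σ) = Nat.card H := by
  obtain ⟨T0, hT0⟩ : ∃ T0 : N →ₗ[F] V, Function.Injective T0 :=
    (finrank_le_iff_exists_linearMap (R := F) (M := N) (M' := V)).1 hlt.le
  have key : ∀ T : {T : N →ₗ[F] V // Function.Injective T}, ∃ s : H,
      ∀ x, (s : V ≃ₗ[F] V) (T0 x) = T.1 x := fun T => by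
    obtain ⟨g, hg, hg'⟩ := exists_sl_of_injective T0 T.1 hT0 T.2 hlt
    exact ⟨⟨g, hH g hg⟩, hg'⟩
  choose s hs using key
  let sg : {T : N →ₗ[F] V // Function.Injective T} → {T : N →ₗ[F] V // Function.Injective T} :=
    fun T => ⟨T.1.comp σ, T.2.comp hσ⟩
  let Φ : Pairs H σ → H := fun p => s ⟨p.1.2, p.2.1⟩ * (s (sg ⟨p.1.2, p.2.1⟩))⁻¹ * p.1.1 *
    s ⟨p.1.2, p.2.1⟩
  have inv_apply : ∀ T x, ((s T)⁻¹ : V ≃ₗ[F] V) (T.1 x) = T0 x := fun T x => by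
    rw [← hs T x, ← LinearEquiv.mul_apply]
    simp
  have hΦ : ∀ p x, (Φ p : V ≃ₗ[F] V) (T0 x) = p.1.2 x := by
    rintro ⟨⟨h, T⟩, hT, hhT⟩ x
    simp only [Φ, Subgroup.coe_mul, LinearEquiv.mul_apply, hs]
    rw [hhT]
    have := inv_apply (sg ⟨T, hT⟩) x
    simp only [sg, LinearMap.comp_apply] at this
    rw [Subgroup.coe_inv]
    simp only [sg]
    rw [this, hs]
  refine Nat.card_eq_of_bijective Φ ⟨?_, ?_⟩
  · rintro ⟨⟨h, T⟩, hT, hhT⟩ ⟨⟨h', T'⟩, hT', hhT'⟩ heq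
    have : T = T' := by
      ext x
      have h1 := hΦ ⟨⟨h, T⟩, hT, hhT⟩ x
      have h2 := hΦ ⟨⟨h', T'⟩, hT', hhT'⟩ x
      rw [heq, h2] at h1
      exact h1.symm
    subst this
    simp only [Φ, mul_left_inj, mul_right_inj] at heq
    subst heq
    rfl
  · intro k
    have hT : Function.Injective ((k : V ≃ₗ[F] V).toLinearMap.comp T0) :=
      (k : V ≃ₗ[F] V).injective.comp hT0
    let T : {T : N →ₗ[F] V // Function.Injective T} := ⟨_, hT⟩
    refine ⟨⟨⟨s (sg T) * (s T)⁻¹ * k * (s T)⁻¹, T.1⟩, hT, fun x => ?_⟩, ?_⟩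
    · simp only [Subgroup.coe_mul, LinearEquiv.mul_apply, Subgroup.coe_inv, inv_apply]
      have : (k : V ≃ₗ[F] V) (T0 x) = T.1 x := rfl
      rw [this, inv_apply, hs]
      rfl
    · change s T * (s (sg T))⁻¹ * (s (sg T) * (s T)⁻¹ * k * (s T)⁻¹) * s T = k
      group

lemma card_pairs_full [Finite V] (H : Subgroup (V ≃ₗ[F] V))
    (heq : finrank F N = finrank F V) (σ : N →ₗ[F] N) :
    Nat.card (Pairs H σ) ≤ Nat.card (V ≃ₗ[F] V) := by
  let e : N ≃ₗ[F] V := LinearEquiv.ofFinrankEq _ _ heq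
  have : Finite (V ≃ₗ[F] V) := DFunLike.finite _
  let eq : ∀ p : Pairs H σ, N ≃ₗ[F] V := fun p => LinearEquiv.ofInjectiveOfFinrankEq p.1.2 p.2.1 heq
  refine Nat.card_le_card_of_injective (fun p : Pairs H σ => e.symm.trans (eq p)) ?_
  rintro ⟨⟨h, T⟩, hT, hhT⟩ ⟨⟨h', T'⟩, hT', hhT'⟩ hpp
  have h1 : T = T' := by
    ext x
    have := congrArg (fun g : V ≃ₗ[F] V => g (e x)) hpp
    simpa [eq, ofInj_apply] using this
  subst h1
  have h2 : h = h' := by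
    ext v
    obtain ⟨x, rfl⟩ := (eq ⟨⟨h, T⟩, hT, hhT⟩).surjective v
    have a1 := hhT x
    have a2 := hhT' x
    simp only [eq, ofInj_apply]
    simp only at a1 a2
    rw [a1, a2]
  subst h2
  rfl

lemma det_of_pairs (H : Subgroup (V ≃ₗ[F] V))
    (heq : finrank F N = finrank F V) (σ : N →ₗ[F] N) (p : Pairs H σ) :
    ((LinearEquiv.det (p.1.1 : V ≃ₗ[F] V) : Fˣ) : F) = LinearMap.det σ := by
  obtain ⟨⟨h, T⟩, hT, hhT⟩ := p
  let e : N ≃ₗ[F] V := LinearEquiv.ofInjectiveOfFinrankEq T hT heq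
  rw [LinearEquiv.coe_det, ← LinearMap.det_conj σ e]
  congr 1
  ext v
  obtain ⟨x, rfl⟩ := e.surjective v
  simp only [LinearMap.comp_apply, LinearEquiv.coe_coe, LinearEquiv.symm_apply_apply]
  simpa [e, ofInj_apply] using hhT x
end Transitive
end Aux12


namespace Aux12
open Polynomial Module

section Poly
variable {F : Type*} [Field F] [Finite F]

/-- Monic irreducible polynomials whose roots have order divisible by `2^(s+1)`. -/
def Ty (s : ℕ) (g : F[X]) : Prop :=
  g.Monic ∧ Irreducible g ∧ ∃ M, 2 ^ s ∣ M ∧ g ∣ X ^ M + 1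

omit [Finite F] in
lemma card_mul_le (S : Finset F[X]) (e : ℕ)
    (hS : ∀ g ∈ S, g.Monic ∧ Irreducible g ∧ g.natDegree = e) (P : F[X]) (hP : P ≠ 0)
    (hdvd : ∀ g ∈ S, g ∣ P) : S.card * e ≤ P.natDegree := by
  have h1 : ∏ g ∈ S, g ∣ P := by
    refine Finset.prod_dvd_of_coprime (fun a ha b hb hab => ?_) hdvd
    refine ((hS a ha).2.1.coprime_iff_not_dvd).2 fun hd => hab ?_
    exact eq_of_monic_of_associated (hS a ha).1 (hS b hb).1
      ((hS a ha).2.1.associated_of_dvd (hS b hb).2.1 hd)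
  have h2 := natDegree_le_of_dvd h1 hP
  rw [natDegree_prod _ _ (fun g hg => (hS g hg).1.ne_zero),
    Finset.sum_congr rfl (fun g hg => (hS g hg).2.2)] at h2
  simpa using h2

omit [Finite F] in
lemma finrank_adjoinRoot (g : F[X]) (hg : g.Monic) : finrank F (AdjoinRoot g) = g.natDegree := by
  rw [(AdjoinRoot.powerBasis hg.ne_zero).finrank, AdjoinRoot.powerBasis_dim]

lemma finite_adjoinRoot (g : F[X]) (hg : g.Monic) : Finite (AdjoinRoot g) := by
  have := hg.finite_adjoinRoot
  exact Module.finite_of_finite F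

omit [Finite F] in
lemma card_adjoinRoot (g : F[X]) (hg : g.Monic) :
    Nat.card (AdjoinRoot g) = Nat.card F ^ g.natDegree := by
  have := hg.finite_adjoinRoot
  rw [Module.natCard_eq_pow_finrank (K := F), finrank_adjoinRoot g hg]

omit [Finite F] in
lemma Ty.root_pow {s : ℕ} {g : F[X]} (hg : Ty s g) :
    ∃ M, 2 ^ s ∣ M ∧ (AdjoinRoot.root g) ^ M = -1 := by
  obtain ⟨hm, hi, M, hM, hd⟩ := hg
  refine ⟨M, hM, ?_⟩
  have := AdjoinRoot.mk_eq_zero.2 hd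
  simp only [map_add, map_pow, AdjoinRoot.mk_X, map_one] at this
  exact eq_neg_of_add_eq_zero_left this

omit [Finite F] in
lemma Ty.exp_pos (h2 : (2 : F) ≠ 0) {g : F[X]} (hi : Irreducible g) {M : ℕ} (hd : g ∣ X ^ M + 1) :
    M ≠ 0 := by
  rintro rfl
  have : (X ^ 0 + 1 : F[X]) = C 2 := by
    simp only [pow_zero]; rw [show (2 : F) = 1 + 1 by norm_num, map_add]; simp
  rw [this] at hd
  exact hi.not_isUnit (isUnit_of_dvd_unit hd ((isUnit_C).2 (isUnit_iff_ne_zero.2 h2)))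

omit [Finite F] in
lemma Ty.root_ne_zero (h2 : (2 : F) ≠ 0) {s : ℕ} {g : F[X]} (hg : Ty s g) :
    AdjoinRoot.root g ≠ 0 := by
  obtain ⟨hm, hi, M, hM, hd⟩ := hg
  have hM0 := Ty.exp_pos h2 hi hd
  have : Fact (Irreducible g) := ⟨hi⟩
  intro h0
  have := AdjoinRoot.mk_eq_zero.2 hd
  simp only [map_add, map_pow, AdjoinRoot.mk_X, map_one, h0, zero_pow hM0, zero_add] at this
  exact one_ne_zero this

lemma Ty.dvd_sub_one (h2 : (2 : F) ≠ 0) {s : ℕ} {g : F[X]} (hg : Ty s g) :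
    g ∣ X ^ (Nat.card F ^ g.natDegree - 1) - 1 := by
  have : Fact (Irreducible g) := ⟨hg.2.1⟩
  have := finite_adjoinRoot g hg.1
  have := Fintype.ofFinite (AdjoinRoot g)
  rw [← AdjoinRoot.mk_eq_zero, ← card_adjoinRoot g hg.1, Nat.card_eq_fintype_card]
  simp only [map_sub, map_pow, AdjoinRoot.mk_X, map_one]
  rw [FiniteField.pow_card_sub_one_eq_one _ (hg.root_ne_zero h2), sub_self]

lemma Ty.dvd_norm {s : ℕ} {g : F[X]} (hg : Ty s g) {δ : F}
    (hδ : Algebra.norm F (AdjoinRoot.root g) = δ) :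
    g ∣ X ^ ((Nat.card F ^ g.natDegree - 1) / (Nat.card F - 1)) - C δ := by
  have : Fact (Irreducible g) := ⟨hg.2.1⟩
  have := finite_adjoinRoot g hg.1
  rw [← AdjoinRoot.mk_eq_zero, ← card_adjoinRoot g hg.1]
  simp only [map_sub, map_pow, AdjoinRoot.mk_X, AdjoinRoot.mk_C]
  rw [← FiniteField.algebraMap_norm_eq_pow (K := F), hδ, AdjoinRoot.algebraMap_eq, sub_self]

lemma two_pow_dvd {K : Type*} [Field K] (h2 : (2 : K) ≠ 0) (α : K) (s M N : ℕ) (hM0 : M ≠ 0)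
    (hM : 2 ^ s ∣ M) (h1 : α ^ M = -1) (hN : α ^ N = 1) : 2 ^ (s + 1) ∣ N := by
  obtain ⟨j, m, hm, rfl⟩ := Nat.exists_eq_two_pow_mul_odd hM0
  have hj : s ≤ j := by
    have := (Nat.Coprime.dvd_of_dvd_mul_right
      (Nat.Coprime.pow_left s (Nat.coprime_two_left.2 hm)) hM)
    exact (Nat.pow_dvd_pow_iff_le_right (by norm_num)).1 this
  have hne : (-1 : K) ≠ 1 := by
    intro h
    apply h2
    linear_combination -h
  have hord : orderOf (α ^ m) = 2 ^ (j + 1) := by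
    apply orderOf_eq_prime_pow (p := 2)
    · rw [← pow_mul, mul_comm, h1]; exact hne
    · rw [pow_succ, pow_mul, ← pow_mul α, mul_comm m, h1]; norm_num
  have : orderOf (α ^ m) ∣ N := by
    apply orderOf_dvd_of_pow_eq_one
    rw [← pow_mul, mul_comm, pow_mul, hN, one_pow]
  rw [hord] at this
  exact (pow_dvd_pow 2 (by omega)).trans this

omit [Finite F] in
lemma two_ne_zero_adjoin (h2 : (2 : F) ≠ 0) (g : F[X]) [Fact (Irreducible g)] :
    (2 : AdjoinRoot g) ≠ 0 := by
  have := (AdjoinRoot.of g).injective.ne h2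
  rwa [map_ofNat, map_zero] at this

omit [Finite F] in
lemma Ty.two_pow_dvd_of_dvd (h2 : (2 : F) ≠ 0) {s : ℕ} {g : F[X]} (hg : Ty s g) {N : ℕ}
    (hN : g ∣ X ^ N - 1) : 2 ^ (s + 1) ∣ N := by
  have : Fact (Irreducible g) := ⟨hg.2.1⟩
  obtain ⟨M, hM, hd⟩ := hg.2.2
  refine two_pow_dvd (two_ne_zero_adjoin h2 g) (AdjoinRoot.root g) s M N
    (Ty.exp_pos h2 hg.2.1 hd) hM ?_ ?_
  · have := AdjoinRoot.mk_eq_zero.2 hd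
    simp only [map_add, map_pow, AdjoinRoot.mk_X, map_one] at this
    exact eq_neg_of_add_eq_zero_left this
  · have := AdjoinRoot.mk_eq_zero.2 hN
    simp only [map_sub, map_pow, AdjoinRoot.mk_X, map_one] at this
    exact sub_eq_zero.1 this

lemma dvd_of_two_pow (q b e t : ℕ) (hq : Odd q)
    (ht : ¬ 2 ^ (t + 1) ∣ q ^ (2 ^ b) - 1) (he : 2 ^ t ∣ q ^ e - 1) (ht2 : 2 ^ t ∣ q ^ (2 ^ b) - 1) :
    2 ^ b ∣ e := by
  have hg : 2 ^ t ∣ q ^ (Nat.gcd (2 ^ b) e) - 1 := by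
    rw [← Nat.pow_sub_one_gcd_pow_sub_one]
    exact Nat.dvd_gcd ht2 he
  obtain ⟨c, hc, hce⟩ := (Nat.dvd_prime_pow Nat.prime_two).1 (Nat.gcd_dvd_left (2 ^ b) e)
  rcases hc.lt_or_eq with hlt | rfl
  · exfalso
    rw [hce] at hg
    apply ht
    have h3 : q ^ (2 ^ (c + 1)) - 1 ∣ q ^ (2 ^ b) - 1 := by
      apply Nat.pow_sub_one_dvd_pow_sub_one
      exact pow_dvd_pow 2 hlt
    refine dvd_trans ?_ h3
    have h4 : q ^ (2 ^ (c + 1)) - 1 = (q ^ (2 ^ c) - 1) * (q ^ (2 ^ c) + 1) := by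
      rw [pow_succ, pow_mul, mul_comm, ← Nat.sq_sub_sq, one_pow]
    rw [h4, pow_succ]
    refine mul_dvd_mul hg ?_
    have : Odd (q ^ 2 ^ c) := hq.pow
    exact (this.add_odd odd_one).two_dvd
  · rw [← hce]; exact Nat.gcd_dvd_right _ _

/-- the exponent `s` attached to `b`: `2^(s+1)` exactly divides `q^(2^b)-1`. -/
def ExpCond (q b s : ℕ) : Prop := 2 ^ (s + 1) ∣ q ^ (2 ^ b) - 1 ∧ ¬ 2 ^ (s + 2) ∣ q ^ (2 ^ b) - 1

lemma exists_expCond (q b : ℕ) (hq : Odd q) (hq1 : 1 < q) : ∃ s, ExpCond q b s := by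
  have hne : q ^ (2 ^ b) - 1 ≠ 0 := by
    have : 1 < q ^ (2 ^ b) := Nat.one_lt_pow (by positivity) hq1
    omega
  obtain ⟨j, m, hm, hj⟩ := Nat.exists_eq_two_pow_mul_odd hne
  have hj0 : j ≠ 0 := by
    rintro rfl
    rw [pow_zero, one_mul] at hj
    have h1 : Odd (q ^ 2 ^ b) := hq.pow
    have : 1 ≤ q ^ 2 ^ b := Nat.one_le_pow _ _ (by omega)
    have h3 : Even (q ^ 2 ^ b - 1) := Nat.Odd.sub_odd h1 odd_one
    rw [hj] at h3
    exact Nat.not_odd_iff_even.2 h3 hm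
  obtain ⟨s, rfl⟩ := Nat.exists_eq_succ_of_ne_zero hj0
  refine ⟨s, hj ▸ dvd_mul_right _ _, ?_⟩
  rw [hj, pow_succ 2 (s + 1)]
  intro h
  have := Nat.dvd_of_mul_dvd_mul_left (by positivity) h
  exact (Nat.not_even_iff_odd.2 hm) (even_iff_two_dvd.2 this)

lemma Ty.dvd_natDegree (h2 : (2 : F) ≠ 0) (hq : Odd (Nat.card F)) {b s : ℕ}
    (hs : ExpCond (Nat.card F) b s) {g : F[X]} (hg : Ty s g) : 2 ^ b ∣ g.natDegree :=
  dvd_of_two_pow (Nat.card F) b _ (s + 1) hq hs.2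
    (hg.two_pow_dvd_of_dvd h2 (hg.dvd_sub_one h2)) hs.1

lemma finite_ty (h2 : (2 : F) ≠ 0) (s e : ℕ) : {g : F[X] | Ty s g ∧ g.natDegree = e}.Finite := by
  rcases Nat.eq_zero_or_pos e with rfl | he
  · convert! Set.finite_empty
    ext g
    simp only [Set.mem_ofPred_eq, Set.mem_empty_iff_false, iff_false, not_and]
    intro hg h
    exact hg.2.1.natDegree_pos.ne' h
  have hlt : 1 < Nat.card F ^ e := Nat.one_lt_pow he.ne' Finite.one_lt_card
  have hP : (X ^ (Nat.card F ^ e - 1) - 1 : F[X]) ≠ 0 :=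
    C_1 (R := F) ▸ X_pow_sub_C_ne_zero (by omega) 1
  classical
  refine ((UniqueFactorizationMonoid.normalizedFactors
    (X ^ (Nat.card F ^ e - 1) - 1 : F[X])).toFinset.finite_toSet).subset ?_
  rintro g ⟨hg, rfl⟩
  simp only [Finset.mem_coe, Multiset.mem_toFinset]
  rw [UniqueFactorizationMonoid.mem_normalizedFactors_iff' hP]
  exact ⟨hg.2.1, hg.1.normalize_eq_self, hg.dvd_sub_one h2⟩

/-- finset of types of degree `e` -/
noncomputable def tyF (h2 : (2 : F) ≠ 0) (s e : ℕ) : Finset F[X] := (finite_ty h2 s e).toFinset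

lemma mem_tyF (h2 : (2 : F) ≠ 0) (s e : ℕ) (g : F[X]) :
    g ∈ tyF h2 s e ↔ Ty s g ∧ g.natDegree = e := by simp [tyF]

lemma card_tyF_le (h2 : (2 : F) ≠ 0) (s e : ℕ) (he : 0 < e) :
    (tyF h2 s e).card * e ≤ Nat.card F ^ e - 1 := by
  have hlt : 1 < Nat.card F ^ e := Nat.one_lt_pow he.ne' Finite.one_lt_card
  have hP : (X ^ (Nat.card F ^ e - 1) - 1 : F[X]) ≠ 0 :=
    C_1 (R := F) ▸ X_pow_sub_C_ne_zero (by omega) 1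
  have := card_mul_le (tyF h2 s e) e (fun g hg => by
    obtain ⟨h, h'⟩ := (mem_tyF h2 s e g).1 hg
    exact ⟨h.1, h.2.1, h'⟩) _ hP (fun g hg => by
    obtain ⟨h, rfl⟩ := (mem_tyF h2 s e g).1 hg
    exact h.dvd_sub_one h2)
  rwa [← C_1, natDegree_X_pow_sub_C] at this

lemma card_tyF_norm_le (s e : ℕ) (he : 0 < e) (δ : F) (S : Finset F[X])
    (hS : ∀ g ∈ S, Ty s g ∧ g.natDegree = e ∧ Algebra.norm F (AdjoinRoot.root g) = δ) :
    S.card * e ≤ (Nat.card F ^ e - 1) / (Nat.card F - 1) := by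
  have h1 : 1 < Nat.card F := Finite.one_lt_card
  have hpos : 0 < (Nat.card F ^ e - 1) / (Nat.card F - 1) := by
    apply Nat.div_pos _ (by omega)
    have : Nat.card F ^ 1 ≤ Nat.card F ^ e := Nat.pow_le_pow_right (by omega) he
    rw [pow_one] at this
    omega
  have := card_mul_le S e (fun g hg => by
    obtain ⟨h, h', _⟩ := hS g hg
    exact ⟨h.1, h.2.1, h'⟩) _ (X_pow_sub_C_ne_zero hpos δ) (fun g hg => by
    obtain ⟨h, rfl, h'⟩ := hS g hg
    exact h.dvd_norm h')
  rwa [natDegree_X_pow_sub_C] at this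

lemma geom_bound (q m : ℕ) (hq : 3 ≤ q) (hm : 4 ≤ m) :
    (∑ i ∈ Finset.Icc 1 m, q ^ i) * 6 ≤ q ^ (2 * m) - 1 := by
  have h1 : ∀ m, (∑ i ∈ Finset.Icc 1 m, q ^ i) * 2 ≤ 3 * (q ^ m - 1) := by
    intro m
    induction m with
    | zero => simp
    | succ k ih =>
      rw [Finset.sum_Icc_succ_top (by omega), add_mul]
      have h2 : 1 ≤ q ^ k := Nat.one_le_pow _ _ (by omega)
      have h3 : q ^ k * 3 ≤ q ^ (k + 1) := by
        rw [pow_succ]; exact Nat.mul_le_mul_left _ hq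
      omega
  have h2 := h1 m
  have h3 : 81 ≤ q ^ m := by
    calc 81 = 3 ^ 4 := by norm_num
      _ ≤ q ^ 4 := Nat.pow_le_pow_left hq 4
      _ ≤ q ^ m := Nat.pow_le_pow_right (by omega) hm
  rw [mul_comm 2 m, pow_mul]
  generalize q ^ m = z at *
  have h4 : z * 81 ≤ z ^ 2 := by nlinarith
  omega

lemma card_tyF_ge (h2 : (2 : F) ≠ 0) (hq : Odd (Nat.card F)) {b s : ℕ}
    (hs : ExpCond (Nat.card F) b s) (d : ℕ) (hd8 : 8 ≤ d) (hde : Even d) (hbd : 2 ^ b ∣ d) :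
    Nat.card F ^ d - 1 ≤ 3 * ((tyF h2 s d).card * d) := by
  classical
  have hq1 : 1 < Nat.card F := Finite.one_lt_card
  set q := Nat.card F with hqdef
  have hq3 : 3 ≤ q := by
    rcases hq with ⟨k, hk⟩; omega
  have hodd : Odd (q ^ d) := hq.pow
  obtain ⟨n, hn⟩ : ∃ n, q ^ d - 1 = 2 * n := by
    have : Even (q ^ d - 1) := Nat.Odd.sub_odd hodd odd_one
    exact even_iff_two_dvd.1 this
  have hqd : 1 < q ^ d := Nat.one_lt_pow (by omega) hq1
  have hn0 : 0 < n := by omega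
  let P : F[X] := X ^ n + 1
  have hPC : P = X ^ n - C (-1) := by simp [P]
  have hPm : P.Monic := by rw [hPC]; exact monic_X_pow_sub_C _ hn0.ne'
  have hPdeg : P.natDegree = n := by rw [hPC, natDegree_X_pow_sub_C]
  have hcast : (n : F) ≠ 0 := by
    intro h0
    have h3 : ((q ^ d : ℕ) : F) = 0 := by
      have := Fintype.ofFinite F
      rw [Nat.cast_pow, hqdef, Nat.card_eq_fintype_card, FiniteField.cast_card_eq_zero,
        zero_pow (by omega)]
    have h4 : q ^ d = 2 * n + 1 := by omega
    rw [h4] at h3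
    push_cast at h3
    rw [h0] at h3
    simp at h3
  have hsep : P.Separable := by
    rw [hPC]
    exact separable_X_pow_sub_C (-1 : F) hcast (by simp)
  have hsq : Squarefree P := hsep.squarefree
  have hsn : 2 ^ s ∣ n := by
    have h5 : 2 ^ (s + 1) ∣ q ^ d - 1 := hs.1.trans (Nat.pow_sub_one_dvd_pow_sub_one _ hbd)
    rw [hn, pow_succ, mul_comm] at h5
    exact Nat.dvd_of_mul_dvd_mul_left (by norm_num) h5
  let NF := UniqueFactorizationMonoid.normalizedFactors P
  have hnodup : NF.Nodup :=
    (UniqueFactorizationMonoid.squarefree_iff_nodup_normalizedFactors hPm.ne_zero).1 hsq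
  let S := NF.toFinset
  have hSmem : ∀ g ∈ S, g.Monic ∧ Irreducible g ∧ g ∣ P := by
    intro g hg
    rw [Multiset.mem_toFinset, UniqueFactorizationMonoid.mem_normalizedFactors_iff'
      hPm.ne_zero] at hg
    refine ⟨?_, hg.1, hg.2.2⟩
    rw [← hg.2.1]
    exact monic_normalize hg.1.ne_zero
  have hprod : ∏ g ∈ S, g = P := by
    have h9 : ∏ g ∈ S, g = NF.prod := by
      rw [Finset.prod_eq_multiset_prod, Multiset.map_id', Multiset.toFinset_val,
        Multiset.dedup_eq_self.2 hnodup]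
    rw [h9, UniqueFactorizationMonoid.prod_normalizedFactors_eq hPm.ne_zero, hPm.normalize_eq_self]
  have hsum : ∑ g ∈ S, g.natDegree = n := by
    rw [← hPdeg, ← hprod, natDegree_prod _ _ (fun g hg => (hSmem g hg).1.ne_zero)]
  have hPdvd : P ∣ X ^ (q ^ d) - X := by
    have h6 : q ^ d = 2 * n + 1 := by omega
    rw [h6]
    refine ⟨(X ^ n - 1) * X, ?_⟩
    simp only [P]
    ring
  have hdegdvd : ∀ g ∈ S, g.natDegree ∣ d := fun g hg =>
    (hSmem g hg).2.1.natDegree_dvd_of_dvd_X_pow_card_pow_sub_X ((hSmem g hg).2.2.trans hPdvd)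
  obtain ⟨m, hm⟩ := hde
  have hsplit : ∑ g ∈ S, g.natDegree ≤ (tyF h2 s d).card * d +
      ∑ i ∈ Finset.Icc 1 m, (S.filter (fun g => g.natDegree = i)).card * i := by
    rw [← Finset.sum_filter_add_sum_filter_not S (fun g => g.natDegree = d)]
    gcongr
    · rw [Finset.sum_congr rfl (fun g hg => (Finset.mem_filter.1 hg).2), Finset.sum_const,
        smul_eq_mul]
      gcongr
      intro g hg
      rw [Finset.mem_filter] at hg
      rw [mem_tyF]
      exact ⟨⟨(hSmem g hg.1).1, (hSmem g hg.1).2.1, n, hsn, (hSmem g hg.1).2.2⟩, hg.2⟩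
    · rw [← Finset.sum_fiberwise_of_maps_to (t := Finset.Icc 1 m) (g := fun g => g.natDegree)]
      · refine Finset.sum_le_sum fun i hi => ?_
        rw [Finset.sum_congr rfl (fun g hg => (Finset.mem_filter.1 hg).2), Finset.sum_const,
          smul_eq_mul]
        gcongr
        exact Finset.filter_subset _ _
      · intro g hg
        rw [Finset.mem_filter] at hg
        have h7 := hdegdvd g hg.1
        have h8 := (hSmem g hg.1).2.1.natDegree_pos
        rw [Finset.mem_Icc]
        refine ⟨h8, ?_⟩
        obtain ⟨c, hc⟩ := h7
        have : c ≠ 0 := by rintro rfl; omega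
        have : c ≠ 1 := by rintro rfl; omega
        have : 2 ≤ c := by omega
        nlinarith
  have hsmall : ∀ i ∈ Finset.Icc 1 m, (S.filter (fun g => g.natDegree = i)).card * i ≤ q ^ i := by
    intro i hi
    rw [Finset.mem_Icc] at hi
    have := card_mul_le (S.filter (fun g => g.natDegree = i)) i (fun g hg => by
      rw [Finset.mem_filter] at hg
      exact ⟨(hSmem g hg.1).1, (hSmem g hg.1).2.1, hg.2⟩) (X ^ q ^ i - X)
      (FiniteField.X_pow_card_pow_sub_X_ne_zero _ (by omega) hq1) (fun g hg => by
        rw [Finset.mem_filter] at hg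
        exact (hSmem g hg.1).2.1.natDegree_dvd_iff_dvd_X_pow_card_pow_sub_X.1 (by rw [hg.2]))
    rwa [FiniteField.X_pow_card_pow_sub_X_natDegree_eq _ (by omega) hq1] at this
  have hge := geom_bound q m hq3 (by omega)
  have := Finset.sum_le_sum hsmall
  rw [show 2 * m = d by omega] at hge
  omega

end Poly
end Aux12


namespace Aux12
open Polynomial Module

section Cyc
variable {F V : Type*} [Field F] [AddCommGroup V] [Module F V]

/-- `p ↦ p(h) v` -/
noncomputable def cyc (h : End F V) (v : V) : F[X] →ₗ[F] V :=
  (LinearMap.applyₗ v).comp (aeval h).toLinearMap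

lemma cyc_apply (h : End F V) (v : V) (p : F[X]) : cyc h v p = aeval h p v := rfl

/-- the cyclic subspace generated by `v` -/
noncomputable def cycW (h : End F V) (v : V) : Submodule F V := LinearMap.range (cyc h v)

lemma mem_cycW {h : End F V} {v w : V} : w ∈ cycW h v ↔ ∃ p : F[X], aeval h p v = w := Iff.rfl

lemma self_mem_cycW (h : End F V) (v : V) : v ∈ cycW h v := ⟨1, by simp [cyc_apply]⟩

lemma aeval_mem_cycW {h : End F V} {v w : V} (p : F[X]) (hw : w ∈ cycW h v) :
    aeval h p w ∈ cycW h v := by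
  obtain ⟨r, rfl⟩ := hw
  exact ⟨p * r, by rw [cyc_apply, cyc_apply, map_mul]; rfl⟩

lemma mem_of_coprime {h : End F V} {v w : V} {p g : F[X]} (hc : IsCoprime p g)
    (h1 : aeval h p w ∈ cycW h v) (h2 : aeval h g w ∈ cycW h v) : w ∈ cycW h v := by
  obtain ⟨a, b, hab⟩ := hc
  have : w = aeval h a (aeval h p w) + aeval h b (aeval h g w) := by
    have := congrArg (fun r => aeval h r w) hab
    simp only [map_add, map_mul, map_one, LinearMap.add_apply] at this
    exact this.symm
  rw [this]
  exact add_mem (aeval_mem_cycW _ h1) (aeval_mem_cycW _ h2)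

lemma zero_of_coprime {h : End F V} {w : V} {p g : F[X]} (hc : IsCoprime p g)
    (h1 : aeval h p w = 0) (h2 : aeval h g w = 0) : w = 0 := by
  obtain ⟨a, b, hab⟩ := hc
  have := congrArg (fun r => aeval h r w) hab
  simp only [map_add, map_mul, map_one, LinearMap.add_apply, Module.End.mul_apply, h1, h2,
    map_zero, add_zero] at this
  exact this.symm

/-- map from `F[X]/f` -/
noncomputable def T1 {f : F[X]} (hf : f.Monic) (h : End F V) (v : V) : AdjoinRoot f →ₗ[F] V :=
  (cyc h v).comp (AdjoinRoot.modByMonicHom hf)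

lemma T1_apply {f : F[X]} (hf : f.Monic) (h : End F V) (v : V) (x : AdjoinRoot f) :
    T1 hf h v x = aeval h (AdjoinRoot.modByMonicHom hf x) v := rfl

lemma T1_mk {f : F[X]} (hf : f.Monic) {h : End F V} {v : V} (hv : aeval h f v = 0) (p : F[X]) :
    T1 hf h v (AdjoinRoot.mk f p) = aeval h p v := by
  rw [T1_apply, AdjoinRoot.modByMonicHom_mk]
  conv_rhs => rw [← modByMonic_add_div p f, mul_comm]
  simp [hv]

lemma range_T1 {f : F[X]} (hf : f.Monic) {h : End F V} {v : V} (hv : aeval h f v = 0) :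
    LinearMap.range (T1 hf h v) = cycW h v := by
  ext w
  constructor
  · rintro ⟨x, rfl⟩
    exact ⟨_, rfl⟩
  · rintro ⟨p, rfl⟩
    exact ⟨AdjoinRoot.mk f p, T1_mk hf hv p⟩

lemma T1_mul {f : F[X]} (hf : f.Monic) {h : End F V} {v : V} (hv : aeval h f v = 0) 
    (x : AdjoinRoot f) : T1 hf h v (AdjoinRoot.root f * x) = h (T1 hf h v x) := by
  obtain ⟨p, rfl⟩ := AdjoinRoot.mk_surjective x
  rw [← AdjoinRoot.mk_X, ← map_mul, T1_mk hf hv, T1_mk hf hv]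
  simp

lemma T1_injective {f : F[X]} (hf : f.Monic) (hi : Irreducible f) {h : End F V} {v : V}
    (hv : aeval h f v = 0) (hv0 : v ≠ 0) : Function.Injective (T1 hf h v) := by
  rw [injective_iff_map_eq_zero]
  intro x hx
  obtain ⟨p, rfl⟩ := AdjoinRoot.mk_surjective x
  rw [T1_mk hf hv] at hx
  rw [AdjoinRoot.mk_eq_zero]
  by_contra hnd
  exact hv0 (zero_of_coprime (hi.coprime_iff_not_dvd.2 hnd) hv hx)

lemma finrank_cycW {f : F[X]} (hf : f.Monic) (hi : Irreducible f) {h : End F V} {v : V}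
    (hv : aeval h f v = 0) (hv0 : v ≠ 0) : finrank F (cycW h v) = f.natDegree := by
  rw [← range_T1 hf hv, LinearMap.finrank_range_of_inj (T1_injective hf hi hv hv0),
    finrank_adjoinRoot f hf]

/-- top coefficient functional -/
noncomputable def lam {g : F[X]} (hg : g.Monic) : AdjoinRoot g →ₗ[F] F :=
  (lcoeff F g.natDegree).comp ((LinearMap.mulLeft F X).comp (AdjoinRoot.modByMonicHom hg))

lemma lam_spec {g : F[X]} (hg : g.Monic) (hpos : 0 < g.natDegree) (r : AdjoinRoot g) :
    X * AdjoinRoot.modByMonicHom hg r =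
      AdjoinRoot.modByMonicHom hg (AdjoinRoot.root g * r) + C (lam hg r) * g := by
  obtain ⟨p, rfl⟩ := AdjoinRoot.mk_surjective r
  rw [← AdjoinRoot.mk_X, ← map_mul, lam]
  simp only [LinearMap.comp_apply, AdjoinRoot.modByMonicHom_mk, LinearMap.mulLeft_apply,
    lcoeff_apply]
  set r := p %ₘ g
  set c := (X * r).coeff g.natDegree
  have hr : r.degree < g.degree := degree_modByMonic_lt _ hg
  have h1 : (X * p) %ₘ g = X * r - C c * g := by
    refine (div_modByMonic_unique (X * (p /ₘ g) + C c) _ hg ⟨?_, ?_⟩).2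
    · have := modByMonic_add_div p g
      simp only [r]
      linear_combination X * this
    · have hg1 : g.degree = (g.natDegree : ℕ) := degree_eq_natDegree hg.ne_zero
      rw [hg1, degree_lt_iff_coeff_zero]
      intro m hm
      rw [coeff_sub, coeff_C_mul]
      rcases hm.lt_or_eq with hlt | heq
      · rw [coeff_eq_zero_of_natDegree_lt hlt, mul_zero, sub_zero]
        obtain ⟨k, rfl⟩ : ∃ k, m = k + 1 := ⟨m - 1, by omega⟩
        rw [coeff_X_mul]
        apply coeff_eq_zero_of_degree_lt
        rw [hg1] at hr
        refine hr.trans_le ?_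
        exact_mod_cast (by omega : g.natDegree ≤ k)
      · rw [← heq, hg.coeff_natDegree]
        simp [c]
  rw [h1]
  ring

/-- the model endomorphism for an extension of `F[X]/g` by `F[X]/f` -/
noncomputable def sig (f : F[X]) {g : F[X]} (hg : g.Monic) (a : AdjoinRoot f) :
    (AdjoinRoot f × AdjoinRoot g) →ₗ[F] (AdjoinRoot f × AdjoinRoot g) :=
  (LinearMap.prodMap (LinearMap.mulLeft F (AdjoinRoot.root f))
    (LinearMap.mulLeft F (AdjoinRoot.root g))).comp
    (LinearMap.transvection ((lam hg).comp (LinearMap.snd F _ _)) (a, 0))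

lemma sig_apply (f : F[X]) {g : F[X]} (hg : g.Monic) (a : AdjoinRoot f)
    (x : AdjoinRoot f × AdjoinRoot g) : sig f hg a x =
      (AdjoinRoot.root f * (x.1 + lam hg x.2 • a), AdjoinRoot.root g * x.2) := by
  simp [sig, LinearMap.transvection.apply]

lemma det_sig {f : F[X]} (hf : f.Monic) {g : F[X]} (hg : g.Monic) (a : AdjoinRoot f) :
    LinearMap.det (sig f hg a) = Algebra.norm F (AdjoinRoot.root f) *
      Algebra.norm F (AdjoinRoot.root g) := by
  have := hf.finite_adjoinRoot
  have := hg.finite_adjoinRoot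
  rw [sig, LinearMap.det_comp, LinearMap.det_prodMap, LinearMap.transvection.det]
  simp only [LinearMap.comp_apply, LinearMap.snd_apply, map_zero, add_zero, mul_one]
  rfl

lemma sig_injective {s : ℕ} (h2 : (2 : F) ≠ 0) {f g : F[X]} (hf : Ty s f) (hg : Ty s g)
    (a : AdjoinRoot f) : Function.Injective (sig f hg.1 a) := by
  have : Fact (Irreducible f) := ⟨hf.2.1⟩
  have : Fact (Irreducible g) := ⟨hg.2.1⟩
  have hf0 := hf.root_ne_zero h2
  have hg0 := hg.root_ne_zero h2
  rw [injective_iff_map_eq_zero]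
  rintro ⟨p, r⟩ hx
  rw [sig_apply, Prod.mk_eq_zero] at hx
  have hr : r = 0 := (mul_eq_zero.1 hx.2).resolve_left hg0
  subst hr
  have hp := (mul_eq_zero.1 hx.1).resolve_left hf0
  simp only [map_zero, zero_smul, add_zero] at hp
  rw [hp]; rfl

/-- map from the extension -/
noncomputable def T2 {f g : F[X]} (hf : f.Monic) (hg : g.Monic) (h : End F V) (v w : V) :
    (AdjoinRoot f × AdjoinRoot g) →ₗ[F] V := (T1 hf h v).coprod (T1 hg h w)

lemma T2_apply {f g : F[X]} (hf : f.Monic) (hg : g.Monic) (h : End F V) (v w : V)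
    (x : AdjoinRoot f × AdjoinRoot g) : T2 hf hg h v w x = T1 hf h v x.1 + T1 hg h w x.2 := rfl

lemma T2_sig {f g : F[X]} (hf : f.Monic) (hg : g.Monic) (hpos : 0 < g.natDegree)
    {h : End F V} {v w : V} (hv : aeval h f v = 0)
    (a : AdjoinRoot f) (hw : aeval h g w = T1 hf h v (AdjoinRoot.root f * a)) (x) :
    h (T2 hf hg h v w x) = T2 hf hg h v w (sig f hg a x) := by
  rw [sig_apply, T2_apply, T2_apply]
  simp only
  rw [T1_mul hf hv, map_add, map_add, map_add, map_smul, map_smul, ← T1_mul hf hv a, ← hw,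
    T1_apply hg, T1_apply hg]
  have h1 : h (aeval h (AdjoinRoot.modByMonicHom hg x.2) w) =
      aeval h (X * AdjoinRoot.modByMonicHom hg x.2) w := by simp
  rw [h1, lam_spec hg hpos]
  simp only [map_add, map_mul, aeval_C, LinearMap.add_apply, Module.End.mul_apply,
    Module.algebraMap_end_apply]
  abel

lemma T2_mem {f g : F[X]} (hf : f.Monic) (hg : g.Monic) (hi : Irreducible g)
    {h : End F V} {v w : V} 
    (hw : aeval h g w ∈ cycW h v) (hw0 : w ∉ cycW h v) (x : AdjoinRoot f × AdjoinRoot g)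
    (hx : T2 hf hg h v w x ∈ cycW h v) : x.2 = 0 := by
  rw [T2_apply] at hx
  have h1 : T1 hf h v x.1 ∈ cycW h v := ⟨_, rfl⟩
  have h2 : T1 hg h w x.2 ∈ cycW h v := (Submodule.add_mem_iff_right _ h1).1 hx
  rw [T1_apply] at h2
  by_contra hne
  apply hw0
  refine mem_of_coprime (IsCoprime.symm (hi.coprime_iff_not_dvd.2 fun hd => hne ?_)) h2 hw
  rw [← AdjoinRoot.mk_eq_zero, AdjoinRoot.mk_leftInverse] at hd
  exact hd

lemma T2_injective {f g : F[X]} (hf : f.Monic) (hg : g.Monic) (hi : Irreducible g)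
    (hfi : Irreducible f) {h : End F V} {v w : V} (hv : aeval h f v = 0) (hv0 : v ≠ 0)
    (hw : aeval h g w ∈ cycW h v) (hw0 : w ∉ cycW h v) :
    Function.Injective (T2 hf hg h v w) := by
  rw [injective_iff_map_eq_zero]
  intro x hx
  have h1 := T2_mem hf hg hi hw hw0 x (by rw [hx]; exact zero_mem _)
  rw [T2_apply, h1, map_zero, add_zero] at hx
  exact Prod.ext ((injective_iff_map_eq_zero _).1 (T1_injective hf hfi hv hv0) _ hx) h1

lemma T2_aeval_mem {f g : F[X]} (hf : f.Monic) (hg : g.Monic)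
    {h : End F V} {v w : V} 
    (hw : aeval h g w ∈ cycW h v) (x : AdjoinRoot f × AdjoinRoot g) :
    aeval h g (T2 hf hg h v w x) ∈ cycW h v := by
  rw [T2_apply, map_add]
  refine add_mem (aeval_mem_cycW _ ⟨_, rfl⟩) ?_
  rw [T1_apply, ← Module.End.mul_apply, ← map_mul, mul_comm, map_mul, Module.End.mul_apply]
  exact aeval_mem_cycW _ hw

lemma T1_one {f : F[X]} (hf : f.Monic) (hpos : 0 < f.natDegree) (h : End F V) (v : V) :
    T1 hf h v 1 = v := by
  rw [T1_apply, ← map_one (AdjoinRoot.mk f), AdjoinRoot.modByMonicHom_mk,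
    (modByMonic_eq_self_iff hf).2]
  · simp
  · rw [degree_one]; exact natDegree_pos_iff_degree_pos.1 hpos

end Cyc

section Count
variable {F V : Type*} [Field F] [Finite F] [AddCommGroup V] [Module F V] [Finite V]

/-- pairs `(h,v)` with `v ≠ 0`, `f(h)v = 0` -/
abbrev QQ (H : Subgroup (V ≃ₗ[F] V)) (f : F[X]) : Type _ :=
  {p : H × V // p.2 ≠ 0 ∧ aeval (p.1.1.toLinearMap : End F V) f p.2 = 0}

/-- bad pairs -/
abbrev BB (H : Subgroup (V ≃ₗ[F] V)) (f g : F[X]) : Type _ :=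
  {p : QQ H f // ∃ w, w ∉ cycW (p.1.1.1.toLinearMap : End F V) p.1.2 ∧
    aeval (p.1.1.1.toLinearMap : End F V) g w ∈ cycW (p.1.1.1.toLinearMap : End F V) p.1.2}

instance finiteEquiv : Finite (V ≃ₗ[F] V) := DFunLike.finite _
instance finiteHom {N : Type*} [AddCommGroup N] [Module F N] [Finite N] : Finite (N →ₗ[F] V) :=
  DFunLike.finite _

lemma card_QQ_ge (h2 : (2 : F) ≠ 0) (H : Subgroup (V ≃ₗ[F] V))
    (hH : ∀ g : V ≃ₗ[F] V, LinearEquiv.det g = 1 → g ∈ H) {s : ℕ} {f : F[X]} (hf : Ty s f)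
    (hlt : f.natDegree < finrank F V) : Nat.card H ≤ Nat.card (QQ H f) := by
  have := hf.1.finite_adjoinRoot
  have : Fact (Irreducible f) := ⟨hf.2.1⟩
  let σ : AdjoinRoot f →ₗ[F] AdjoinRoot f := LinearMap.mulLeft F (AdjoinRoot.root f)
  have hσ : Function.Injective σ := mul_right_injective₀ (hf.root_ne_zero h2)
  rw [← card_pairs H hH (by rwa [finrank_adjoinRoot f hf.1]) σ hσ]
  have key : ∀ p : Pairs H σ, ∀ r : F[X], p.1.2 (AdjoinRoot.mk f r) =
      aeval (p.1.1.1.toLinearMap : End F V) r (p.1.2 1) := by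
    rintro ⟨⟨h, T⟩, hT, hhT⟩ r
    induction r using Polynomial.induction_on' with
    | add p q hp hq => simp only [map_add, LinearMap.add_apply] at hp hq ⊢; rw [hp, hq]
    | monomial n c =>
      induction n with
      | zero =>
        simp only [monomial_zero_left, aeval_C, AdjoinRoot.mk_C]
        rw [Module.algebraMap_end_apply, ← map_smul, Algebra.smul_def, mul_one]
        rfl
      | succ n ih =>
        rw [← monomial_mul_X, mul_comm, map_mul (AdjoinRoot.mk f), map_mul (aeval _),
          AdjoinRoot.mk_X, aeval_X, Module.End.mul_apply, ← ih]
        exact (hhT _).symm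
  refine Nat.card_le_card_of_injective
    (fun p : Pairs H σ => (⟨⟨p.1.1, p.1.2 1⟩, ?_, ?_⟩ : QQ H f)) ?_
  · intro h0
    have := p.2.1 (h0.trans (map_zero p.1.2).symm)
    exact one_ne_zero this
  · simp only
    rw [← key, AdjoinRoot.mk_self, map_zero]
  · intro p p' hpp
    have h1 : p.1.1 = p'.1.1 := congrArg (fun z => z.1.1) hpp
    have h3 : p.1.2 1 = p'.1.2 1 := congrArg (fun z => z.1.2) hpp
    apply Subtype.ext
    refine Prod.ext h1 ?_
    ext x
    obtain ⟨r, rfl⟩ := AdjoinRoot.mk_surjective x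
    rw [key, key, h1, h3]

lemma card_BB_le (h2 : (2 : F) ≠ 0) (H : Subgroup (V ≃ₗ[F] V)) {s : ℕ} {f g : F[X]}
    (hf : Ty s f) (hg : Ty s g) (c : ℕ)
    (hc : ∀ a : AdjoinRoot f, Nat.card (Pairs H (sig f hg.1 a)) ≤ c) :
    Nat.card (BB H f g) * (Nat.card F ^ g.natDegree - 1) ≤ c := by
  have hfin := finite_adjoinRoot f hf.1
  have hfin' := finite_adjoinRoot g hg.1
  have : Fact (Irreducible f) := ⟨hf.2.1⟩
  have : Fact (Irreducible g) := ⟨hg.2.1⟩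
  have hfpos := hf.2.1.natDegree_pos
  have hgpos := hg.2.1.natDegree_pos
  let ww : BB H f g → V := fun p => p.2.choose
  have hww : ∀ p : BB H f g, ww p ∉ cycW (p.1.1.1.1.toLinearMap : End F V) p.1.1.2 ∧
    aeval (p.1.1.1.1.toLinearMap : End F V) g (ww p) ∈
      cycW (p.1.1.1.1.toLinearMap : End F V) p.1.1.2 := fun p => p.2.choose_spec
  -- the new vector
  let W' : BB H f g → AdjoinRoot f × AdjoinRoot g → V := fun p x =>
    T2 hf.1 hg.1 (p.1.1.1.1.toLinearMap : End F V) p.1.1.2 (ww p) x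
  have hW' : ∀ p : BB H f g, ∀ x : AdjoinRoot f × {r : AdjoinRoot g // r ≠ 0},
      W' p (x.1, x.2.1) ∉ cycW (p.1.1.1.1.toLinearMap : End F V) p.1.1.2 ∧
    aeval (p.1.1.1.1.toLinearMap : End F V) g (W' p (x.1, x.2.1)) ∈
      cycW (p.1.1.1.1.toLinearMap : End F V) p.1.1.2 := fun p x =>
    ⟨fun hx => x.2.2 (T2_mem hf.1 hg.1 hg.2.1 (hww p).2 (hww p).1 _ hx),
      T2_aeval_mem hf.1 hg.1 (hww p).2 _⟩
  have hex : ∀ p : BB H f g, ∀ x : AdjoinRoot f × {r : AdjoinRoot g // r ≠ 0},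
      ∃ a : AdjoinRoot f, aeval (p.1.1.1.1.toLinearMap : End F V) g (W' p (x.1, x.2.1)) =
        T1 hf.1 (p.1.1.1.1.toLinearMap : End F V) p.1.1.2 (AdjoinRoot.root f * a) := by
    intro p x
    have h1 := (hW' p x).2
    rw [← range_T1 hf.1 p.1.2.2] at h1
    obtain ⟨a, ha⟩ := h1
    refine ⟨(AdjoinRoot.root f)⁻¹ * a, ?_⟩
    rw [mul_inv_cancel_left₀ (hf.root_ne_zero h2), ha]
  choose aa haa using hex
  let Φ : BB H f g × (AdjoinRoot f × {r : AdjoinRoot g // r ≠ 0}) →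
      Σ a : AdjoinRoot f, Pairs H (sig f hg.1 a) := fun y =>
    ⟨aa y.1 y.2, ⟨⟨y.1.1.1.1, T2 hf.1 hg.1 (y.1.1.1.1.1.toLinearMap : End F V) y.1.1.1.2
      (W' y.1 (y.2.1, y.2.2.1))⟩,
      T2_injective hf.1 hg.1 hg.2.1 hf.2.1 y.1.1.2.2 y.1.1.2.1 (hW' y.1 y.2).2 (hW' y.1 y.2).1,
      fun x => T2_sig hf.1 hg.1 hgpos y.1.1.2.2 _ (haa y.1 y.2) x⟩⟩
  -- recover data
  let rec1 : (Σ a : AdjoinRoot f, Pairs H (sig f hg.1 a)) → H × V × V := fun z =>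
    ⟨z.2.1.1, z.2.1.2 (1, 0), z.2.1.2 (0, 1)⟩
  have hrec : ∀ y, rec1 (Φ y) = ⟨y.1.1.1.1, y.1.1.1.2, W' y.1 (y.2.1, y.2.2.1)⟩ := by
    intro y
    simp only [rec1, Φ, T2_apply, map_zero, add_zero, zero_add, T1_one hf.1 hfpos,
      T1_one hg.1 hgpos]
  have hinj : Function.Injective Φ := by
    intro y y' hyy
    have h1 := congrArg rec1 hyy
    rw [hrec, hrec] at h1
    simp only [Prod.mk.injEq] at h1
    obtain ⟨e1, e2, e3⟩ := h1
    obtain ⟨p, x1, x2⟩ := y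
    obtain ⟨p', x1', x2'⟩ := y'
    have hp : p = p' := Subtype.ext (Subtype.ext (Prod.ext e1 e2))
    subst hp
    have h3 := T2_injective hf.1 hg.1 hg.2.1 hf.2.1 p.1.2.2 p.1.2.1 (hww p).2 (hww p).1 e3
    simp only [Prod.mk.injEq] at h3
    obtain ⟨rfl, h4⟩ := h3
    rw [Subtype.ext h4]
  have hcard := Nat.card_le_card_of_injective Φ hinj
  have := Fintype.ofFinite (AdjoinRoot f)
  rw [Nat.card_prod, Nat.card_prod, Nat.card_sigma] at hcard
  have hne : Nat.card {r : AdjoinRoot g // r ≠ 0} = Nat.card F ^ g.natDegree - 1 := by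
    rw [← card_adjoinRoot g hg.1]
    classical
    have := Fintype.ofFinite (AdjoinRoot g)
    rw [Nat.card_eq_fintype_card, Nat.card_eq_fintype_card, Fintype.card_subtype_compl,
      Fintype.card_subtype_eq]
  have hsum : ∑ a : AdjoinRoot f, Nat.card (Pairs H (sig f hg.1 a)) ≤
      Nat.card (AdjoinRoot f) * c := by
    refine (Finset.sum_le_sum fun a _ => hc a).trans ?_
    simp
  rw [hne] at hcard
  have hfc : 0 < Nat.card (AdjoinRoot f) := Nat.card_pos
  have := hcard.trans hsum
  rw [mul_left_comm] at this
  exact Nat.le_of_mul_le_mul_left this hfc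

end Count
end Aux12


namespace Aux12
open Polynomial Module

section CountD
variable {F V : Type*} [Field F] [Finite F] [AddCommGroup V] [Module F V] [Finite V]

lemma card_det_image (H : Subgroup (V ≃ₗ[F] V))
    (hH : ∀ g : V ≃ₗ[F] V, LinearEquiv.det g = 1 → g ∈ H) (hpos : 0 < finrank F V) :
    Nat.card (H.map LinearEquiv.det) * Nat.card (V ≃ₗ[F] V) = (Nat.card F - 1) * Nat.card H := by
  have hsurj : Function.Surjective (LinearEquiv.det : (V ≃ₗ[F] V) →* Fˣ) := by
    intro δ
    obtain ⟨t, ht, -⟩ := exists_det_fix (0 : PUnit →ₗ[F] V) (by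
      rw [finrank_zero_of_subsingleton]; exact hpos) δ
    exact ⟨t, ht⟩
  have h1 : (H.map LinearEquiv.det).index = H.index :=
    Subgroup.index_map_eq H hsurj (fun g hg => hH g hg)
  have h2 := H.card_mul_index
  have h3 := (H.map LinearEquiv.det).card_mul_index
  have h4 : Nat.card Fˣ = Nat.card F - 1 := Nat.card_units F
  rw [h1, h4] at h3
  rw [← h2, ← h3]
  ring

lemma BB_deg {s : ℕ} {H : Subgroup (V ≃ₗ[F] V)} {f g : F[X]} (hf : Ty s f) (hg : Ty s g)
    (p : BB H f g) : f.natDegree + g.natDegree ≤ finrank F V := by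
  have := hf.1.finite_adjoinRoot
  have := hg.1.finite_adjoinRoot
  obtain ⟨w, hw, hw'⟩ := p.2
  have := LinearMap.finrank_le_finrank_of_injective
    (T2_injective hf.1 hg.1 hg.2.1 hf.2.1 p.1.2.2 p.1.2.1 hw' hw)
  rwa [finrank_prod, finrank_adjoinRoot f hf.1, finrank_adjoinRoot g hg.1] at this

lemma sum_BB_le (h2 : (2 : F) ≠ 0) (H : Subgroup (V ≃ₗ[F] V))
    (hH : ∀ g : V ≃ₗ[F] V, LinearEquiv.det g = 1 → g ∈ H) {s : ℕ} {f : F[X]} (hf : Ty s f)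
    (e : ℕ) (he : 0 < e) :
    (∑ g ∈ tyF h2 s e, Nat.card (BB H f g)) * e ≤ Nat.card H := by
  classical
  have hq1 : 1 < Nat.card F := Finite.one_lt_card
  have hqe : 1 < Nat.card F ^ e := Nat.one_lt_pow he.ne' hq1
  have := hf.1.finite_adjoinRoot
  have hpos : 0 < Nat.card F ^ e - 1 := by omega
  rcases lt_trichotomy (f.natDegree + e) (finrank F V) with hlt | heq | hgt
  · have h1 : ∀ g ∈ tyF h2 s e, Nat.card (BB H f g) * (Nat.card F ^ e - 1) ≤ Nat.card H := by
      intro g hg0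
      obtain ⟨hg, rfl⟩ := (mem_tyF h2 s e g).1 hg0
      have := hg.1.finite_adjoinRoot
      refine card_BB_le h2 H hf hg _ fun a => (card_pairs H hH ?_ _ (sig_injective h2 hf hg a)).le
      rwa [finrank_prod, finrank_adjoinRoot f hf.1, finrank_adjoinRoot g hg.1]
    have h3 := Finset.sum_le_sum h1
    rw [← Finset.sum_mul, Finset.sum_const, smul_eq_mul] at h3
    have h4 := card_tyF_le h2 s e he
    refine Nat.le_of_mul_le_mul_right ?_ hpos
    calc _ = ((∑ g ∈ tyF h2 s e, Nat.card (BB H f g)) * (Nat.card F ^ e - 1)) * e := by ring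
      _ ≤ ((tyF h2 s e).card * Nat.card H) * e := Nat.mul_le_mul_right _ h3
      _ = ((tyF h2 s e).card * e) * Nat.card H := by ring
      _ ≤ (Nat.card F ^ e - 1) * Nat.card H := Nat.mul_le_mul_right _ h4
      _ = _ := by ring
  · set D := H.map (LinearEquiv.det : (V ≃ₗ[F] V) →* Fˣ) with hD
    have : Fintype D := Fintype.ofFinite _
    let R : F[X] → D → Prop := fun g u => Algebra.norm F (AdjoinRoot.root f) *
      Algebra.norm F (AdjoinRoot.root g) = ((u : Fˣ) : F)
    let T := (tyF h2 s e).filter fun g => ∃ u : D, R g u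
    have hkey : ∀ g ∈ tyF h2 s e, ∀ a : AdjoinRoot f, ∀ hg : Ty s g,
        Nonempty (Pairs H (sig f hg.1 a)) → g ∈ T := by
      intro g hg a hgt ⟨p⟩
      have := hgt.1.finite_adjoinRoot
      obtain ⟨-, hge⟩ := (mem_tyF h2 s e g).1 hg
      have h1 := det_of_pairs H (by
        rw [finrank_prod, finrank_adjoinRoot f hf.1, finrank_adjoinRoot g hgt.1, hge, heq]) _ p
      rw [det_sig hf.1] at h1
      exact Finset.mem_filter.2 ⟨hg, ⟨⟨_, Subgroup.mem_map_of_mem _ p.1.1.2⟩, h1.symm⟩⟩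
    have h1 : ∀ g ∈ T, Nat.card (BB H f g) * (Nat.card F ^ e - 1) ≤ Nat.card (V ≃ₗ[F] V) := by
      intro g hg0
      obtain ⟨hg, rfl⟩ := (mem_tyF h2 s e g).1 (Finset.mem_filter.1 hg0).1
      have := hg.1.finite_adjoinRoot
      refine card_BB_le h2 H hf hg _ fun a => card_pairs_full H ?_ _
      rwa [finrank_prod, finrank_adjoinRoot f hf.1, finrank_adjoinRoot g hg.1]
    have h0 : ∀ g ∈ tyF h2 s e, g ∉ T → Nat.card (BB H f g) = 0 := by
      intro g hg hgT
      obtain ⟨hg', hge⟩ := (mem_tyF h2 s e g).1 hg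
      have h3 := card_BB_le h2 H hf hg' 0 fun a => by
        by_contra hne
        have : Nat.card (Pairs H (sig f hg'.1 a)) ≠ 0 := by omega
        exact hgT (hkey g hg a hg' (Nat.card_ne_zero.1 this).1)
      rw [hge] at h3
      have := Nat.le_zero.1 h3
      exact (Nat.mul_eq_zero.1 this).resolve_right hpos.ne'
    have hsumT : ∑ g ∈ T, Nat.card (BB H f g) = ∑ g ∈ tyF h2 s e, Nat.card (BB H f g) :=
      Finset.sum_subset (Finset.filter_subset _ _) h0
    have h3 := Finset.sum_le_sum h1
    rw [← Finset.sum_mul, Finset.sum_const, smul_eq_mul, hsumT] at h3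
    have hTc : T.card * e ≤ Nat.card D * ((Nat.card F ^ e - 1) / (Nat.card F - 1)) := by
      have hsub : T ⊆ (Finset.univ : Finset D).biUnion
          fun u => (tyF h2 s e).filter fun g => R g u := by
        intro g hg
        obtain ⟨hg, u, hu⟩ := Finset.mem_filter.1 hg
        exact Finset.mem_biUnion.2 ⟨u, Finset.mem_univ _, Finset.mem_filter.2 ⟨hg, hu⟩⟩
      have hc := (Finset.card_le_card hsub).trans Finset.card_biUnion_le
      calc T.card * e ≤ (∑ u : D, ((tyF h2 s e).filter fun g => R g u).card) * e :=
            Nat.mul_le_mul_right _ hc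
        _ = ∑ u : D, ((tyF h2 s e).filter fun g => R g u).card * e := Finset.sum_mul _ _ _
        _ ≤ ∑ u : D, ((Nat.card F ^ e - 1) / (Nat.card F - 1)) := by
            refine Finset.sum_le_sum fun u _ => ?_
            refine card_tyF_norm_le s e he
              ((Algebra.norm F (AdjoinRoot.root f))⁻¹ * ((u : Fˣ) : F)) _ fun g hg => ?_
            obtain ⟨hg, hu⟩ := Finset.mem_filter.1 hg
            obtain ⟨hg', hge⟩ := (mem_tyF h2 s e g).1 hg
            refine ⟨hg', hge, ?_⟩
            have : Fact (Irreducible f) := ⟨hf.2.1⟩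
            have hn : Algebra.norm F (AdjoinRoot.root f) ≠ 0 :=
              Algebra.norm_ne_zero_iff.2 (hf.root_ne_zero h2)
            rw [← hu, inv_mul_cancel_left₀ hn]
        _ = _ := by simp
    have hdet := card_det_image H hH (by omega)
    have hdiv : (Nat.card F ^ e - 1) / (Nat.card F - 1) * (Nat.card F - 1) ≤ Nat.card F ^ e - 1 :=
      Nat.div_mul_le_self _ _
    rw [← hD] at hdet
    set B := ∑ g ∈ tyF h2 s e, Nat.card (BB H f g)
    set z := Nat.card F ^ e - 1
    set y := z / (Nat.card F - 1)
    have hq1' : 0 < Nat.card F - 1 := by omega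
    refine Nat.le_of_mul_le_mul_right (c := z * (Nat.card F - 1)) ?_ (Nat.mul_pos hpos hq1')
    calc _ = (B * z) * (e * (Nat.card F - 1)) := by ring
      _ ≤ (T.card * Nat.card (V ≃ₗ[F] V)) * (e * (Nat.card F - 1)) := Nat.mul_le_mul_right _ h3
      _ = (T.card * e) * (Nat.card (V ≃ₗ[F] V) * (Nat.card F - 1)) := by ring
      _ ≤ (Nat.card D * y) * (Nat.card (V ≃ₗ[F] V) * (Nat.card F - 1)) :=
        Nat.mul_le_mul_right _ hTc
      _ = (y * (Nat.card F - 1)) * (Nat.card D * Nat.card (V ≃ₗ[F] V)) := by ring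
      _ ≤ z * (Nat.card D * Nat.card (V ≃ₗ[F] V)) := Nat.mul_le_mul_right _ hdiv
      _ = _ := by rw [hdet]; ring
  · have : ∑ g ∈ tyF h2 s e, Nat.card (BB H f g) = 0 := by
      refine Finset.sum_eq_zero fun g hg => ?_
      obtain ⟨hg', hge⟩ := (mem_tyF h2 s e g).1 hg
      rw [Nat.card_eq_zero]
      left
      refine ⟨fun p => ?_⟩
      have := BB_deg hf hg' p
      omega
    rw [this]; simp

/-- the bad pairs for `f` -/
abbrev Bad (s : ℕ) (H : Subgroup (V ≃ₗ[F] V)) (f : F[X]) : Type _ :=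
  {p : QQ H f // ∃ g : F[X], Ty s g ∧ ∃ w, w ∉ cycW (p.1.1.1.toLinearMap : End F V) p.1.2 ∧
    aeval (p.1.1.1.toLinearMap : End F V) g w ∈ cycW (p.1.1.1.toLinearMap : End F V) p.1.2}

lemma card_Bad_le (h2 : (2 : F) ≠ 0) (hq : Odd (Nat.card F)) {b s : ℕ}
    (hs : ExpCond (Nat.card F) b s) (H : Subgroup (V ≃ₗ[F] V))
    (hH : ∀ g : V ≃ₗ[F] V, LinearEquiv.det g = 1 → g ∈ H) {f : F[X]} (hf : Ty s f) :
    (Nat.card (Bad s H f) : ℝ) ≤ Nat.card H *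
      ((∑ j ∈ Finset.Icc 1 (finrank F V), (1 / (j : ℝ))) / 2 ^ b) := by
  classical
  have hb : 0 < 2 ^ b := by positivity
  have hnat : Nat.card (Bad s H f) ≤ ∑ j ∈ Finset.Icc 1 (finrank F V),
      ∑ g ∈ tyF h2 s (2 ^ b * j), Nat.card (BB H f g) := by
    let I := (j : Finset.Icc 1 (finrank F V)) × (g : tyF h2 s (2 ^ b * j)) × BB H f g.1
    have hex : ∀ p : Bad s H f, ∃ i : I, i.2.2.1 = p.1 := by
      rintro ⟨p, g, hg, w, hw⟩
      obtain ⟨j, hj⟩ := hg.dvd_natDegree h2 hq hs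
      have hdeg := BB_deg hf hg (⟨p, w, hw⟩ : BB H f g)
      have hgp := hg.2.1.natDegree_pos
      have hj1 : 0 < j := by
        rcases Nat.eq_zero_or_pos j with rfl | h
        · omega
        · exact h
      have hjn : j ≤ finrank F V := by
        have : j ≤ 2 ^ b * j := Nat.le_mul_of_pos_left _ hb
        omega
      exact ⟨⟨⟨j, Finset.mem_Icc.2 ⟨hj1, hjn⟩⟩, ⟨g, (mem_tyF _ _ _ _).2 ⟨hg, hj⟩⟩,
        ⟨p, w, hw⟩⟩, rfl⟩
    choose φ hφ using hex
    have hinj : Function.Injective φ := by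
      intro p p' h
      apply Subtype.ext
      rw [← hφ p, ← hφ p', h]
    have := Nat.card_le_card_of_injective φ hinj
    refine this.trans (le_of_eq ?_)
    rw [Nat.card_sigma, ← Finset.sum_coe_sort (Finset.Icc 1 (finrank F V))]
    refine Finset.sum_congr rfl fun j _ => ?_
    rw [Nat.card_sigma, ← Finset.sum_coe_sort (tyF h2 s (2 ^ b * j))]
  have hreal : (Nat.card (Bad s H f) : ℝ) ≤ ∑ j ∈ Finset.Icc 1 (finrank F V),
      ((∑ g ∈ tyF h2 s (2 ^ b * j), Nat.card (BB H f g) : ℕ) : ℝ) := by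
    exact_mod_cast hnat
  refine hreal.trans ?_
  rw [Finset.sum_div, Finset.mul_sum]
  refine Finset.sum_le_sum fun j hj => ?_
  have hj1 := (Finset.mem_Icc.1 hj).1
  have h3 := sum_BB_le h2 H hH hf (2 ^ b * j) (by positivity)
  have h4 : ((∑ g ∈ tyF h2 s (2 ^ b * j), Nat.card (BB H f g) : ℕ) : ℝ) * (2 ^ b * j) ≤
      Nat.card H := by exact_mod_cast h3
  have hj' : (0 : ℝ) < j := by exact_mod_cast hj1
  rw [div_div, mul_one_div, le_div_iff₀ (by positivity)]
  linarith

end CountD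
end Aux12


namespace Aux12
open Polynomial Module

section Good
variable {F V : Type*} [Field F] [AddCommGroup V] [Module F V]

/-- good pairs -/
def GP (s : ℕ) (f : F[X]) (h : End F V) (v : V) : Prop :=
  v ≠ 0 ∧ aeval h f v = 0 ∧ ∀ g : F[X], Ty s g → ∀ w, aeval h g w ∈ cycW h v → w ∈ cycW h v

lemma exists_irred_of_aeval {h : End F V} {v : V} (P : F[X]) (hP : P ≠ 0) :
    ∀ w, w ∉ cycW h v → aeval h P w ∈ cycW h v →
      ∃ g : F[X], g.Monic ∧ Irreducible g ∧ g ∣ P ∧ ∃ w, w ∉ cycW h v ∧ aeval h g w ∈ cycW h v := by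
  classical
  induction P using UniqueFactorizationMonoid.induction_on_prime with
  | h₁ => exact absurd rfl hP
  | h₂ u hu =>
    intro w hw hw'
    obtain ⟨c, hc⟩ := IsUnit.exists_left_inv hu
    exact absurd (mem_of_coprime (p := u) (g := u) ⟨c, 0, by rw [hc]; simp⟩ hw' hw') hw
  | h₃ a p ha hp ih =>
    intro w hw hw'
    by_cases hm : aeval h a w ∈ cycW h v
    · obtain ⟨g, h1, h2, h3, h4⟩ := ih ha w hw hm
      exact ⟨g, h1, h2, h3.mul_left _, h4⟩
    · rw [map_mul, Module.End.mul_apply] at hw'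
      refine ⟨normalize p, monic_normalize hp.ne_zero,
        (associated_normalize p).irreducible hp.irreducible,
        ((associated_normalize p).symm.dvd).mul_right _, aeval h a w, hm, ?_⟩
      obtain ⟨u, hu⟩ := associated_normalize p
      rw [← hu, mul_comm, map_mul, Module.End.mul_apply]
      exact aeval_mem_cycW _ hw'

lemma GP.ker_le {s : ℕ} {f : F[X]} {h : End F V} {v : V} (hgp : GP s f h v)
    {m : ℕ} (hm : 2 ^ s ∣ m) (hm0 : m ≠ 0) (w : V) (hw : (h ^ m) w + w = 0) : w ∈ cycW h v := by
  by_contra hw0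
  have hP : (X ^ m + 1 : F[X]) ≠ 0 := by
    have := X_pow_add_C_ne_zero (Nat.pos_of_ne_zero hm0) (1 : F)
    rwa [C_1] at this
  obtain ⟨g, h1, h3, h4, w', h5, h6⟩ := exists_irred_of_aeval (h := h) (v := v) _ hP w hw0 (by
    have : aeval h (X ^ m + 1 : F[X]) w = 0 := by simpa using hw
    rw [this]; exact zero_mem _)
  exact h5 (hgp.2.2 g ⟨h1, h3, m, hm, h4⟩ w' h6)

lemma GP.dvd {s : ℕ} (h2 : (2 : F) ≠ 0) {f : F[X]} (hf : Ty s f) {h : End F V} {v : V}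
    (hgp : GP s f h v) {N : ℕ} (hN : h ^ N = 1) : 2 ^ (s + 1) ∣ N := by
  refine hf.two_pow_dvd_of_dvd h2 ?_
  by_contra hnd
  refine hgp.1 (zero_of_coprime (hf.2.1.coprime_iff_not_dvd.2 hnd) hgp.2.1 ?_)
  simp [hN]

lemma GP.mem {s : ℕ} {f f' : F[X]} (hf' : Ty s f') {h : End F V} {v v' : V}
    (hgp : GP s f h v) (hgp' : GP s f' h v') : v' ∈ cycW h v :=
  hgp.2.2 f' hf' v' (by rw [hgp'.2.1]; exact zero_mem _)

lemma GP.eq {s : ℕ} {f f' : F[X]} (hf : Ty s f) (hf' : Ty s f') {h : End F V} {v v' : V}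
    (hgp : GP s f h v) (hgp' : GP s f' h v') : f = f' := by
  have hm := hgp.mem hf' hgp'
  obtain ⟨p, hp⟩ := mem_cycW.1 hm
  have h1 : aeval h f v' = 0 := by
    rw [← hp, ← Module.End.mul_apply, ← map_mul, mul_comm, map_mul, Module.End.mul_apply,
      hgp.2.1, map_zero]
  by_contra hne
  refine hgp'.1 (zero_of_coprime (hf.2.1.coprime_iff_not_dvd.2 fun hd => hne ?_) h1 hgp'.2.1)
  exact eq_of_monic_of_associated hf.1 hf'.1 (hf.2.1.associated_of_dvd hf'.2.1 hd)

end Good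

section CountE
variable {F V : Type*} [Field F] [Finite F] [AddCommGroup V] [Module F V] [Finite V]

/-- elements good for `f` -/
abbrev HG (s : ℕ) (H : Subgroup (V ≃ₗ[F] V)) (f : F[X]) : Type _ :=
  {h : H // ∃ v, GP s f (h.1.toLinearMap : End F V) v}

lemma card_HG_ge (h2 : (2 : F) ≠ 0) (hq : Odd (Nat.card F)) {b s : ℕ}
    (hs : ExpCond (Nat.card F) b s) (H : Subgroup (V ≃ₗ[F] V))
    (hH : ∀ g : V ≃ₗ[F] V, LinearEquiv.det g = 1 → g ∈ H) {f : F[X]} (hf : Ty s f)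
    (hlt : f.natDegree < finrank F V) (M : ℝ)
    (hM : ∑ j ∈ Finset.Icc 1 (finrank F V), (1 / (j : ℝ)) ≤ M) :
    (Nat.card H : ℝ) * (1 - M / 2 ^ b) ≤
      Nat.card (HG s H f) * ((Nat.card F ^ f.natDegree - 1 : ℕ) : ℝ) := by
  classical
  have h1 := card_QQ_ge h2 H hH hf hlt
  have h3 := card_Bad_le h2 hq hs H hH hf
  -- good pairs
  let G := {p : QQ H f // GP s f (p.1.1.1.toLinearMap : End F V) p.1.2}
  have h4 : Nat.card (QQ H f) ≤ Nat.card (Bad s H f) + Nat.card G := by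
    rw [← Nat.card_sum]
    refine Nat.card_le_card_of_surjective
      (Sum.elim (fun p : Bad s H f => p.1) (fun p : G => p.1)) ?_
    intro p
    by_cases hp : GP s f (p.1.1.1.toLinearMap : End F V) p.1.2
    · exact ⟨Sum.inr ⟨p, hp⟩, rfl⟩
    · refine ⟨Sum.inl ⟨p, ?_⟩, rfl⟩
      by_contra hb
      push Not at hb
      refine hp ⟨p.2.1, p.2.2, fun g hg w hw => ?_⟩
      by_contra hw0
      exact hb g hg w hw0 hw
  have h5 : Nat.card G ≤ Nat.card (HG s H f) * (Nat.card F ^ f.natDegree - 1) := by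
    let v0 : HG s H f → V := fun h => h.2.choose
    have hv0 : ∀ h : HG s H f, GP s f (h.1.1.toLinearMap : End F V) (v0 h) :=
      fun h => h.2.choose_spec
    let Φ : G → Σ h : HG s H f, {w : cycW (h.1.1.toLinearMap : End F V) (v0 h) // w ≠ 0} :=
      fun p => ⟨⟨p.1.1.1, ⟨_, p.2⟩⟩, ⟨⟨p.1.1.2, (hv0 _).mem hf p.2⟩,
        fun h0 => p.2.1 (congrArg Subtype.val h0)⟩⟩
    let rec1 : (Σ h : HG s H f, {w : cycW (h.1.1.toLinearMap : End F V) (v0 h) // w ≠ 0}) → H × V :=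
      fun z => ⟨z.1.1, z.2.1.1⟩
    have hinj : Function.Injective Φ := by
      intro p p' hpp
      have := congrArg rec1 hpp
      exact Subtype.ext (Subtype.ext this)
    have hc := Nat.card_le_card_of_injective Φ hinj
    have : Fintype (HG s H f) := Fintype.ofFinite _
    rw [Nat.card_sigma] at hc
    refine hc.trans (le_of_eq ?_)
    rw [Finset.sum_congr rfl (g := fun _ => Nat.card F ^ f.natDegree - 1)]
    · simp
    · intro h _
      rw [← finrank_cycW hf.1 hf.2.1 (hv0 h).2.1 (hv0 h).1, ← Module.natCard_eq_pow_finrank]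
      have : Fintype (cycW (h.1.1.toLinearMap : End F V) (v0 h)) := Fintype.ofFinite _
      rw [Nat.card_eq_fintype_card, Nat.card_eq_fintype_card, Fintype.card_subtype_compl,
        Fintype.card_subtype_eq]
  have h6 : (Nat.card H : ℝ) ≤ Nat.card (Bad s H f) +
      Nat.card (HG s H f) * ((Nat.card F ^ f.natDegree - 1 : ℕ) : ℝ) := by
    exact_mod_cast (h1.trans h4).trans (Nat.add_le_add_left h5 _)
  have h7 : (Nat.card H : ℝ) *
      ((∑ j ∈ Finset.Icc 1 (finrank F V), (1 / (j : ℝ))) / 2 ^ b) ≤ Nat.card H * (M / 2 ^ b) := by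
    gcongr
  linarith

/-- the good elements -/
abbrev HGood (s d : ℕ) (H : Subgroup (V ≃ₗ[F] V)) : Type _ :=
  {h : H // ∃ (f : F[X]) (v : V), Ty s f ∧ f.natDegree ≤ d ∧ GP s f (h.1.toLinearMap : End F V) v}

lemma card_HGood_ge (h2 : (2 : F) ≠ 0) (hq : Odd (Nat.card F)) {b s : ℕ} (hb : 8 ≤ 2 ^ b)
    (hs : ExpCond (Nat.card F) b s) (H : Subgroup (V ≃ₗ[F] V))
    (hH : ∀ g : V ≃ₗ[F] V, LinearEquiv.det g = 1 → g ∈ H) (K : ℕ)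
    (hK : 2 ^ b * K < finrank F V) (M : ℝ) (hMb : M ≤ 2 ^ b)
    (hM : ∑ j ∈ Finset.Icc 1 (finrank F V), (1 / (j : ℝ)) ≤ M) :
    (Nat.card H : ℝ) * (1 - M / 2 ^ b) * ((∑ k ∈ Finset.Icc 1 K, (1 / (k : ℝ))) / (3 * 2 ^ b)) ≤
      Nat.card (HGood s (2 ^ b * K) H) := by
  classical
  have hq1 : 1 < Nat.card F := Finite.one_lt_card
  have hnat : ∑ k ∈ Finset.Icc 1 K, ∑ f ∈ tyF h2 s (2 ^ b * k), Nat.card (HG s H f) ≤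
      Nat.card (HGood s (2 ^ b * K) H) := by
    let I := (k : Finset.Icc 1 K) × (f : tyF h2 s (2 ^ b * k)) × HG s H f.1
    have hI : ∑ k ∈ Finset.Icc 1 K, ∑ f ∈ tyF h2 s (2 ^ b * k), Nat.card (HG s H f) =
        Nat.card I := by
      rw [Nat.card_sigma, ← Finset.sum_coe_sort (Finset.Icc 1 K)]
      refine Finset.sum_congr rfl fun j _ => ?_
      rw [Nat.card_sigma, ← Finset.sum_coe_sort (tyF h2 s (2 ^ b * j))]
    rw [hI]
    have hty : ∀ i : I, Ty s i.2.1.1 ∧ i.2.1.1.natDegree = 2 ^ b * i.1.1 := fun i =>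
      (mem_tyF h2 _ _ _).1 i.2.1.2
    refine Nat.card_le_card_of_injective (fun i : I => (⟨i.2.2.1, i.2.1.1, i.2.2.2.choose,
      (hty i).1, ?_, i.2.2.2.choose_spec⟩ : HGood s (2 ^ b * K) H)) ?_
    · rw [(hty i).2]
      exact Nat.mul_le_mul_left _ (Finset.mem_Icc.1 i.1.2).2
    · intro i i' hii
      have h1 : i.2.2.1 = i'.2.2.1 := congrArg (fun z => z.1) hii
      have t1 := hty i
      have t2 := hty i'
      obtain ⟨⟨k, hk⟩, ⟨f, hf⟩, ⟨h, v, hv⟩⟩ := i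
      obtain ⟨⟨k', hk'⟩, ⟨f', hf'⟩, ⟨h', v', hv'⟩⟩ := i'
      simp only at h1 t1 t2
      subst h1
      have hff := GP.eq t1.1 t2.1 hv hv'
      subst hff
      have hkk : k = k' := Nat.eq_of_mul_eq_mul_left (by positivity) (t1.2.symm.trans t2.2)
      subst hkk
      rfl
  have hreal : ∑ k ∈ Finset.Icc 1 K, ∑ f ∈ tyF h2 s (2 ^ b * k), (Nat.card (HG s H f) : ℝ) ≤
      Nat.card (HGood s (2 ^ b * K) H) := by exact_mod_cast hnat
  refine le_trans ?_ hreal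
  rw [Finset.sum_div, Finset.mul_sum]
  refine Finset.sum_le_sum fun k hk => ?_
  obtain ⟨hk1, hkK⟩ := Finset.mem_Icc.1 hk
  have hxk : 2 ^ b * k ≤ 2 ^ b * K := Nat.mul_le_mul_left _ hkK
  have hxk8 : 8 ≤ 2 ^ b * k := hb.trans (Nat.le_mul_of_pos_right _ hk1)
  have hb0 : b ≠ 0 := by rintro rfl; simp at hb
  have heven : Even (2 ^ b * k) := (Nat.even_pow.2 ⟨even_two, hb0⟩).mul_right k
  set z := Nat.card F ^ (2 ^ b * k) - 1 with hz
  have hzpos : 0 < z := by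
    have : 1 < Nat.card F ^ (2 ^ b * k) := Nat.one_lt_pow (by omega) hq1
    omega
  have hz' : (0 : ℝ) < z := by exact_mod_cast hzpos
  set A := (Nat.card H : ℝ) * (1 - M / 2 ^ b) with hA
  have hA0 : 0 ≤ A := by
    have : M / 2 ^ b ≤ 1 := (div_le_one (by positivity)).2 hMb
    exact mul_nonneg (Nat.cast_nonneg _) (by linarith)
  have hlow : ∀ f ∈ tyF h2 s (2 ^ b * k), A / z ≤ (Nat.card (HG s H f) : ℝ) := by
    intro f hf
    obtain ⟨hf, hd⟩ := (mem_tyF h2 _ _ _).1 hf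
    have := card_HG_ge h2 hq hs H hH hf (by omega) M hM
    rw [hd] at this
    rwa [div_le_iff₀ hz']
  have hs1 := Finset.sum_le_sum hlow
  rw [Finset.sum_const, nsmul_eq_mul] at hs1
  refine le_trans ?_ hs1
  have hc := card_tyF_ge h2 hq hs (2 ^ b * k) hxk8 heven (dvd_mul_right _ _)
  have hc' : (z : ℝ) ≤ 3 * ((tyF h2 s (2 ^ b * k)).card * (2 ^ b * k)) := by exact_mod_cast hc
  have hk0 : (0 : ℝ) < k := by exact_mod_cast hk1
  have : 1 / (k : ℝ) / (3 * 2 ^ b) ≤ (tyF h2 s (2 ^ b * k)).card / z := by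
    rw [div_div, div_le_div_iff₀ (by positivity) hz']
    linarith
  calc A * (1 / (k : ℝ) / (3 * 2 ^ b)) ≤ A * ((tyF h2 s (2 ^ b * k)).card / z) := by gcongr
    _ = _ := by ring

end CountE
end Aux12


namespace Aux12

lemma num_log_three {ℓ : ℕ} (h : 21 ≤ ℓ) : (3 : ℝ) ≤ Real.log ℓ := by
  rw [Real.le_log_iff_exp_le (by positivity)]
  have h1 := Real.exp_one_lt_d9
  have h2 : Real.exp 3 = Real.exp 1 ^ 3 := by rw [← Real.exp_nat_mul]; norm_num
  have h3 : Real.exp 1 ^ 3 ≤ 2.7182818286 ^ 3 := by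
    gcongr
  have h4 : (21 : ℝ) ≤ ℓ := by exact_mod_cast h
  rw [h2]
  norm_num at h3 ⊢
  linarith

lemma num_ge {ℓ : ℕ} (h : ⌈(Real.log ℓ + 1) ^ 2⌉ + 1 + 2 * ⌈Real.log ℓ⌉ ≤ (ℓ : ℤ))
    (h2 : 2 ≤ ℓ) : 21 ≤ ℓ := by
  have hl2 := Real.log_two_gt_d9
  have hmono : ∀ k : ℕ, 2 ^ k ≤ ℓ → k * Real.log 2 ≤ Real.log ℓ := by
    intro k hk
    rw [← Real.log_pow]
    apply Real.log_le_log (by positivity)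
    exact_mod_cast hk
  have hceil : ∀ a c : ℤ, (a : ℝ) < (Real.log ℓ + 1) ^ 2 → (c : ℝ) < Real.log ℓ →
      (a + 1) + 1 + 2 * (c + 1) ≤ (ℓ : ℤ) := by
    intro a c ha hc
    have h1 := Int.lt_ceil.2 ha
    have h3 := Int.lt_ceil.2 hc
    omega
  have m1 := hmono 1 (by omega)
  norm_num at m1
  have a1 := hceil 2 0 (by push_cast; nlinarith) (by push_cast; linarith)
  have m2 := hmono 2 (by omega)
  norm_num at m2
  have a2 := hceil 5 1 (by push_cast; nlinarith) (by push_cast; linarith)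
  have m3 := hmono 3 (by omega)
  norm_num at m3
  have a3 := hceil 9 2 (by push_cast; nlinarith) (by push_cast; linarith)
  have m4 := hmono 4 (by omega)
  norm_num at m4
  have a4 := hceil 14 2 (by push_cast; nlinarith) (by push_cast; linarith)
  omega

lemma harm_ge (K : ℕ) (hK : 1 ≤ K) :
    1 + Real.log ((K + 1) / 2) ≤ ∑ k ∈ Finset.Icc 1 K, (1 / (k : ℝ)) := by
  induction K, hK using Nat.le_induction with
  | base => norm_num
  | succ n hn ih =>
    rw [Finset.sum_Icc_succ_top (by omega)]
    have hn' : (0 : ℝ) < n + 1 := by positivity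
    have h1 : Real.log (((n + 1 : ℕ) + 1 : ℝ) / 2) =
        Real.log ((n + 1) / 2) + Real.log (1 + 1 / ((n + 1 : ℕ) : ℝ)) := by
      rw [← Real.log_mul (by positivity) (by positivity)]
      congr 1
      push_cast
      field_simp
    have h3 := Real.log_le_sub_one_of_pos (x := 1 + 1 / ((n + 1 : ℕ) : ℝ)) (by positivity)
    rw [h1]
    linarith

lemma harm_le (n : ℕ) : ∑ k ∈ Finset.Icc 1 n, (1 / (k : ℝ)) ≤ Real.log n + 1 := by
  have := harmonic_le_one_add_log n
  rw [harmonic_eq_sum_Icc] at this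
  push_cast at this
  simp only [one_div]
  linarith

lemma exists_pow_two (M : ℝ) (hM : 4 ≤ M) : ∃ b : ℕ, 8 ≤ 2 ^ b ∧ 3 / 2 * M ≤ 2 ^ b ∧
    (2 : ℝ) ^ b ≤ 3 * M := by
  obtain ⟨n, h1, h2⟩ := exists_nat_pow_near (x := 3 / 2 * M) (y := 2) (by linarith) (by norm_num)
  refine ⟨n + 1, ?_, h2.le, ?_⟩
  · have : (4 : ℝ) < 2 ^ (n + 1) := by linarith
    have h3 : 2 ^ 2 < 2 ^ (n + 1) := by exact_mod_cast (by norm_num; exact this : (2:ℝ) ^ 2 < 2 ^ (n + 1))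
    have h4 := (Nat.pow_lt_pow_iff_right (by norm_num)).1 h3
    calc 8 = 2 ^ 3 := by norm_num
      _ ≤ _ := Nat.pow_le_pow_right (by norm_num) (by omega)
  · rw [pow_succ]; linarith

/-- numerics -/
lemma numerics (ε : ℝ) (hε : ε ∈ Set.Ioo (0 : ℝ) 1) (ℓ : ℕ)
    (h1 : ⌈(Real.log ℓ + 1) ^ 2⌉ < ⌈(ℓ : ℝ) ^ ε⌉)
    (h2 : ⌈(ℓ : ℝ) ^ ε⌉ ≤ (ℓ : ℤ) - 2 * ⌈Real.log ℓ⌉) :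
    ∃ b K : ℕ, 8 ≤ 2 ^ b ∧ 2 ^ b * K < ℓ ∧ ((2 ^ b * K : ℕ) : ℤ) ≤ ⌈(ℓ : ℝ) ^ ε⌉ ∧
      Real.log ℓ + 1 ≤ 2 ^ b ∧
      ε / 96 < (1 - (Real.log ℓ + 1) / 2 ^ b) *
        ((∑ k ∈ Finset.Icc 1 K, (1 / (k : ℝ))) / (3 * 2 ^ b)) := by
  obtain ⟨hε0, hε1⟩ := hε
  have hℓ2 : 2 ≤ ℓ := by
    by_contra hlt
    have : ℓ = 0 ∨ ℓ = 1 := by omega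
    rcases this with rfl | rfl
    · simp [Real.zero_rpow hε0.ne'] at h1
    · simp at h1
  have hℓ : 21 ≤ ℓ := num_ge (by omega) hℓ2
  have hL := num_log_three hℓ
  set L := Real.log ℓ with hLdef
  set M := L + 1 with hM
  have hM4 : 4 ≤ M := by linarith
  have hℓ0 : (0 : ℝ) < ℓ := by positivity
  have hrp : M ^ 2 < (ℓ : ℝ) ^ ε := by
    by_contra hle
    exact absurd h1 (not_lt.2 (Int.ceil_le_ceil (not_lt.1 hle)))
  have hy : 2 * Real.log M < ε * L := by
    have := Real.log_lt_log (by positivity) hrp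
    rw [Real.log_rpow hℓ0, Real.log_pow] at this
    exact_mod_cast this
  obtain ⟨b, hb8, hb1, hb2⟩ := exists_pow_two M hM4
  have hx0 : (0 : ℝ) < 2 ^ b := by positivity
  set K := ⌊(ℓ : ℝ) ^ ε / 2 ^ b⌋₊ with hK
  have hKle : (K : ℝ) ≤ (ℓ : ℝ) ^ ε / 2 ^ b := Nat.floor_le (by positivity)
  have hKlt : (ℓ : ℝ) ^ ε / 2 ^ b < K + 1 := Nat.lt_floor_add_one _
  have hKx : (2 : ℝ) ^ b * K ≤ (ℓ : ℝ) ^ ε := by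
    rw [le_div_iff₀ hx0] at hKle; linarith
  have hK1 : 1 ≤ K := by
    rw [hK, Nat.one_le_floor_iff, one_le_div hx0]
    nlinarith
  have hle : ((2 ^ b * K : ℕ) : ℤ) ≤ ⌈(ℓ : ℝ) ^ ε⌉ := by
    have : (((2 ^ b * K : ℕ) : ℤ) : ℝ) ≤ ⌈(ℓ : ℝ) ^ ε⌉ := by
      push_cast
      exact hKx.trans (Int.le_ceil _)
    exact_mod_cast this
  have hcl : 0 < ⌈L⌉ := Int.ceil_pos.2 (by linarith)
  refine ⟨b, K, hb8, by omega, hle, by linarith, ?_⟩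
  have hh := harm_ge K hK1
  set S := ∑ k ∈ Finset.Icc 1 K, (1 / (k : ℝ))
  -- lower bound for log
  have hlogK : ε * L - Real.log M - Real.log 6 ≤ Real.log ((K + 1) / 2) := by
    have e1 : ε * L - Real.log M - Real.log 6 = Real.log ((ℓ : ℝ) ^ ε / (3 * M) / 2) := by
      rw [Real.log_div (by positivity) (by norm_num), Real.log_div (by positivity) (by positivity),
        Real.log_mul (by norm_num) (by positivity), Real.log_rpow hℓ0,
        show (6 : ℝ) = 3 * 2 by norm_num, Real.log_mul (by norm_num) (by norm_num)]
      ring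
    rw [e1]
    apply Real.log_le_log (by positivity)
    have : (ℓ : ℝ) ^ ε / (3 * M) ≤ (ℓ : ℝ) ^ ε / 2 ^ b := by gcongr
    linarith
  have hlog6 : Real.log 6 ≤ 1.8 := by
    rw [Real.log_le_iff_le_exp (by norm_num)]
    have h1 := Real.exp_one_gt_d9
    have h2 : Real.exp 1.8 = Real.exp 1 ^ 2 * Real.exp (-0.2) := by
      rw [← Real.exp_nat_mul, ← Real.exp_add]; norm_num
    have h4 := Real.one_sub_le_exp_neg (0.05 : ℝ)
    have h5 : Real.exp (-0.2) = (Real.exp (-0.05) ^ 2) ^ 2 := by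
      rw [← Real.exp_nat_mul, ← Real.exp_nat_mul]; norm_num
    have h6 : Real.exp 1.8 = (Real.exp 1 * Real.exp (-0.05) ^ 2) ^ 2 := by rw [h2, h5]; ring
    have h8 : 0.9025 ≤ Real.exp (-0.05) ^ 2 := by nlinarith
    have h7 : 2.4532 ≤ Real.exp 1 * Real.exp (-0.05) ^ 2 := by nlinarith
    rw [h6]
    nlinarith
  have hlogM : 1.386 ≤ Real.log M := by
    have h1 : Real.log 4 ≤ Real.log M := Real.log_le_log (by norm_num) hM4
    have h3 : Real.log 4 = 2 * Real.log 2 := by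
      rw [show (4 : ℝ) = 2 ^ 2 by norm_num, Real.log_pow]; norm_num
    have := Real.log_two_gt_d9
    linarith
  have hS : ε * L - Real.log M - 0.8 ≤ S := by linarith
  have hSy : ε * L / 5 ≤ S := by linarith
  -- lower bound for the factor
  have hfac : 2 / (27 * M) ≤ (1 - M / 2 ^ b) / (3 * 2 ^ b) := by
    set x : ℝ := 2 ^ b
    have e : (1 - M / x) / (3 * x) = (x - M) / (3 * x ^ 2) := by field_simp
    rw [e, div_le_div_iff₀ (by positivity) (by positivity)]
    nlinarith [mul_nonneg (sub_nonneg.2 hb1) (sub_nonneg.2 hb2)]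
  have hy0 : 0 < ε * L := by positivity
  calc ε / 96 < 2 / (27 * M) * (ε * L / 5) := by
        rw [div_mul_div_comm, div_lt_div_iff₀ (by norm_num) (by positivity)]
        have : 27 * M * 5 < 192 * L := by linarith
        nlinarith
    _ ≤ 2 / (27 * M) * S := by gcongr
    _ ≤ (1 - M / 2 ^ b) / (3 * 2 ^ b) * S := by
        have : 0 ≤ S := by linarith
        gcongr
    _ = _ := by ring

end Aux12

namespace Aux12
open Polynomial Module

/-- matrices to linear automorphisms -/
noncomputable def phi (ℓ : ℕ) (F : Type*) [Field F] :
    GL (Fin ℓ) F ≃* ((Fin ℓ → F) ≃ₗ[F] (Fin ℓ → F)) :=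
  Matrix.GeneralLinearGroup.toLin.trans (LinearMap.GeneralLinearGroup.generalLinearEquiv F _)

lemma phi_coe (ℓ : ℕ) (F : Type*) [Field F] (g : GL (Fin ℓ) F) :
    ((phi ℓ F g).toLinearMap : End F (Fin ℓ → F)) = Matrix.toLin' (g : Matrix (Fin ℓ) (Fin ℓ) F) :=
  rfl

lemma good_prop {ℓ : ℕ} {F : Type*} [Field F] [Finite F] (h2 : (2 : F) ≠ 0)
    (H : Subgroup (GL (Fin ℓ) F)) (h : H) {s d : ℕ} {f : F[X]} {v : Fin ℓ → F} (hf : Ty s f)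
    (hd : f.natDegree ≤ d) (hgp : GP s f ((phi ℓ F h.1).toLinearMap : End F (Fin ℓ → F)) v) :
    Even (orderOf h) ∧ orderOf (h ^ (orderOf h / 2)) = 2 ∧
        negOneEigDim F (((h ^ (orderOf h / 2) : H) : GL (Fin ℓ) F) :
            Matrix (Fin ℓ) (Fin ℓ) F) ≤ d := by
  have hfin : Finite (GL (Fin ℓ) F) := inferInstance
  have hpow : ∀ n : ℕ, Matrix.toLin' (((h ^ n : H) : GL (Fin ℓ) F) : Matrix (Fin ℓ) (Fin ℓ) F) =
      ((phi ℓ F h.1).toLinearMap : End F (Fin ℓ → F)) ^ n := by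
    intro n
    rw [phi_coe, ← Matrix.toLin'_pow]
    simp
  have hN : ((phi ℓ F h.1).toLinearMap : End F (Fin ℓ → F)) ^ orderOf h = 1 := by
    rw [← hpow, pow_orderOf_eq_one]
    simp
    rfl
  have hdvd := hgp.dvd h2 hf hN
  have hpos : 0 < orderOf h := orderOf_pos h
  obtain ⟨c, hc⟩ := hdvd
  have hm : orderOf h / 2 = 2 ^ s * c := by
    rw [hc, pow_succ]
    have : 2 ^ s * 2 * c = 2 ^ s * c * 2 := by ring
    rw [this, Nat.mul_div_cancel _ (by norm_num)]
  have heq : orderOf h = orderOf h / 2 * 2 := by rw [hm, hc]; ring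
  have hm0 : orderOf h / 2 ≠ 0 := by omega
  refine ⟨⟨orderOf h / 2, by omega⟩, ?_, ?_⟩
  · rw [orderOf_pow_of_dvd hm0 ⟨2, heq⟩]
    exact Nat.div_eq_of_eq_mul_right (Nat.pos_of_ne_zero hm0) heq
  · refine le_trans ?_ hd
    rw [← finrank_cycW hf.1 hf.2.1 hgp.2.1 hgp.1, negOneEigDim]
    apply Submodule.finrank_mono
    intro w hw
    rw [LinearMap.mem_ker, map_add, hpow, Matrix.toLin'_one] at hw
    exact hgp.ker_le ⟨c, hm⟩ hm0 w hw

end Aux12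

theorem stmt12 (ε : ℝ) (hε : ε ∈ Set.Ioo (0 : ℝ) 1) (ℓ : ℕ)
    (h1 : ⌈(Real.log ℓ + 1) ^ 2⌉ < ⌈(ℓ : ℝ) ^ ε⌉)
    (h2 : ⌈(ℓ : ℝ) ^ ε⌉ ≤ (ℓ : ℤ) - 2 * ⌈Real.log ℓ⌉)
    (F : Type*) [Field F] [Fintype F] (hF : Odd (Fintype.card F))
    (H : Subgroup (GL (Fin ℓ) F))
    (hSL : ∀ M : GL (Fin ℓ) F, ((M : Matrix (Fin ℓ) (Fin ℓ) F)).det = 1 → M ∈ H) :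
    (Nat.card {h : H // Even (orderOf h) ∧ orderOf (h ^ (orderOf h / 2)) = 2 ∧
        ((negOneEigDim F (((h ^ (orderOf h / 2) : H) : GL (Fin ℓ) F) :
            Matrix (Fin ℓ) (Fin ℓ) F) : ℤ) ≤ ⌈(ℓ : ℝ) ^ ε⌉)} : ℝ) /
      Nat.card H > ε / 96 := by
  obtain ⟨b, K, hb8, hKℓ, hKc, hMb, hnum⟩ := Aux12.numerics ε hε ℓ h1 h2
  have hq : Odd (Nat.card F) := by rwa [Nat.card_eq_fintype_card]
  have htwo : (2 : F) ≠ 0 := by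
    apply Ring.two_ne_zero
    intro hc
    have := FiniteField.even_card_iff_char_two.1 hc
    rw [Nat.odd_iff] at hF
    omega
  obtain ⟨s, hs⟩ := Aux12.exists_expCond (Nat.card F) b hq Finite.one_lt_card
  let H' := H.map (Aux12.phi ℓ F).toMonoidHom
  have hH' : ∀ g : (Fin ℓ → F) ≃ₗ[F] (Fin ℓ → F), LinearEquiv.det g = 1 → g ∈ H' := by
    intro g hg
    obtain ⟨M, rfl⟩ := (Aux12.phi ℓ F).surjective g
    refine Subgroup.mem_map_of_mem _ (hSL M ?_)
    have h3 := congrArg Units.val hg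
    rw [LinearEquiv.coe_det] at h3
    have h4 : LinearMap.det (Matrix.toLin' (M : Matrix (Fin ℓ) (Fin ℓ) F)) = 1 := h3
    rwa [LinearMap.det_toLin'] at h4
  have hfr : Module.finrank F (Fin ℓ → F) = ℓ := by simp
  have hcount := Aux12.card_HGood_ge htwo hq hb8 hs H' hH' K (by rwa [hfr]) (Real.log ℓ + 1) hMb
    (by rw [hfr]; exact Aux12.harm_le ℓ)
  have hcardH : Nat.card H' = Nat.card H :=
    Nat.card_congr (H.equivMapOfInjective _ (Aux12.phi ℓ F).injective).symm.toEquiv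
  have hpre : ∀ x : Aux12.HGood s (2 ^ b * K) H', ∃ h : H, Aux12.phi ℓ F h.1 = x.1.1 := by
    rintro ⟨⟨_, h, hh, rfl⟩, hx⟩
    exact ⟨⟨h, hh⟩, rfl⟩
  choose ψ hψ using hpre
  have hle : Nat.card (Aux12.HGood s (2 ^ b * K) H') ≤
      Nat.card {h : H // Even (orderOf h) ∧ orderOf (h ^ (orderOf h / 2)) = 2 ∧
        ((negOneEigDim F (((h ^ (orderOf h / 2) : H) : GL (Fin ℓ) F) :
            Matrix (Fin ℓ) (Fin ℓ) F) : ℤ) ≤ ⌈(ℓ : ℝ) ^ ε⌉)} := by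
    refine Nat.card_le_card_of_injective (fun x => ⟨ψ x, ?_⟩) ?_
    · obtain ⟨f, v, hf, hd, hgp⟩ := x.2
      rw [← hψ x] at hgp
      obtain ⟨p1, p2, p3⟩ := Aux12.good_prop htwo H (ψ x) hf hd hgp
      exact ⟨p1, p2, le_trans (by exact_mod_cast p3) hKc⟩
    · intro x y hxy
      have h3 : ψ x = ψ y := congrArg Subtype.val hxy
      apply Subtype.ext
      apply Subtype.ext
      rw [← hψ x, ← hψ y, h3]
  have hHpos : (0 : ℝ) < Nat.card H := by exact_mod_cast Nat.card_pos
  rw [gt_iff_lt, lt_div_iff₀ hHpos]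
  rw [hcardH] at hcount
  have hle' : (Nat.card (Aux12.HGood s (2 ^ b * K) H') : ℝ) ≤ _ := Nat.cast_le.2 hle
  refine lt_of_lt_of_le ?_ (hcount.trans hle')
  rw [mul_assoc, mul_comm]
  exact mul_lt_mul_of_pos_left hnum hHpos
end

section
/- Let ε ∈ (0,1) and let ℓ be an integer satisfying ⌈(log(ℓ)+1)²⌉ < ⌈ℓ^ε⌉ ≤ ℓ − 2⌈log(ℓ)⌉. Let F be a finite field of odd order, and let H = Sp_{2ℓ}(F) be the symplectic group of 2ℓ×2ℓ matrices over F preserving the standard alternating form. Then the proportion of elements h ∈ H such that h has even order and h^{|h|/2} is an involution whose (−1)-eigenspace has dimension at most 2⌈ℓ^ε⌉ is greater than ε/192. -/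
open scoped MatrixGroups Matrix

open Polynomial

/-- Data of a level: `D` is a power of two measuring the 2-part of eigenvalue orders. -/
structure Lev (q D B : ℕ) : Prop where
  pow : ∃ a, D = 2 ^ a
  iff : ∀ d, 1 ≤ d → (D ∣ q ^ d - 1 ↔ B ∣ d)
  ne : ∀ i, ¬ D ∣ q ^ i + 1
  four : 4 ≤ B
  qodd : Odd q
  qgt : 3 ≤ q

theorem Lev.exists (q b : ℕ) (hq : Odd q) (hq3 : 3 ≤ q) (hb : 2 ≤ b) : ∃ D, Lev q D (2 ^ b) := by
  set N := q ^ (2 ^ b) - 1 with hN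
  have hN0 : N ≠ 0 := by
    have : 3 ^ 1 ≤ q ^ (2 ^ b) := (Nat.pow_le_pow_left hq3 1).trans (Nat.pow_le_pow_right (by omega) Nat.one_le_two_pow)
    omega
  have hD : 2 ^ padicValNat 2 N ∣ N := pow_padicValNat_dvd
  have key : ∀ d, 1 ≤ d → (2 ^ padicValNat 2 N ∣ q ^ d - 1 ↔ 2 ^ b ∣ d) := by
    intro d hd
    constructor
    · intro h
      have h1 : 2 ^ padicValNat 2 N ∣ Nat.gcd (q ^ d - 1) (q ^ (2 ^ b) - 1) := Nat.dvd_gcd h hD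
      rw [Nat.pow_sub_one_gcd_pow_sub_one] at h1
      have h2 : d.gcd (2 ^ b) ∣ 2 ^ b := Nat.gcd_dvd_right _ _
      obtain ⟨c, hc, hc'⟩ := (Nat.dvd_prime_pow Nat.prime_two).1 h2
      rw [hc'] at h1
      rcases hc.lt_or_eq with hlt | rfl
      · exfalso
        have h3 : (q ^ 2 ^ c - 1) * (q ^ 2 ^ c + 1) ∣ N := by
          have : (q ^ 2 ^ c - 1) * (q ^ 2 ^ c + 1) = q ^ 2 ^ (c + 1) - 1 := by
            rw [pow_succ 2 c, pow_mul, mul_comm]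
            have := Nat.sq_sub_sq (q ^ 2 ^ c) 1
            simpa using this.symm
          rw [this]
          obtain ⟨e, he⟩ := pow_dvd_pow 2 (Nat.succ_le_of_lt hlt)
          rw [hN, he, pow_mul]
          simpa using Nat.sub_dvd_pow_sub_pow (q ^ 2 ^ (c+1)) 1 e
        have h4 : 2 ∣ q ^ 2 ^ c + 1 := by
          have : Odd (q ^ 2 ^ c) := hq.pow
          exact (this.add_one).two_dvd
        have h5 : 2 ^ (padicValNat 2 N + 1) ∣ N := by
          rw [pow_succ]
          exact (mul_dvd_mul h1 h4).trans h3
        exact pow_succ_padicValNat_not_dvd hN0 h5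
      · rw [← hc']; exact Nat.gcd_dvd_left _ _
    · rintro ⟨e, rfl⟩
      refine hD.trans ?_
      rw [pow_mul]
      simpa using Nat.sub_dvd_pow_sub_pow (q ^ 2 ^ b) 1 e
  have h8 : 4 ∣ N := by
    have h1 : (q ^ 2 - 1) ∣ N := by
      obtain ⟨e, he⟩ := pow_dvd_pow 2 (show 1 ≤ b by omega)
      rw [hN, he, pow_one, pow_mul]
      simpa using Nat.sub_dvd_pow_sub_pow (q ^ 2) 1 e
    refine Dvd.dvd.trans ?_ h1
    obtain ⟨r, rfl⟩ := hq
    refine ⟨r ^ 2 + r, ?_⟩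
    have : (2 * r + 1) ^ 2 = 4 * (r ^ 2 + r) + 1 := by ring
    omega
  have h4 : 4 ∣ 2 ^ padicValNat 2 N := by
    have : 2 ≤ padicValNat 2 N := (padicValNat_dvd_iff_le hN0).1 (by simpa using h8)
    exact (show 4 = 2 ^ 2 by norm_num) ▸ pow_dvd_pow 2 this
  refine ⟨2 ^ padicValNat 2 N, ⟨_, rfl⟩, key, ?_, ?_, hq, hq3⟩
  · intro i hi
    rcases Nat.even_or_odd i with he | ho
    · obtain ⟨j, rfl⟩ := he
      have := h4.trans hi
      obtain ⟨r, hr⟩ := hq.pow (n := j)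
      have e : q ^ (j + j) + 1 = 4 * (r ^ 2 + r) + 2 := by rw [pow_add, hr]; ring
      rw [e] at this
      omega
    · have h1 : 2 ^ padicValNat 2 N ∣ q ^ (2 * i) - 1 := by
        have : q ^ (2 * i) - 1 = (q ^ i + 1) * (q ^ i - 1) := by
          have := Nat.sq_sub_sq (q ^ i) 1
          rw [mul_comm 2 i, pow_mul]
          simpa using this
        rw [this]; exact hi.mul_right _
      have h2 := (key (2 * i) (by have := ho.pos; omega)).1 h1
      have h3 : 4 ∣ 2 * i := ((show 4 = 2 ^ 2 by norm_num) ▸ pow_dvd_pow 2 hb : 4 ∣ 2 ^ b).trans h2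
      obtain ⟨j, hj⟩ := ho
      omega
  · simpa using Nat.pow_le_pow_right (show 0 < 2 by norm_num) hb

theorem two_part_dvd {D s d : ℕ} (hD : ∃ a, D = 2 ^ a) (hs : s ≠ 0) (hDs : D ∣ s) (hd : d ∣ s)
    (hn : ¬ d ∣ s / 2) : D ∣ d := by
  obtain ⟨a, rfl⟩ := hD
  obtain ⟨e, rfl⟩ := hd
  rcases Nat.even_or_odd e with he | ho
  · obtain ⟨j, rfl⟩ := he
    exact absurd ⟨j, by rw [← mul_two, ← mul_assoc]; simp⟩ hn
  · refine Nat.Coprime.dvd_of_dvd_mul_right ?_ hDs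
    exact Nat.Coprime.pow_left _ (Nat.coprime_two_left.2 ho)

theorem dvd_half {D s d : ℕ} (hD : ∃ a, D = 2 ^ a) (hs : s ≠ 0) (hDs : D ∣ s) (hd : d ∣ s)
    (hn : ¬ D ∣ d) : d ∣ s / 2 := by
  by_contra h
  exact hn (two_part_dvd hD hs hDs hd h)

theorem Lev.four_dvd {q D B : ℕ} (L : Lev q D B) : 4 ∣ D := by
  obtain ⟨a, rfl⟩ := L.pow
  rcases Nat.lt_or_ge a 2 with h | h
  · exfalso
    have h0 := L.ne 0
    apply h0
    simpa using pow_dvd_pow 2 (show a ≤ 1 by omega)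
  · exact (show 4 = 2 ^ 2 by norm_num) ▸ pow_dvd_pow 2 h

section
variable {F K : Type*} [Field F] [Finite F] [Field K] [Finite K] [Algebra F K]

theorem Lev.nsr {D B : ℕ} (L : Lev (Nat.card F) D B) (u : Kˣ) (hu : D ∣ orderOf u) :
    aeval ((u⁻¹ : Kˣ) : K) (minpoly F (u : K)) ≠ 0 := by
  intro h
  have hintegral : IsAlgebraic F ((u:Kˣ):K) := Algebra.IsAlgebraic.isAlgebraic _
  obtain ⟨σ, hσ⟩ := minpoly.exists_algEquiv_of_root hintegral h
  let ⟨p, hp⟩ := CharP.exists F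
  have : Fact (Nat.Prime p) := ⟨CharP.char_is_prime F p⟩
  obtain ⟨i, hi⟩ := FiniteField.exists_forall_apply_eq_pow F p K σ
  rw [hi] at hσ
  apply L.ne i
  refine hu.trans ?_
  apply orderOf_dvd_of_pow_eq_one
  have : u ^ (Nat.card F ^ i) = u⁻¹ := by
    apply inv_injective
    rw [inv_inv]
    ext; simpa using hσ
  rw [pow_succ, this]; simp

/-- The generating units of `K` whose order is divisible by `D`. -/
def Lam (F K : Type*) [Field F] [Field K] [Algebra F K] (D : ℕ) : Set Kˣ :=
  {u | D ∣ orderOf u ∧ (minpoly F (u : K)).natDegree = Module.finrank F K}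

theorem bad_exists {D B : ℕ} (L : Lev (Nat.card F) D B) {p : F[X]} (hp : Irreducible p) {s : ℕ}
    (hs : Even s) (hs0 : s ≠ 0)
    (hpr : p ∣ X ^ (s / 2) + 1) (hD : D ∣ s) (hdeg : Module.finrank F K = p.natDegree) :
    B ∣ p.natDegree ∧ ∃ u ∈ Lam F K D, aeval (u : K) p = 0 := by
  let ⟨c, hc⟩ := CharP.exists F
  have : Fact (Nat.Prime c) := ⟨CharP.char_is_prime F c⟩
  have : Fact (Irreducible p) := ⟨hp⟩
  have : NeZero p.natDegree := ⟨hp.natDegree_pos.ne'⟩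
  let e := (FiniteField.algEquivExtension F c p.natDegree (AdjoinRoot p)
    (finrank_quotient_span_eq_natDegree (f := p))).trans
    (FiniteField.algEquivExtension F c p.natDegree K hdeg).symm
  let x : K := e (AdjoinRoot.root p)
  have hx : aeval x p = 0 := by
    have h := Polynomial.aeval_algHom_apply (e : AdjoinRoot p →ₐ[F] K) (AdjoinRoot.root p) p
    change aeval (e (AdjoinRoot.root p)) p = 0
    refine h.trans ?_
    simp
  have hxr : x ^ (s/2) = -1 := by
    obtain ⟨r, hr⟩ := hpr
    have := congrArg (aeval x) hr
    rw [map_mul, hx, zero_mul] at this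
    simp only [map_add, map_pow, aeval_X, map_one] at this
    exact eq_neg_of_add_eq_zero_left this
  have hx0 : x ≠ 0 := by
    rintro h0
    rw [h0] at hxr
    have : s / 2 ≠ 0 := by obtain ⟨j, rfl⟩ := hs; omega
    rw [zero_pow this] at hxr
    simp at hxr
  have h2 : (-1 : K) ≠ 1 := by
    have hodd := L.qodd
    have hF : ringChar F ≠ 2 := by
      intro h
      have := Fintype.ofFinite F
      rw [← Nat.not_even_iff_odd, Nat.card_eq_fintype_card] at hodd
      exact hodd ((FiniteField.even_card_iff_char_two).1 h |> Nat.even_iff.2)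
    have := (algebraMap F K).injective.ne (Ring.neg_one_ne_one_of_char_ne_two hF)
    simpa using this
  let u : Kˣ := Units.mk0 x hx0
  have hu : D ∣ orderOf u := by
    refine two_part_dvd L.pow hs0 hD (orderOf_dvd_of_pow_eq_one ?_) ?_
    · ext
      have : s = s / 2 * 2 := by obtain ⟨j, rfl⟩ := hs; omega
      rw [this]
      simp [u, pow_mul, hxr]
    · intro h
      have := orderOf_dvd_iff_pow_eq_one.1 h
      have := congrArg (Units.val) this
      simp [u, hxr] at this
      exact h2 this
  have hmin : (minpoly F x).natDegree = p.natDegree := by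
    rw [← minpoly.eq_of_irreducible hp hx, natDegree_mul_C]
    simpa using hp.ne_zero
  refine ⟨?_, u, ⟨hu, by rw [hdeg]; exact hmin⟩, hx⟩
  rw [← L.iff _ hp.natDegree_pos, ← hdeg, ← Module.natCard_eq_pow_finrank, ← Nat.card_units]
  exact hu.trans (orderOf_dvd_natCard u)

theorem Lam_le {D : ℕ} : (Lam F K D).ncard ≤ Nat.card F ^ (Module.finrank F K) - 1 := by
  rw [← Module.natCard_eq_pow_finrank, ← Nat.card_units, ← Set.ncard_univ]
  exact Set.ncard_le_ncard (Set.subset_univ _) (Set.toFinite _)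

theorem geom_aux (q n : ℕ) (hq : 3 ≤ q) : 2 * ∑ d ∈ Finset.Icc 1 n, q ^ d + 3 ≤ 3 * q ^ n := by
  induction n with
  | zero => simp
  | succ n ih =>
    rw [Finset.sum_Icc_succ_top (by omega)]
    have : 3 * q ^ n ≤ q ^ (n+1) := by rw [pow_succ, mul_comm]; gcongr
    omega

theorem roots_card_le {n : ℕ} (hn : n ≠ 0) : {u : Kˣ | u ^ n = 1}.ncard ≤ n := by
  classical
  have hf : Fintype Kˣ := Fintype.ofFinite _
  have : NeZero n := ⟨hn⟩
  have : {u : Kˣ | u ^ n = 1}.ncard = Nat.card (rootsOfUnity n K) := rfl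
  rw [this]; exact card_rootsOfUnity K n

theorem Lam_ge {D B : ℕ} (L : Lev (Nat.card F) D B) (hB : B ∣ Module.finrank F K) :
    Nat.card F ^ (Module.finrank F K) - 1 ≤ 4 * (Lam F K D).ncard := by
  set m := Module.finrank F K with hm
  have hm0 : 0 < m := Module.finrank_pos
  have hm4 : 4 ≤ m := L.four.trans (Nat.le_of_dvd hm0 hB)
  set q := Nat.card F with hq
  have hcard : Nat.card Kˣ = q ^ m - 1 := by
    rw [Nat.card_units, ← Module.natCard_eq_pow_finrank]
  have hDN : D ∣ q ^ m - 1 := (L.iff m hm0).2 hB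
  have h9 : 9 ≤ q ^ (m/2) := by
    calc 9 = 3 ^ 2 := by norm_num
      _ ≤ q ^ 2 := Nat.pow_le_pow_left L.qgt 2
      _ ≤ _ := Nat.pow_le_pow_right (by have := L.qgt; omega) (by omega)
  have hyy : q ^ (m/2) * q ^ (m/2) ≤ q ^ m := by
    rw [← pow_add]; exact Nat.pow_le_pow_right (by have := L.qgt; omega) (by omega)
  have hN4 : 4 ≤ q ^ m - 1 := by nlinarith [Nat.sub_add_cancel (show 1 ≤ q ^ m by nlinarith)]
  have hcov : (Set.univ : Set Kˣ) ⊆ Lam F K D ∪ ({u : Kˣ | u ^ ((q ^ m - 1)/2) = 1} ∪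
      ⋃ d ∈ Finset.Icc 1 (m/2), {u : Kˣ | u ^ (q ^ d - 1) = 1}) := by
    intro u _
    by_cases h1 : D ∣ orderOf u
    · by_cases h2 : (minpoly F (u : K)).natDegree = m
      · exact Or.inl ⟨h1, h2⟩
      · refine Or.inr (Or.inr ?_)
        have hintegral : IsIntegral F (u : K) := Algebra.IsIntegral.isIntegral _
        have hdvd : (minpoly F (u : K)).natDegree ∣ m := minpoly.degree_dvd hintegral
        have hpos := minpoly.natDegree_pos hintegral
        simp only [Set.mem_iUnion]
        refine ⟨(minpoly F (u : K)).natDegree, ?_, ?_⟩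
        · obtain ⟨e, he⟩ := hdvd
          have : 2 ≤ e := by
            by_contra hlt
            interval_cases e
            · omega
            · omega
          rw [Finset.mem_Icc]
          refine ⟨hpos, ?_⟩
          rw [Nat.le_div_iff_mul_le (by norm_num), he]
          gcongr
        · have hirr := minpoly.irreducible hintegral
          have h3 := (hirr.natDegree_dvd_iff_dvd_X_pow_card_pow_sub_X
            (n := (minpoly F (u:K)).natDegree)).1 dvd_rfl
          have h4 : (u:K) ^ (q ^ (minpoly F (u : K)).natDegree) - u = 0 := by
            have := (minpoly.dvd_iff).1 h3
            simpa using this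
          have h5 : u ^ (q ^ (minpoly F (u : K)).natDegree) = u := by
            ext; simpa using sub_eq_zero.1 h4
          change u ^ _ = 1
          have h6 : q ^ (minpoly F (u : K)).natDegree ≠ 0 := by
            have := L.qgt; positivity
          have h7 : u ^ (q ^ (minpoly F (u : K)).natDegree - 1) * u = 1 * u := by
            rw [pow_sub_one_mul h6, one_mul, h5]
          exact mul_right_cancel h7
    · refine Or.inr (Or.inl ?_)
      apply orderOf_dvd_iff_pow_eq_one.1
      refine dvd_half L.pow (by omega) hDN ?_ h1
      rw [← hcard]; exact orderOf_dvd_natCard u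
  have hle := Set.ncard_le_ncard hcov (Set.toFinite _)
  rw [Set.ncard_univ, hcard] at hle
  have h1 := Set.ncard_union_le (Lam F K D) ({u : Kˣ | u ^ ((q ^ m - 1)/2) = 1} ∪
      ⋃ d ∈ Finset.Icc 1 (m/2), {u : Kˣ | u ^ (q ^ d - 1) = 1})
  have h2 := Set.ncard_union_le ({u : Kˣ | u ^ ((q ^ m - 1)/2) = 1})
      (⋃ d ∈ Finset.Icc 1 (m/2), {u : Kˣ | u ^ (q ^ d - 1) = 1})
  have h3 : (⋃ d ∈ Finset.Icc 1 (m/2), {u : Kˣ | u ^ (q ^ d - 1) = 1}).ncard ≤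
      ∑ d ∈ Finset.Icc 1 (m/2), q ^ d := by
    refine (Finset.set_ncard_biUnion_le _ _).trans ?_
    refine Finset.sum_le_sum fun d hd => ?_
    rw [Finset.mem_Icc] at hd
    have : 3 ≤ q ^ d := L.qgt.trans (Nat.le_self_pow (by omega) q)
    exact (roots_card_le (by omega)).trans (by omega)
  have h4 : {u : Kˣ | u ^ ((q ^ m - 1)/2) = 1}.ncard ≤ (q ^ m - 1)/2 := roots_card_le (by omega)
  have h5 := geom_aux q (m/2) L.qgt
  have h6 : 6 * (q ^ (m/2) - 1) ≤ q ^ m - 1 := by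
    obtain ⟨y, hy⟩ := Nat.exists_eq_add_of_le h9
    rw [hy] at hyy ⊢
    have : 6 * (9 + y - 1) + 1 ≤ q ^ m := by
      have : 9 + y - 1 = 8 + y := by omega
      rw [this]; nlinarith
    omega
  omega

theorem conj_card {D B : ℕ} (L : Lev (Nat.card F) D B) (u : Kˣ) (hu : u ∈ Lam F K D) :
    {v : Kˣ | minpoly F (v : K) = minpoly F (u : K) ∨
      minpoly F (v : K) = minpoly F ((u⁻¹ : Kˣ) : K)}.ncard = 2 * Module.finrank F K := by
  have hinj : Function.Injective (Units.val : Kˣ → K) := Units.val_injective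
  have key : ∀ w : Kˣ, (minpoly F (w : K)).natDegree = Module.finrank F K →
      {v : Kˣ | minpoly F (v : K) = minpoly F (w : K)}.ncard = Module.finrank F K := by
    intro w hw
    have hintegral : IsIntegral F (w : K) := Algebra.IsIntegral.isIntegral _
    rw [← Set.ncard_image_of_injective _ hinj]
    have : Units.val '' {v : Kˣ | minpoly F (v : K) = minpoly F (w : K)} =
        (minpoly F (w : K)).rootSet K := by
      ext x
      rw [mem_rootSet]
      constructor
      · rintro ⟨v, hv, rfl⟩
        refine ⟨minpoly.ne_zero hintegral, ?_⟩
        rw [← (show minpoly F (v : K) = minpoly F (w : K) from hv)]; exact minpoly.aeval _ _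
      · rintro ⟨h0, hx⟩
        have h1 : minpoly F (w : K) = minpoly F x :=
          minpoly.eq_of_irreducible_of_monic (minpoly.irreducible hintegral) hx (minpoly.monic hintegral)
        have hx0 : x ≠ 0 := by
          rintro rfl
          rw [minpoly.zero] at h1
          have := minpoly.aeval F (w : K)
          rw [h1] at this
          simp at this
        exact ⟨Units.mk0 x hx0, h1.symm, rfl⟩
    rw [this, ← hw, ← Nat.card_coe_set_eq, Nat.card_eq_fintype_card]
    exact card_rootSet_eq_natDegree (Algebra.IsSeparable.isSeparable F (w:K))
      (Normal.splits inferInstance (w:K))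
  have hinvdeg : (minpoly F ((u⁻¹ : Kˣ) : K)).natDegree = Module.finrank F K := by
    have h1 := hu.2
    have hintegral : IsIntegral F (u : K) := Algebra.IsIntegral.isIntegral _
    have hintegral' : IsIntegral F ((u⁻¹ : Kˣ) : K) := Algebra.IsIntegral.isIntegral _
    rw [← IntermediateField.adjoin.finrank hintegral] at h1
    rw [← IntermediateField.adjoin.finrank hintegral', ← h1]
    have : IntermediateField.adjoin F {((u⁻¹ : Kˣ) : K)} = IntermediateField.adjoin F {(u : K)} := by
      apply le_antisymm
      · rw [IntermediateField.adjoin_simple_le_iff, Units.val_inv_eq_inv_val]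
        exact inv_mem (IntermediateField.mem_adjoin_simple_self F (u : K))
      · rw [IntermediateField.adjoin_simple_le_iff]
        have := inv_mem (IntermediateField.mem_adjoin_simple_self F ((u⁻¹ : Kˣ) : K))
        simpa using this
    rw [this]
  have hdis : Disjoint {v : Kˣ | minpoly F (v : K) = minpoly F (u : K)}
      {v : Kˣ | minpoly F (v : K) = minpoly F ((u⁻¹ : Kˣ) : K)} := by
    rw [Set.disjoint_left]
    intro v hv hv'
    apply L.nsr u hu.1
    rw [← (show minpoly F (v : K) = minpoly F (u : K) from hv), 
      (show minpoly F (v : K) = _ from hv')]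
    exact minpoly.aeval _ _
  have := Set.ncard_union_eq hdis (Set.toFinite _) (Set.toFinite _)
  rw [key u hu.2, key _ hinvdeg, ← two_mul] at this
  exact this
end


section
variable {F V : Type*} [Field F] [AddCommGroup V] [Module F V]

/-- The isometry group of a bilinear form. -/
def Spg (β : LinearMap.BilinForm F V) : Subgroup (V ≃ₗ[F] V) where
  carrier := {g | ∀ x y, β (g x) (g y) = β x y}
  mul_mem' := by
    intro a b ha hb x y
    simp only [LinearEquiv.mul_apply]
    rw [ha, hb]
  one_mem' := by intro x y; rfl
  inv_mem' := by
    intro a ha x y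
    have := ha (a⁻¹ x) (a⁻¹ y)
    rw [← LinearEquiv.mul_apply, ← LinearEquiv.mul_apply, mul_inv_cancel] at this
    exact this.symm

theorem mem_Spg {β : LinearMap.BilinForm F V} {g : V ≃ₗ[F] V} :
    g ∈ Spg β ↔ ∀ x y, β (g x) (g y) = β x y := Iff.rfl

theorem inv_apply_self' (g : V ≃ₗ[F] V) (x : V) : g⁻¹ (g x) = x := by
  rw [← LinearEquiv.mul_apply, inv_mul_cancel]; rfl

theorem apply_inv_self' (g : V ≃ₗ[F] V) (x : V) : g (g⁻¹ x) = x := by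
  rw [← LinearEquiv.mul_apply, mul_inv_cancel]; rfl

/-- One transvection. -/
theorem transv {β : LinearMap.BilinForm F V} (hA : β.IsAlt) (w w' : V) (h : β w w' ≠ 0) :
    ∃ g ∈ Spg β, g w = w' ∧ ∀ x, β x w = 0 → β x w' = 0 → g x = x := by
  set u := w' - w with hu
  set c := (β w w')⁻¹ with hc
  let T : V →ₗ[F] V := LinearMap.id + c • (β.flip u).smulRight u
  let T' : V →ₗ[F] V := LinearMap.id - c • (β.flip u).smulRight u
  have hT : ∀ x, T x = x + (c * β x u) • u := by
    intro x; simp [T, mul_smul]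
  have hT' : ∀ x, T' x = x - (c * β x u) • u := by
    intro x; simp [T', mul_smul]
  have huu : β u u = 0 := hA u
  let g : V ≃ₗ[F] V := LinearEquiv.ofLinearMap T T'
    (by ext x; simp [hT, hT', huu]) (by ext x; simp [hT, hT', huu])
  have hg : ∀ x, g x = x + (c * β x u) • u := hT
  refine ⟨g, ?_, ?_, ?_⟩
  · intro x y
    rw [hg, hg]
    have h1 : β u y = - β y u := (LinearMap.IsAlt.neg hA y u).symm
    simp only [map_add, map_smul, LinearMap.add_apply, LinearMap.smul_apply, smul_eq_mul, huu, h1]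
    ring
  · rw [hg]
    have : β w u = β w w' := by rw [hu, map_sub, hA w, sub_zero]
    rw [this, hc, inv_mul_cancel₀ h, one_smul, hu]; abel
  · intro x h1 h2
    rw [hg, hu, map_sub, h1, h2]; simp

theorem witt_step [FiniteDimensional F V] {β : LinearMap.BilinForm F V} (hA : β.IsAlt)
    (hN : β.Nondegenerate) (U : Submodule F V) (w w' : V) (hw : w ∉ U) (hw' : w' ∉ U)
    (ho : ∀ x ∈ U, β x w = 0) (ho' : ∀ x ∈ U, β x w' = 0) :
    ∃ g ∈ Spg β, g w = w' ∧ ∀ x ∈ U, g x = x := by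
  by_cases h : β w w' = 0
  · have key : ∀ v, v ∉ U → ∃ z ∈ β.orthogonal U, β z v ≠ 0 := by
      intro v hv
      rw [← LinearMap.BilinForm.orthogonal_orthogonal hN hA.isRefl U,
        LinearMap.BilinForm.mem_orthogonal_iff] at hv
      push Not at hv
      obtain ⟨z, hz, hz'⟩ := hv
      exact ⟨z, hz, hz'⟩
    obtain ⟨z1, hz1, h1⟩ := key w hw
    obtain ⟨z2, hz2, h2⟩ := key w' hw'
    have : ∃ z ∈ β.orthogonal U, β z w ≠ 0 ∧ β z w' ≠ 0 := by
      by_cases h3 : β z1 w' = 0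
      · by_cases h4 : β z2 w = 0
        · exact ⟨z1 + z2, add_mem hz1 hz2, by simpa [h4] using h1, by simpa [h3] using h2⟩
        · exact ⟨z2, hz2, h4, h2⟩
      · exact ⟨z1, hz1, h1, h3⟩
    obtain ⟨z, hz, h5, h6⟩ := this
    have hzU : ∀ x ∈ U, β x z = 0 := fun x hx => hz x hx
    have h5' : β w z ≠ 0 := by rw [← LinearMap.IsAlt.neg hA]; simpa using h5
    obtain ⟨g1, hg1, e1, f1⟩ := transv hA w z h5'
    obtain ⟨g2, hg2, e2, f2⟩ := transv hA z w' h6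
    refine ⟨g2 * g1, mul_mem hg2 hg1, by rw [LinearEquiv.mul_apply, e1, e2], ?_⟩
    intro x hx
    rw [LinearEquiv.mul_apply, f1 x (ho x hx) (hzU x hx), f2 x (hzU x hx) (ho' x hx)]
  · obtain ⟨g, hg, e, f⟩ := transv hA w w' h
    exact ⟨g, hg, e, fun x hx => f x (ho x hx) (ho' x hx)⟩

theorem witt_fin [FiniteDimensional F V] {β : LinearMap.BilinForm F V} (hA : β.IsAlt)
    (hN : β.Nondegenerate) (m : ℕ) : ∀ v v' : Fin m → V, LinearIndependent F v →
    LinearIndependent F v' → (∀ i j, β (v i) (v j) = 0) → (∀ i j, β (v' i) (v' j) = 0) →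
    ∃ g ∈ Spg β, ∀ i, g (v i) = v' i := by
  induction m with
  | zero => intro v v' _ _ _ _; exact ⟨1, one_mem _, fun i => i.elim0⟩
  | succ m ih =>
    intro v v' hv hv' ho ho'
    have hv1 := (linearIndependent_finSucc').1 hv
    have hv1' := (linearIndependent_finSucc').1 hv'
    obtain ⟨g, hg, e⟩ := ih (fun i : Fin m => v i.castSucc) (fun i : Fin m => v' i.castSucc) hv1.1 hv1'.1 (fun i j => ho _ _)
      (fun i j => ho' _ _)
    set U := Submodule.span F (Set.range (fun i : Fin m => v' i.castSucc)) with hU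
    have hUimg : U = (Submodule.span F (Set.range (fun i : Fin m => v i.castSucc))).map (g : V →ₗ[F] V) := by
      rw [Submodule.map_span, hU, ← Set.range_comp]
      congr 2
      funext i; exact (e i).symm
    have horth : ∀ z : V, (∀ i, β (v' (Fin.castSucc i)) z = 0) → ∀ x ∈ U, β x z = 0 := by
      intro z hz x hx
      have : U ≤ LinearMap.ker (β.flip z) := by
        rw [hU, Submodule.span_le]
        rintro _ ⟨i, rfl⟩
        simpa using hz i
      simpa using this hx
    obtain ⟨g2, hg2, e2, f2⟩ := witt_step hA hN U (g (v (Fin.last m))) (v' (Fin.last m)) (by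
        rw [hUimg]
        rintro ⟨x, hx, hx'⟩
        have : x = v (Fin.last m) := g.injective hx'
        exact hv1.2 (this ▸ hx)) hv1'.2
      (horth _ (fun i => by rw [← e i, hg]; exact ho _ _))
      (horth _ (fun i => ho' _ _))
    refine ⟨g2 * g, mul_mem hg2 hg, fun i => ?_⟩
    rw [LinearEquiv.mul_apply]
    refine Fin.lastCases ?_ (fun j => ?_) i
    · exact e2
    · have := e j
      change g (v j.castSucc) = v' j.castSucc at this
      rw [this]
      exact f2 _ (Submodule.subset_span ⟨j, rfl⟩)

theorem witt {W : Type*} [AddCommGroup W] [Module F W] [FiniteDimensional F W]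
    [FiniteDimensional F V] {β : LinearMap.BilinForm F V} (hA : β.IsAlt)
    (hN : β.Nondegenerate) (φ ψ : W →ₗ[F] V) (hφ : Function.Injective φ)
    (hψ : Function.Injective ψ) (iφ : ∀ x y, β (φ x) (φ y) = 0) (iψ : ∀ x y, β (ψ x) (ψ y) = 0) :
    ∃ g ∈ Spg β, ∀ x, g (φ x) = ψ x := by
  let b := Module.finBasis F W
  obtain ⟨g, hg, e⟩ := witt_fin hA hN _ (φ ∘ b) (ψ ∘ b)
    (b.linearIndependent.map' φ (LinearMap.ker_eq_bot.2 hφ))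
    (b.linearIndependent.map' ψ (LinearMap.ker_eq_bot.2 hψ)) (fun _ _ => iφ _ _)
    (fun _ _ => iψ _ _)
  refine ⟨g, hg, fun x => ?_⟩
  have : (g : V →ₗ[F] V) ∘ₗ φ = ψ := b.ext e
  exact LinearMap.congr_fun this x

theorem iso_le {W : Type*} [AddCommGroup W] [Module F W] [FiniteDimensional F W]
    [FiniteDimensional F V] {β : LinearMap.BilinForm F V}
    (hN : β.Nondegenerate) (φ : W →ₗ[F] V) (hφ : Function.Injective φ)
    (iφ : ∀ x y, β (φ x) (φ y) = 0) : 2 * Module.finrank F W ≤ Module.finrank F V := by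
  have h1 := LinearMap.finrank_range_of_inj hφ
  have h2 := LinearMap.BilinForm.finrank_orthogonal hN (LinearMap.range φ)
  have h3 : LinearMap.range φ ≤ β.orthogonal (LinearMap.range φ) := by
    rintro _ ⟨x, rfl⟩ _ ⟨y, rfl⟩
    exact iφ y x
  have h4 := Submodule.finrank_mono h3
  have h5 := Submodule.finrank_le (LinearMap.range φ)
  omega
end

set_option linter.unusedSectionVars false
section
variable {F K V : Type*} [Field F] [Finite F] [Field K] [Finite K] [Algebra F K]
  [AddCommGroup V] [Module F V]

theorem inter_poly (T : Module.End F V) (φ : K →ₗ[F] V) (a : K) (h : ∀ x, T (φ x) = φ (a * x))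
    (p : F[X]) (x : K) : φ (aeval a p * x) = aeval T p (φ x) := by
  induction p using Polynomial.induction_on' with
  | add p q hp hq => simp [add_mul, hp, hq]
  | monomial n c =>
    rw [aeval_monomial, aeval_monomial, Module.algebraMap_end_eq_smul_id, mul_assoc,
      ← Algebra.smul_def, map_smul]
    simp only [Module.End.mul_apply, LinearMap.smul_apply, LinearMap.id_apply]
    congr 1
    induction n generalizing x with
    | zero => simp
    | succ n ih => rw [pow_succ, pow_succ, Module.End.mul_apply, h, ← ih, mul_assoc]

theorem Lam.gen {D : ℕ} {u : Kˣ} (hu : u ∈ Lam F K D) (y : K) : ∃ p : F[X], aeval (u:K) p = y := by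
  have hintegral : IsIntegral F (u : K) := Algebra.IsIntegral.isIntegral _
  have h1 := hu.2
  rw [← IntermediateField.adjoin.finrank hintegral] at h1
  have h2 : IntermediateField.adjoin F {(u:K)} = ⊤ :=
    IntermediateField.eq_of_le_of_finrank_eq le_top (by rw [h1, IntermediateField.finrank_top'])
  have h3 : Algebra.adjoin F {(u:K)} = ⊤ := by
    rw [← IntermediateField.adjoin_simple_toSubalgebra_of_isAlgebraic hintegral.isAlgebraic, h2]
    rfl
  have : y ∈ Algebra.adjoin F {(u:K)} := by rw [h3]; trivial
  rw [Algebra.adjoin_singleton_eq_range_aeval] at this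
  exact this

theorem inter_inj {D : ℕ} {u : Kˣ} (hu : u ∈ Lam F K D) (T : Module.End F V) (φ : K →ₗ[F] V)
    (h : ∀ x, T (φ x) = φ (u * x)) (h0 : φ ≠ 0) : Function.Injective φ := by
  rw [← LinearMap.ker_eq_bot, LinearMap.ker_eq_bot']
  intro x hx
  by_contra hx0
  apply h0
  ext y
  obtain ⟨p, hp⟩ := Lam.gen hu (y / x)
  have := inter_poly T φ u h p x
  rw [hp, hx, map_zero, div_mul_cancel₀ _ hx0] at this
  simpa using this

theorem inter_exists {D : ℕ} {u : Kˣ} (hu : u ∈ Lam F K D) (T : Module.End F V) (y : V)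
    (hy : y ≠ 0) (hT : aeval T (minpoly F (u:K)) y = 0) :
    ∃ φ : K →ₗ[F] V, φ ≠ 0 ∧ ∀ x, T (φ x) = φ (u * x) := by
  let L1 : F[X] →ₗ[F] K := (aeval (u:K)).toLinearMap
  let L2 : F[X] →ₗ[F] V := (LinearMap.applyₗ y) ∘ₗ (aeval T).toLinearMap
  have hL1 : ∀ p, L1 p = aeval (u:K) p := fun p => rfl
  have hL2 : ∀ p, L2 p = aeval T p y := fun p => rfl
  have hs : Function.Surjective L1 := Lam.gen hu
  obtain ⟨g, hg⟩ := L1.exists_rightInverse_of_surjective (LinearMap.range_eq_top.2 hs)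
  have hker : ∀ p, L1 p = 0 → L2 p = 0 := by
    intro p hp
    rw [hL1] at hp
    obtain ⟨r, rfl⟩ := minpoly.dvd F _ hp
    rw [hL2, mul_comm, map_mul, Module.End.mul_apply, hT, map_zero]
  have hφ : ∀ p, L2 (g (L1 p)) = L2 p := by
    intro p
    have : L1 (g (L1 p) - p) = 0 := by
      rw [map_sub, sub_eq_zero]
      exact LinearMap.congr_fun hg (L1 p)
    have := hker _ this
    rwa [map_sub, sub_eq_zero] at this
  refine ⟨L2 ∘ₗ g, ?_, ?_⟩
  · intro h
    have := LinearMap.congr_fun h (L1 1)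
    simp only [LinearMap.comp_apply, hφ, hL2] at this
    simp at this
    exact hy this
  · intro x
    obtain ⟨p, rfl⟩ := hs x
    have : (u:K) * L1 p = L1 (X * p) := by simp [hL1]
    rw [this]
    simp only [LinearMap.comp_apply, hφ, hL2]
    simp

theorem adj_poly {β : LinearMap.BilinForm F V} {h : V ≃ₗ[F] V} (hh : h ∈ Spg β) (p : F[X])
    (x y : V) : β (aeval (h : Module.End F V) p x) y =
      β x (aeval ((h⁻¹ : V ≃ₗ[F] V) : Module.End F V) p y) := by
  induction p using Polynomial.induction_on' with
  | add p q hp hq => simp [hp, hq]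
  | monomial n c =>
    rw [aeval_monomial, aeval_monomial, Module.algebraMap_end_eq_smul_id]
    simp only [Module.End.mul_apply, LinearMap.smul_apply, LinearMap.id_apply, map_smul]
    congr 1
    induction n generalizing x y with
    | zero => simp
    | succ n ih =>
      rw [pow_succ', pow_succ, Module.End.mul_apply, Module.End.mul_apply, ← ih]
      have := hh (((h : Module.End F V) ^ n) x) (h⁻¹ y)
      rw [apply_inv_self'] at this
      exact this

/-- the number of intertwiners -/
noncomputable def Nint (u : Kˣ) (h : V ≃ₗ[F] V) : ℕ :=
  Nat.card {φ : K →ₗ[F] V // φ ≠ 0 ∧ ∀ x, h (φ x) = φ (u * x)}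

theorem inter_iso {D B : ℕ} (L : Lev (Nat.card F) D B) {u : Kˣ} (hu : D ∣ orderOf u)
    {β : LinearMap.BilinForm F V} {h : V ≃ₗ[F] V} (hh : h ∈ Spg β) (φ : K →ₗ[F] V)
    (hφ : ∀ x, h (φ x) = φ (u * x)) (x y : K) : β (φ x) (φ y) = 0 := by
  have h2 : ∀ x, h⁻¹ (φ x) = φ (((u⁻¹ : Kˣ):K) * x) := by
    intro x
    have := hφ (((u⁻¹ : Kˣ):K) * x)
    rw [← mul_assoc, Units.mul_inv, one_mul] at this
    rw [← this, inv_apply_self']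
  have h1 := L.nsr u hu
  set c := aeval ((u⁻¹ : Kˣ) : K) (minpoly F (u : K)) with hc
  have h3 : φ y = φ (c * (c⁻¹ * y)) := by rw [← mul_assoc, mul_inv_cancel₀ h1, one_mul]
  rw [h3, hc, inter_poly ((h⁻¹ : V ≃ₗ[F] V) : Module.End F V) φ _ h2, ← adj_poly hh,
    ← inter_poly (h : Module.End F V) φ (u:K) hφ, minpoly.aeval]
  simp

instance finLin [Finite V] : Finite (K →ₗ[F] V) := Finite.of_injective _ DFunLike.coe_injective
instance finEquiv [Finite V] : Finite (V ≃ₗ[F] V) := Finite.of_injective _ DFunLike.coe_injective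

theorem Nint_sum [Finite V] {D B : ℕ} (L : Lev (Nat.card F) D B) {u : Kˣ} (hu : u ∈ Lam F K D)
    {β : LinearMap.BilinForm F V} (hA : β.IsAlt) (hN : β.Nondegenerate) [Fintype (Spg β)] :
    ∑ h : Spg β, Nint u (h : V ≃ₗ[F] V) ≤ Nat.card (Spg β) := by
  classical
  have hfd : FiniteDimensional F V := inferInstance
  unfold Nint
  rw [← Nat.card_sigma]
  rcases isEmpty_or_nonempty
    (Σ h : Spg β, {φ : K →ₗ[F] V // φ ≠ 0 ∧ ∀ x, (h : V ≃ₗ[F] V) (φ x) = φ (u * x)}) with he | ⟨⟨h0, φ0, hφ0⟩⟩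
  · simp
  let Emb := {φ : K →ₗ[F] V // Function.Injective φ ∧ ∀ x y, β (φ x) (φ y) = 0}
  have hex : ∀ φ : Emb, ∃ g : Spg β, ∀ x, (g : V ≃ₗ[F] V) (φ0 x) = φ.1 x := by
    intro φ
    obtain ⟨g, hg, e⟩ := witt hA hN φ0 φ.1 (inter_inj hu _ φ0 hφ0.2 hφ0.1) φ.2.1
      (inter_iso L hu.1 h0.2 φ0 hφ0.2) φ.2.2
    exact ⟨⟨g, hg⟩, e⟩
  choose γ hγ using hex
  let emb : (Σ h : Spg β, {φ : K →ₗ[F] V // φ ≠ 0 ∧ ∀ x, (h : V ≃ₗ[F] V) (φ x) = φ (u * x)}) → Emb :=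
    fun s => ⟨s.2.1, inter_inj hu _ s.2.1 s.2.2.2 s.2.2.1, inter_iso L hu.1 s.1.2 s.2.1 s.2.2.2⟩
  let shift : Emb → Emb := fun φ => ⟨φ.1 ∘ₗ LinearMap.mulLeft F (u:K), by
    refine ⟨?_, fun x y => φ.2.2 _ _⟩
    intro x y hxy
    have := φ.2.1 hxy
    simpa using this⟩
  let Φ : (Σ h : Spg β, {φ : K →ₗ[F] V // φ ≠ 0 ∧ ∀ x, (h : V ≃ₗ[F] V) (φ x) = φ (u * x)}) → Spg β :=
    fun s => γ (emb s) * (γ (shift (emb s)))⁻¹ * s.1 * γ (emb s)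
  have hΦ : ∀ s x, (Φ s : V ≃ₗ[F] V) (φ0 x) = s.2.1 x := by
    intro s x
    have h1 : (Φ s : V ≃ₗ[F] V) (φ0 x) = (γ (emb s) : V ≃ₗ[F] V)
      ((γ (shift (emb s)) : V ≃ₗ[F] V)⁻¹ ((s.1 : V ≃ₗ[F] V) ((γ (emb s) : V ≃ₗ[F] V) (φ0 x)))) := rfl
    rw [h1, hγ]
    have h2 : (s.1 : V ≃ₗ[F] V) ((emb s).1 x) = (shift (emb s)).1 x := s.2.2.2 x
    rw [h2, ← hγ, inv_apply_self', hγ]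
  apply Nat.card_le_card_of_injective Φ
  intro s t hst
  have h1 : emb s = emb t := by
    apply Subtype.ext
    ext x
    change s.2.1 x = t.2.1 x
    rw [← hΦ, ← hΦ, hst]
  have h2 : s.1 = t.1 := by
    have : Φ s = Φ t := hst
    simp only [Φ, h1] at this
    exact mul_left_cancel (mul_right_cancel this)
  have h3 : s.2.1 = t.2.1 := congrArg Subtype.val h1
  obtain ⟨s1, s2, s3⟩ := s
  obtain ⟨t1, t2, t3⟩ := t
  simp only at h2 h3
  subst h2
  subst h3
  rfl

theorem Nint_ge [Finite V] {D : ℕ} {u : Kˣ} (hu : u ∈ Lam F K D) (h : V ≃ₗ[F] V) (y : V)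
    (hy : y ≠ 0) (hT : aeval (h : Module.End F V) (minpoly F (u:K)) y = 0) :
    Nat.card F ^ (Module.finrank F K) - 1 ≤ Nint u h := by
  obtain ⟨φ, hφ, e⟩ := inter_exists hu (h : Module.End F V) y hy hT
  have hinj := inter_inj hu (h : Module.End F V) φ e hφ
  rw [← Module.natCard_eq_pow_finrank, ← Nat.card_units]
  unfold Nint
  refine Nat.card_le_card_of_injective (fun c : Kˣ => ⟨φ ∘ₗ LinearMap.mulLeft F (c:K), ?_, ?_⟩) ?_
  · intro h0
    have := LinearMap.congr_fun h0 1
    simp only [LinearMap.comp_apply, LinearMap.mulLeft_apply, mul_one, LinearMap.zero_apply] at this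
    rw [← map_zero φ] at this
    exact c.ne_zero (hinj this)
  · intro x
    have := e (c * x)
    simp only [LinearMap.comp_apply, LinearMap.mulLeft_apply]
    rw [mul_left_comm]; exact this
  · intro c d hcd
    have := LinearMap.congr_fun (congrArg Subtype.val hcd) 1
    simp only [LinearMap.comp_apply, LinearMap.mulLeft_apply, mul_one] at this
    exact Units.ext (hinj this)
end

set_option linter.unusedSectionVars false
section
variable {F K V : Type*} [Field F] [Finite F] [Field K] [Finite K] [Algebra F K]
  [AddCommGroup V] [Module F V]

theorem irr_factor (T : Module.End F V) (P : F[X]) (hP : P ≠ 0) (y : V) (hy : y ≠ 0)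
    (h : aeval T P y = 0) : ∃ p, Irreducible p ∧ p ∣ P ∧ ∃ z : V, z ≠ 0 ∧ aeval T p z = 0 := by
  induction P using WfDvdMonoid.induction_on_irreducible with
  | zero => exact absurd rfl hP
  | unit u hu =>
    exfalso
    obtain ⟨v, hv⟩ := hu.exists_left_inv
    have := congrArg (aeval T v) h
    rw [← Module.End.mul_apply, ← map_mul, hv] at this
    simp at this
    exact hy this
  | mul a i ha hi ih =>
    by_cases h0 : aeval T a y = 0
    · obtain ⟨p, h1, h2, h3⟩ := ih ha h0
      exact ⟨p, h1, h2.mul_left _, h3⟩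
    · exact ⟨i, hi, dvd_mul_right _ _, _, h0, by
        rw [← Module.End.mul_apply, ← map_mul]; exact h⟩

theorem coe_pow_end (h : V ≃ₗ[F] V) (n : ℕ) (x : V) :
    ((h : Module.End F V) ^ n) x = (h ^ n) x := by
  induction n generalizing x with
  | zero => rfl
  | succ n ih => rw [pow_succ, pow_succ, Module.End.mul_apply, LinearEquiv.mul_apply, ih]; rfl

theorem bad_vec [Finite V] (h : V ≃ₗ[F] V) (hev : Even (orderOf h)) :
    ∃ p : F[X], Irreducible p ∧ p ∣ X ^ (orderOf h / 2) + 1 ∧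
      ∃ z : V, z ≠ 0 ∧ aeval (h : Module.End F V) p z = 0 := by
  have hpos : 0 < orderOf h := orderOf_pos h
  set s := orderOf h with hs
  have h2 : s / 2 ≠ 0 := by obtain ⟨j, hj⟩ := hev; omega
  have hne : h ^ (s/2) ≠ 1 := pow_ne_one_of_lt_orderOf h2 (by omega)
  have : ∃ x, (h ^ (s/2)) x ≠ x := by
    by_contra hcon
    push Not at hcon
    exact hne (LinearEquiv.ext hcon)
  obtain ⟨x, hx⟩ := this
  refine irr_factor (h : Module.End F V) (X ^ (s/2) + 1) ?_ ((h ^ (s/2)) x - x)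
    (sub_ne_zero.2 hx) ?_
  · exact (monic_X_pow_add_C (1:F) h2).ne_zero
  · simp only [map_add, map_pow, aeval_X, map_one, LinearMap.add_apply, coe_pow_end, map_sub,
      Module.End.one_apply]
    rw [← LinearEquiv.mul_apply, ← pow_add]
    have : s/2 + s/2 = s := by obtain ⟨j, hj⟩ := hev; omega
    rw [this, hs, pow_orderOf_eq_one]
    simp; abel

theorem Lam_congr {D : ℕ} {u v : Kˣ} (hu : u ∈ Lam F K D)
    (h : minpoly F (v:K) = minpoly F (u:K)) : v ∈ Lam F K D := by
  refine ⟨?_, by rw [h]; exact hu.2⟩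
  have : orderOf v = orderOf u := by
    rw [orderOf_eq_orderOf_iff]
    intro n
    have key : ∀ w : Kˣ, w ^ n = 1 ↔ minpoly F (w:K) ∣ X ^ n - 1 := by
      intro w
      rw [minpoly.dvd_iff]
      simp only [map_sub, map_pow, aeval_X, map_one, sub_eq_zero]
      rw [← Units.val_inj]; simp
    rw [key, key, h]
  rw [this]; exact hu.1

theorem Lam_inv {D : ℕ} {u : Kˣ} (hu : u ∈ Lam F K D) : u⁻¹ ∈ Lam F K D := by
  refine ⟨by rw [orderOf_inv]; exact hu.1, ?_⟩
  have h1 := hu.2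
  have hintegral : IsIntegral F (u : K) := Algebra.IsIntegral.isIntegral _
  have hintegral' : IsIntegral F ((u⁻¹ : Kˣ) : K) := Algebra.IsIntegral.isIntegral _
  rw [← IntermediateField.adjoin.finrank hintegral] at h1
  rw [← IntermediateField.adjoin.finrank hintegral', ← h1]
  have : IntermediateField.adjoin F {((u⁻¹ : Kˣ) : K)} = IntermediateField.adjoin F {(u : K)} := by
    apply le_antisymm
    · rw [IntermediateField.adjoin_simple_le_iff, Units.val_inv_eq_inv_val]
      exact inv_mem (IntermediateField.mem_adjoin_simple_self F (u : K))
    · rw [IntermediateField.adjoin_simple_le_iff]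
      have := inv_mem (IntermediateField.mem_adjoin_simple_self F ((u⁻¹ : Kˣ) : K))
      simpa using this
  rw [this]

theorem dual_vec [Finite V] {β : LinearMap.BilinForm F V} (hN : β.Nondegenerate)
    {h : V ≃ₗ[F] V} (hh : h ∈ Spg β) (p : F[X]) (y : V) (hy : y ≠ 0)
    (hp : aeval (h : Module.End F V) p y = 0) :
    ∃ z : V, z ≠ 0 ∧ aeval ((h⁻¹ : V ≃ₗ[F] V) : Module.End F V) p z = 0 := by
  by_contra hcon
  push Not at hcon
  have hinj : Function.Injective (aeval ((h⁻¹ : V ≃ₗ[F] V) : Module.End F V) p) := by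
    rw [← LinearMap.ker_eq_bot, LinearMap.ker_eq_bot']
    intro z hz
    by_contra h0
    exact hcon z h0 hz
  have hsurj := Finite.surjective_of_injective hinj
  apply hy
  apply hN.1
  intro w
  obtain ⟨z, rfl⟩ := hsurj w
  rw [← adj_poly hh, hp]; simp

theorem dual_vec' [Finite V] {β : LinearMap.BilinForm F V} (hN : β.Nondegenerate)
    {h : V ≃ₗ[F] V} (hh : h ∈ Spg β) {D : ℕ} {u : Kˣ} (hu : u ∈ Lam F K D) (y : V) (hy : y ≠ 0)
    (hp : aeval (h : Module.End F V) (minpoly F (u:K)) y = 0) :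
    ∃ z : V, z ≠ 0 ∧ aeval (h : Module.End F V) (minpoly F ((u⁻¹ : Kˣ) : K)) z = 0 := by
  obtain ⟨z, hz, hpz⟩ := dual_vec hN hh _ y hy hp
  obtain ⟨φ, hφ, e⟩ := inter_exists hu _ z hz hpz
  have hinj := inter_inj hu _ φ e hφ
  have e' : ∀ x, (h : Module.End F V) (φ x) = φ (((u⁻¹:Kˣ):K) * x) := by
    intro x
    have := e (((u⁻¹:Kˣ):K) * x)
    rw [← mul_assoc, Units.mul_inv, one_mul] at this
    rw [← this]
    exact apply_inv_self' h _
  refine ⟨φ 1, ?_, ?_⟩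
  · rw [← map_zero φ]; exact hinj.ne one_ne_zero
  · rw [← inter_poly _ φ _ e', minpoly.aeval]; simp

theorem Nint_conj [Finite V] {D B : ℕ} (L : Lev (Nat.card F) D B)
    {β : LinearMap.BilinForm F V} (hN : β.Nondegenerate)
    {h : V ≃ₗ[F] V} (hh : h ∈ Spg β) {u : Kˣ} (hu : u ∈ Lam F K D) (y : V) (hy : y ≠ 0)
    (hp : aeval (h : Module.End F V) (minpoly F (u:K)) y = 0) [Fintype (Lam F K D)] :
    2 * Module.finrank F K * (Nat.card F ^ Module.finrank F K - 1) ≤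
      ∑ v ∈ (Lam F K D).toFinset, Nint v h := by
  classical
  set C := {v : Kˣ | minpoly F (v : K) = minpoly F (u : K) ∨
      minpoly F (v : K) = minpoly F ((u⁻¹ : Kˣ) : K)} with hC
  have hfC : Fintype C := Fintype.ofFinite _
  have hcard := conj_card L u hu
  have hsub : C.toFinset ⊆ (Lam F K D).toFinset := by
    rw [Set.toFinset_subset_toFinset]
    rintro v (hv | hv)
    · exact Lam_congr hu hv
    · exact Lam_congr (Lam_inv hu) hv
  rw [← hcard, Set.ncard_eq_toFinset_card']
  refine le_trans ?_ (Finset.sum_le_sum_of_subset hsub)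
  rw [← smul_eq_mul]
  refine Finset.card_nsmul_le_sum _ _ _ ?_
  intro v hv
  obtain ⟨z, hz, hpz⟩ := dual_vec' hN hh hu y hy hp
  rw [Set.mem_toFinset] at hv
  rcases hv with hv | hv
  · exact Nint_ge (Lam_congr hu hv) h y hy (hv ▸ hp)
  · exact Nint_ge (Lam_congr (Lam_inv hu) hv) h z hz (hv ▸ hpz)
end

theorem bad_le {F V : Type*} [Field F] [Finite F] [AddCommGroup V] [Module F V] [Finite V]
    (K : ℕ → Type*) [∀ m, Field (K m)] [∀ m, Finite (K m)] [∀ m, Algebra F (K m)]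
    (hK : ∀ m, 1 ≤ m → Module.finrank F (K m) = m)
    {D B : ℕ} (L : Lev (Nat.card F) D B) {n : ℕ} (hn : Module.finrank F V = 2 * n)
    {β : LinearMap.BilinForm F V} (hA : β.IsAlt) (hN : β.Nondegenerate) :
    (Nat.card {h : Spg β // D ∣ orderOf (h : V ≃ₗ[F] V)} : ℝ) ≤
      (∑ m ∈ (Finset.Icc 1 n).filter (B ∣ ·), 1 / (2 * (m:ℝ))) * Nat.card (Spg β) := by
  classical
  have hfS : Fintype (Spg β) := Fintype.ofFinite _
  have hfL : ∀ m, Fintype (Lam F (K m) D) := fun m => Fintype.ofFinite _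
  set q := Nat.card F with hq
  have hq3 := L.qgt
  have hqm : ∀ m, 1 ≤ m → (0:ℝ) < ((q ^ m - 1 : ℕ) : ℝ) := by
    intro m hm
    have : 3 ≤ q ^ m := hq3.trans (Nat.le_self_pow (by omega) q)
    exact_mod_cast (by omega)
  have key : ∀ h : Spg β, D ∣ orderOf (h : V ≃ₗ[F] V) →
      1 ≤ ∑ m ∈ (Finset.Icc 1 n).filter (B ∣ ·), ∑ u ∈ (Lam F (K m) D).toFinset,
        (Nint u (h : V ≃ₗ[F] V) : ℝ) / (2 * m * (q ^ m - 1 : ℕ)) := by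
    intro h hD
    have hev : Even (orderOf (h : V ≃ₗ[F] V)) := by
      have := L.four_dvd.trans hD
      exact even_iff_two_dvd.2 ((by norm_num : 2 ∣ 4).trans this)
    obtain ⟨p, hp, hpd, z, hz, hpz⟩ := bad_vec (h : V ≃ₗ[F] V) hev
    set m := p.natDegree with hm
    have hm1 : 1 ≤ m := hp.natDegree_pos
    obtain ⟨hB, u, hu, hup⟩ := bad_exists (K := K m) L hp hev (orderOf_pos _).ne' hpd hD (hK m hm1)
    have hmin : aeval ((h : V ≃ₗ[F] V) : Module.End F V) (minpoly F (u : K m)) z = 0 := by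
      rw [← minpoly.eq_of_irreducible hp hup, mul_comm, map_mul, Module.End.mul_apply, hpz, map_zero]
    have hmn : m ≤ n := by
      obtain ⟨φ, hφ, e⟩ := inter_exists hu _ z hz hmin
      have h1 := iso_le hN φ (inter_inj hu _ φ e hφ) (inter_iso L hu.1 h.2 φ e)
      rw [hK m hm1] at h1
      omega
    have h2 := Nint_conj L hN h.2 hu z hz hmin
    rw [hK m hm1] at h2
    have hmem : m ∈ (Finset.Icc 1 n).filter (B ∣ ·) := by simp [hm1, hmn]; exact hB
    refine le_trans ?_ (Finset.single_le_sum (fun i _ => by positivity) hmem)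
    rw [← Finset.sum_div, le_div_iff₀ (by have := hqm m hm1; positivity), one_mul]
    exact_mod_cast h2
  have h1 : (Nat.card {h : Spg β // D ∣ orderOf (h : V ≃ₗ[F] V)} : ℝ) =
      ∑ h : Spg β, if D ∣ orderOf (h : V ≃ₗ[F] V) then (1:ℝ) else 0 := by
    rw [Nat.card_eq_fintype_card, Fintype.card_subtype]
    simp
  rw [h1]
  calc _ ≤ ∑ h : Spg β, ∑ m ∈ (Finset.Icc 1 n).filter (B ∣ ·), ∑ u ∈ (Lam F (K m) D).toFinset,
        (Nint u (h : V ≃ₗ[F] V) : ℝ) / (2 * m * (q ^ m - 1 : ℕ)) := by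
        refine Finset.sum_le_sum fun h _ => ?_
        split_ifs with hh
        · exact key h hh
        · positivity
    _ = ∑ m ∈ (Finset.Icc 1 n).filter (B ∣ ·), ∑ u ∈ (Lam F (K m) D).toFinset,
        (∑ h : Spg β, (Nint u (h : V ≃ₗ[F] V) : ℝ)) / (2 * m * (q ^ m - 1 : ℕ)) := by
        rw [Finset.sum_comm]
        refine Finset.sum_congr rfl fun m _ => ?_
        rw [Finset.sum_comm]
        refine Finset.sum_congr rfl fun u _ => ?_
        rw [Finset.sum_div]
    _ ≤ ∑ m ∈ (Finset.Icc 1 n).filter (B ∣ ·), ∑ u ∈ (Lam F (K m) D).toFinset,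
        (Nat.card (Spg β) : ℝ) / (2 * m * (q ^ m - 1 : ℕ)) := by
        gcongr with m hm u hu
        have := Nint_sum L (Set.mem_toFinset.1 hu) hA hN
        exact_mod_cast this
    _ ≤ _ := by
        rw [Finset.sum_mul]
        refine Finset.sum_le_sum fun m hm => ?_
        simp only [Finset.mem_filter, Finset.mem_Icc] at hm
        rw [Finset.sum_const, nsmul_eq_mul, ← Set.ncard_eq_toFinset_card']
        have h3 := Lam_le (F := F) (K := K m) (D := D)
        rw [hK m hm.1.1, ← hq] at h3
        have h4 : ((Lam F (K m) D).ncard : ℝ) ≤ ((q ^ m - 1 : ℕ) : ℝ) := by exact_mod_cast h3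
        have h5 := hqm m hm.1.1
        have h6 : (0:ℝ) < m := by exact_mod_cast hm.1.1
        calc _ ≤ ((q ^ m - 1 : ℕ) : ℝ) * ((Nat.card (Spg β) : ℝ) / (2 * m * (q ^ m - 1 : ℕ))) := by
              gcongr
          _ = _ := by field_simp

set_option linter.unusedSectionVars false
section
variable {F K V W : Type*} [Field F] [Finite F] [Field K] [Finite K] [Algebra F K]
  [AddCommGroup V] [Module F V] [AddCommGroup W] [Module F W]

theorem inter_zero_of_order {D : ℕ} {u : Kˣ} (hu : u ∈ Lam F K D) (T : W ≃ₗ[F] W)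
    (hT : ¬ D ∣ orderOf T) (φ : K →ₗ[F] W) (h : ∀ x, T (φ x) = φ (u * x)) : φ = 0 := by
  by_contra h0
  have hinj := inter_inj hu (T : Module.End F W) φ h h0
  have hp : ∀ n : ℕ, ∀ x, (T ^ n) (φ x) = φ ((u : K) ^ n * x) := by
    intro n
    induction n with
    | zero => intro x; simp
    | succ n ih => intro x; rw [pow_succ, LinearEquiv.mul_apply, h, ih]; congr 1; ring
  have h1 := hp (orderOf T) 1
  rw [pow_orderOf_eq_one, mul_one] at h1
  have h2 := hinj h1
  apply hT
  refine hu.1.trans (orderOf_dvd_of_pow_eq_one ?_)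
  ext
  simpa using h2.symm

theorem aeval_mulLeft (a : K) (p : F[X]) (y : K) :
    aeval (LinearMap.mulLeft F a) p y = aeval a p * y := by
  have := Polynomial.aeval_algHom_apply (Algebra.lmul F K) a p
  have h2 := congrArg (fun T : Module.End F K => T y) this
  exact h2

theorem inter_root {K' : Type*} [Field K'] [Finite K'] [Algebra F K'] (a : K) (b : K')
    (φ : K' →ₗ[F] K) (h : ∀ x, a * φ x = φ (b * x)) (h0 : φ ≠ 0) : aeval a (minpoly F b) = 0 := by
  have h1 : ∃ x, φ x ≠ 0 := by
    by_contra hcon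
    push Not at hcon
    exact h0 (LinearMap.ext hcon)
  obtain ⟨x, hx⟩ := h1
  have h2 := inter_poly (LinearMap.mulLeft F a) φ b h (minpoly F b) x
  rw [minpoly.aeval, zero_mul, map_zero, aeval_mulLeft] at h2
  exact (mul_eq_zero.1 h2.symm).resolve_right hx

theorem inter_scalar {D : ℕ} {u : Kˣ} (hu : u ∈ Lam F K D) (φ : K →ₗ[F] K)
    (h : ∀ x, (u : K) * φ x = φ (u * x)) (x : K) : φ x = φ 1 * x := by
  obtain ⟨p, hp⟩ := Lam.gen hu x
  have h2 := inter_poly (LinearMap.mulLeft F (u : K)) φ u h p 1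
  rw [aeval_mulLeft, hp, mul_one] at h2
  rw [h2, mul_comm]

/-- Model block transformation. -/
def Mm (u : Kˣ) (g : W ≃ₗ[F] W) : ((K × K) × W) ≃ₗ[F] ((K × K) × W) where
  toFun x := (((u : K) * x.1.1, ((u⁻¹ : Kˣ) : K) * x.1.2), g x.2)
  invFun x := ((((u⁻¹ : Kˣ) : K) * x.1.1, (u : K) * x.1.2), g.symm x.2)
  map_add' x y := by simp [mul_add]
  map_smul' c x := by simp
  left_inv x := by simp
  right_inv x := by simp

theorem Mm_apply (u : Kˣ) (g : W ≃ₗ[F] W) (x : (K × K) × W) :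
    Mm u g x = (((u : K) * x.1.1, ((u⁻¹ : Kˣ) : K) * x.1.2), g x.2) := rfl

/-- Model blocks as a homomorphism. -/
def MmHom (F K W : Type*) [Field F] [Field K] [Algebra F K] [AddCommGroup W] [Module F W] :
    Kˣ × (W ≃ₗ[F] W) →* (((K × K) × W) ≃ₗ[F] ((K × K) × W)) where
  toFun x := Mm x.1 x.2
  map_one' := by
    have ha : ∀ (u : Kˣ) (g : W ≃ₗ[F] W) (x : (K × K) × W),
      Mm u g x = (((u : K) * x.1.1, ((u⁻¹ : Kˣ) : K) * x.1.2), g x.2) := fun _ _ _ => rfl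
    apply LinearEquiv.ext
    intro x
    simp [ha]
  map_mul' x y := by
    have ha : ∀ (u : Kˣ) (g : W ≃ₗ[F] W) (x : (K × K) × W),
      Mm u g x = (((u : K) * x.1.1, ((u⁻¹ : Kˣ) : K) * x.1.2), g x.2) := fun _ _ _ => rfl
    apply LinearEquiv.ext
    intro z
    simp only [ha, LinearEquiv.mul_apply, Prod.fst_mul, Prod.snd_mul, mul_inv, Units.val_mul,
      mul_assoc]

theorem MmHom_apply (u : Kˣ) (g : W ≃ₗ[F] W) : MmHom F K W (u, g) = Mm u g := rfl

theorem MmHom_inj : Function.Injective (MmHom F K W) := by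
  rintro ⟨u, g⟩ ⟨v, h⟩ e
  rw [MmHom_apply, MmHom_apply] at e
  have h1 := fun x => congrArg (fun T : ((K × K) × W) ≃ₗ[F] ((K × K) × W) => T x) e
  simp only [Mm_apply, Prod.mk.injEq] at h1
  refine Prod.ext (Units.ext ?_) (LinearEquiv.ext fun w => ?_)
  · simpa using (h1 ((1, 0), 0)).1.1
  · simpa using (h1 ((0, 0), w)).2

theorem orderOf_Mm (u : Kˣ) (g : W ≃ₗ[F] W) :
    orderOf (Mm u g : ((K × K) × W) ≃ₗ[F] ((K × K) × W)) = Nat.lcm (orderOf u) (orderOf g) := by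
  rw [← MmHom_apply, orderOf_injective _ MmHom_inj, Prod.orderOf]

theorem Mm_mul (u v : Kˣ) (g h : W ≃ₗ[F] W) :
    Mm u g * Mm v h = (Mm (u * v) (g * h) : ((K × K) × W) ≃ₗ[F] ((K × K) × W)) := 
  ((MmHom F K W).map_mul (u, g) (v, h)).symm

theorem Mm_pow (u : Kˣ) (g : W ≃ₗ[F] W) (n : ℕ) :
    (Mm u g : ((K × K) × W) ≃ₗ[F] ((K × K) × W)) ^ n = Mm (u ^ n) (g ^ n) := by
  rw [← MmHom_apply, ← map_pow]; rfl

/-- Model symplectic form. -/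
noncomputable def bm (K : Type*) [Field K] [Algebra F K] (β : LinearMap.BilinForm F W) :
    LinearMap.BilinForm F ((K × K) × W) :=
  LinearMap.mk₂ F (fun x y => Algebra.trace F K (x.1.1 * y.1.2) - Algebra.trace F K (y.1.1 * x.1.2)
    + β x.2 y.2)
    (by intro x y z; simp [add_mul, mul_add]; ring)
    (by intro c x y; simp; ring)
    (by intro x y z; simp [add_mul, mul_add]; ring)
    (by intro c x y; simp; ring)

theorem bm_apply (β : LinearMap.BilinForm F W) (x y : (K × K) × W) :
    bm K β x y = Algebra.trace F K (x.1.1 * y.1.2) - Algebra.trace F K (y.1.1 * x.1.2)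
    + β x.2 y.2 := rfl

theorem Mm_mem {β : LinearMap.BilinForm F W} (u : Kˣ) {g : W ≃ₗ[F] W} (hg : g ∈ Spg β) :
    Mm u g ∈ Spg (bm K β) := by
  intro x y
  simp only [bm_apply, Mm_apply]
  rw [hg]
  have : ∀ a b : K, (u : K) * a * (((u⁻¹ : Kˣ) : K) * b) = a * b := by
    intro a b
    rw [mul_mul_mul_comm, Units.mul_inv, one_mul]
  rw [this, this]

theorem tr_zero (r : K) (h : ∀ a : K, Algebra.trace F K (a * r) = 0) : r = 0 := by
  have := traceForm_nondegenerate F K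
  apply this.1
  intro a
  rw [Algebra.traceForm_apply, mul_comm]
  exact h a

theorem block [Finite W] {D B : ℕ} (L : Lev (Nat.card F) D B) {u : Kˣ} (hu : u ∈ Lam F K D)
    {β : LinearMap.BilinForm F W} {z : ((K × K) × W) ≃ₗ[F] ((K × K) × W)} (hz : z ∈ Spg (bm K β))
    (g g' : W ≃ₗ[F] W) (hg' : ¬ D ∣ orderOf g') (h : ∀ x, z (Mm u g x) = Mm u g' (z x)) :
    ∃ c : Kˣ, ∃ y ∈ Spg β, z = Mm c y := by
  let i1 : K →ₗ[F] ((K × K) × W) := LinearMap.inl F _ _ ∘ₗ LinearMap.inl F _ _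
  let i2 : K →ₗ[F] ((K × K) × W) := LinearMap.inl F _ _ ∘ₗ LinearMap.inr F _ _
  let i3 : W →ₗ[F] ((K × K) × W) := LinearMap.inr F _ _
  let p1 : ((K × K) × W) →ₗ[F] K := LinearMap.fst F _ _ ∘ₗ LinearMap.fst F _ _
  let p2 : ((K × K) × W) →ₗ[F] K := LinearMap.snd F _ _ ∘ₗ LinearMap.fst F _ _
  let p3 : ((K × K) × W) →ₗ[F] W := LinearMap.snd F _ _
  let zz : ((K × K) × W) →ₗ[F] ((K × K) × W) := z
  have hu' := Lam_inv hu
  have H1 : ∀ x : K, z ((u * x, 0), 0) = Mm u g' (z ((x, 0), 0)) := by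
    intro x; rw [← h]; simp [Mm_apply]
  have H2 : ∀ x : K, z ((0, ((u⁻¹ : Kˣ) : K) * x), 0) = Mm u g' (z ((0, x), 0)) := by
    intro x; rw [← h]; simp [Mm_apply]
  have e13 : p3 ∘ₗ zz ∘ₗ i1 = 0 := by
    apply inter_zero_of_order hu g' hg'
    intro x
    change g' (z ((x, 0), 0)).2 = (z ((u * x, 0), 0)).2
    rw [H1]; rfl
  have e23 : p3 ∘ₗ zz ∘ₗ i2 = 0 := by
    apply inter_zero_of_order hu' g' hg'
    intro x
    change g' (z ((0, x), 0)).2 = (z ((0, ((u⁻¹ : Kˣ) : K) * x), 0)).2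
    rw [H2]; rfl
  have e12 : p2 ∘ₗ zz ∘ₗ i1 = 0 := by
    by_contra h0
    refine L.nsr u hu.1 (inter_root ((u⁻¹ : Kˣ) : K) (u : K) _ ?_ h0)
    intro x
    change ((u⁻¹ : Kˣ) : K) * (z ((x, 0), 0)).1.2 = (z ((u * x, 0), 0)).1.2
    rw [H1]; rfl
  have e21 : p1 ∘ₗ zz ∘ₗ i2 = 0 := by
    by_contra h0
    have := L.nsr u⁻¹ hu'.1
    rw [inv_inv] at this
    refine this (inter_root (u : K) ((u⁻¹ : Kˣ) : K) _ ?_ h0)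
    intro x
    change (u : K) * (z ((0, x), 0)).1.1 = (z ((0, ((u⁻¹ : Kˣ) : K) * x), 0)).1.1
    rw [H2]; rfl
  have e11 := inter_scalar hu (p1 ∘ₗ zz ∘ₗ i1) (by
    intro x
    change (u : K) * (z ((x, 0), 0)).1.1 = (z ((u * x, 0), 0)).1.1
    rw [H1]; rfl)
  have e22 := inter_scalar hu' (p2 ∘ₗ zz ∘ₗ i2) (by
    intro x
    change ((u⁻¹ : Kˣ) : K) * (z ((0, x), 0)).1.2 = (z ((0, ((u⁻¹ : Kˣ) : K) * x), 0)).1.2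
    rw [H2]; rfl)
  set c := (p1 ∘ₗ zz ∘ₗ i1) 1
  set d := (p2 ∘ₗ zz ∘ₗ i2) 1
  have Z1 : ∀ x : K, z ((x, 0), 0) = ((c * x, 0), 0) := by
    intro x
    refine Prod.ext (Prod.ext (e11 x) (LinearMap.congr_fun e12 x)) (LinearMap.congr_fun e13 x)
  have Z2 : ∀ x : K, z ((0, x), 0) = ((0, d * x), 0) := by
    intro x
    refine Prod.ext (Prod.ext (LinearMap.congr_fun e21 x) (e22 x)) (LinearMap.congr_fun e23 x)
  have hcd : c * d = 1 := by
    have : c * d - 1 = 0 := by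
      apply tr_zero (F := F)
      intro a
      have h1 := hz ((a, 0), 0) ((0, 1), 0)
      rw [Z1, Z2] at h1
      simp only [bm_apply] at h1
      simp only [mul_one, mul_zero, map_zero, sub_zero, add_zero] at h1
      rw [mul_sub, map_sub, mul_one, sub_eq_zero, ← h1]
      congr 1; ring
    exact sub_eq_zero.1 this
  have hc0 : c ≠ 0 := left_ne_zero_of_mul_eq_one hcd
  have hd0 : d ≠ 0 := right_ne_zero_of_mul_eq_one hcd
  have Z3 : ∀ w : W, z ((0, 0), w) = ((0, 0), (z ((0, 0), w)).2) := by
    intro w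
    refine Prod.ext (Prod.ext ?_ ?_) rfl
    · apply tr_zero (F := F)
      intro a
      have h1 := hz ((0, d⁻¹ * a), 0) ((0, 0), w)
      rw [Z2] at h1
      simp only [bm_apply] at h1
      simp only [mul_zero, zero_mul, map_zero, sub_zero, add_zero, LinearMap.zero_apply, zero_sub,
        neg_eq_zero] at h1
      rw [← h1]
      congr 1; field_simp
    · apply tr_zero (F := F)
      intro a
      have h1 := hz ((c⁻¹ * a, 0), 0) ((0, 0), w)
      rw [Z1] at h1
      simp only [bm_apply] at h1
      simp only [mul_zero, zero_mul, map_zero, sub_zero, add_zero, LinearMap.zero_apply] at h1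
      rw [← h1]
      congr 1; field_simp
  have hinj : Function.Injective (p3 ∘ₗ zz ∘ₗ i3) := by
    intro w w' hw
    have : z ((0, 0), w) = z ((0, 0), w') := by
      rw [Z3 w, Z3 w']
      exact Prod.ext rfl hw
    exact (Prod.ext_iff.1 (z.injective this)).2
  have hbij : Function.Bijective (p3 ∘ₗ zz ∘ₗ i3) := Finite.injective_iff_bijective.1 hinj
  let y : W ≃ₗ[F] W := LinearEquiv.ofBijective _ hbij
  have hy : ∀ w, y w = (z ((0, 0), w)).2 := fun w => rfl
  refine ⟨⟨c, d, hcd, by rw [mul_comm]; exact hcd⟩, y, ?_, ?_⟩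
  · intro w w'
    have h1 := hz ((0, 0), w) ((0, 0), w')
    rw [Z3 w, Z3 w'] at h1
    simpa [bm_apply, hy] using h1
  · apply LinearEquiv.ext
    rintro ⟨⟨a, b⟩, w⟩
    have : (((a, b), w) : (K × K) × W) = ((a, 0), 0) + ((0, b), 0) + ((0, 0), w) := by simp
    rw [this, map_add, map_add, Z1, Z2, Z3, ← hy]
    simp [Mm_apply]

/-- The set of elements of model type. -/
def Iset (β0 : LinearMap.BilinForm F V) (β : LinearMap.BilinForm F W) (D : ℕ) (u : Kˣ) :
    Set (V ≃ₗ[F] V) :=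
  {h | h ∈ Spg β0 ∧ ∃ e : V ≃ₗ[F] ((K × K) × W), ∃ g ∈ Spg β, ¬ D ∣ orderOf g ∧
    ∀ x, e (h x) = Mm u g (e x)}

theorem Iset_card [Finite V] [Finite W] {D B : ℕ} (L : Lev (Nat.card F) D B) {u : Kˣ}
    (hu : u ∈ Lam F K D) {β0 : LinearMap.BilinForm F V} {β : LinearMap.BilinForm F W}
    (e : V ≃ₗ[F] ((K × K) × W)) (he : ∀ x y, bm K β (e x) (e y) = β0 x y) :
    Nat.card (Spg β0) * Nat.card {g : Spg β // ¬ D ∣ orderOf (g : W ≃ₗ[F] W)} ≤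
      (Iset β0 β D u).ncard * (Nat.card F ^ Module.finrank F K - 1) * Nat.card (Spg β) := by
  have hes : ∀ x y, β0 (e.symm x) (e.symm y) = bm K β x y := by
    intro x y; rw [← he]; simp
  -- element attached to a pair
  let P : (Spg β0) → (W ≃ₗ[F] W) → (V ≃ₗ[F] V) := fun y g =>
    (y : V ≃ₗ[F] V)⁻¹ * ((e.trans (Mm u g)).trans e.symm) * (y : V ≃ₗ[F] V)
  have hP : ∀ y g x, P y g x = (y : V ≃ₗ[F] V)⁻¹ (e.symm (Mm u g (e ((y : V ≃ₗ[F] V) x)))) :=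
    fun _ _ _ => rfl
  have hI : ∀ (y : Spg β0) (g : {g : Spg β // ¬ D ∣ orderOf (g : W ≃ₗ[F] W)}),
      P y g ∈ Iset β0 β D u := by
    intro y g
    refine ⟨?_, (y : V ≃ₗ[F] V).trans e, g, g.1.2, g.2, ?_⟩
    · refine mul_mem (mul_mem (inv_mem y.2) ?_) y.2
      intro a b
      simp only [LinearEquiv.trans_apply]
      rw [hes, Mm_mem u g.1.2, he]
    · intro x
      simp [hP, apply_inv_self']
  let Q := {h : V ≃ₗ[F] V // ∃ p : Spg β0 × {g : Spg β // ¬ D ∣ orderOf (g : W ≃ₗ[F] W)}, 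
    P p.1 p.2 = h}
  let f : Q × Kˣ × Spg β → Spg β0 × {g : Spg β // ¬ D ∣ orderOf (g : W ≃ₗ[F] W)} := fun t =>
    let y0 := t.1.2.choose.1
    let g0 := t.1.2.choose.2
    let c := t.2.1
    let y2 := t.2.2
    (⟨((e.trans (Mm c (y2 : W ≃ₗ[F] W))).trans e.symm), by
        intro a b
        simp only [LinearEquiv.trans_apply]
        rw [hes, Mm_mem c y2.2, he]⟩ * y0,
      ⟨y2 * g0 * y2⁻¹, by
        have : orderOf ((y2 * g0 * y2⁻¹ : Spg β) : W ≃ₗ[F] W) = orderOf ((g0 : Spg β) : W ≃ₗ[F] W) := by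
          rw [Subgroup.orderOf_coe, Subgroup.orderOf_coe]
          exact orderOf_injective (MulAut.conj y2).toMonoidHom (MulAut.conj y2).injective _
        rw [this]; exact g0.2⟩)
  have hf : Function.Surjective f := by
    rintro ⟨y, g⟩
    let q : Q := ⟨P y g, (y, g), rfl⟩
    have hq : P q.2.choose.1 q.2.choose.2 = P y g := q.2.choose_spec
    set y0 := q.2.choose.1 with hy0
    set g0 := q.2.choose.2 with hg0
    -- z = e y y0⁻¹ e⁻¹
    let z : ((K × K) × W) ≃ₗ[F] ((K × K) × W) :=
      (e.symm.trans ((y * y0⁻¹ : Spg β0) : V ≃ₗ[F] V)).trans e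
    have hz : ∀ x, z x = e (((y * y0⁻¹ : Spg β0) : V ≃ₗ[F] V) (e.symm x)) := fun _ => rfl
    have hzS : z ∈ Spg (bm K β) := by
      intro a b
      rw [hz, hz, he, (y * y0⁻¹).2, hes]
    obtain ⟨c, y2, hy2, hzc⟩ := block L hu hzS (g0 : W ≃ₗ[F] W) (g : W ≃ₗ[F] W) g.2 (by
      intro x
      have h1 := congrArg (fun T : V ≃ₗ[F] V => e ((y : V ≃ₗ[F] V)
        (T ((y0 : V ≃ₗ[F] V)⁻¹ (e.symm x))))) hq
      simp only [hP] at h1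
      rw [apply_inv_self', apply_inv_self'] at h1
      simpa [hz] using h1)
    have hzy : (y2 : W ≃ₗ[F] W) * (g0 : W ≃ₗ[F] W) * y2⁻¹ = (g : W ≃ₗ[F] W) := by
      rw [mul_inv_eq_iff_eq_mul]
      have : Mm c y2 * Mm u (g0 : W ≃ₗ[F] W) = Mm u (g : W ≃ₗ[F] W) * Mm c y2 := by
        rw [← hzc]
        apply LinearEquiv.ext
        intro x
        have h1 := congrArg (fun T : V ≃ₗ[F] V => e ((y : V ≃ₗ[F] V)
          (T ((y0 : V ≃ₗ[F] V)⁻¹ (e.symm x))))) hq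
        simp only [hP] at h1
        rw [apply_inv_self', apply_inv_self'] at h1
        simpa [hz] using h1
      rw [Mm_mul, Mm_mul] at this
      exact (Prod.ext_iff.1 (MmHom_inj (a₁ := (_, _)) (a₂ := (_, _)) this)).2
    refine ⟨(q, c, ⟨y2, hy2⟩), ?_⟩
    refine Prod.ext (Subtype.ext ?_) (Subtype.ext (Subtype.ext ?_))
    · apply LinearEquiv.ext
      intro x
      change e.symm (Mm c y2 (e ((y0 : V ≃ₗ[F] V) x))) = (y : V ≃ₗ[F] V) x
      rw [← hzc, hz]
      simp [inv_apply_self']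
    · exact hzy
  have h1 := Nat.card_le_card_of_surjective f hf
  rw [Nat.card_prod, Nat.card_prod, Nat.card_prod, Nat.card_units, ← mul_assoc] at h1
  refine h1.trans ?_
  rw [Module.natCard_eq_pow_finrank (K := F) (V := K)]
  gcongr
  rw [← Nat.card_coe_set_eq]
  refine Nat.card_le_card_of_injective (fun q : Q => ⟨q.1, ?_⟩) ?_
  · obtain ⟨h, p, rfl⟩ := q
    exact hI _ _
  · intro a b hab
    exact Subtype.ext (congrArg (fun t => t.1) hab)

theorem Iset_unique {K' : Type*} [Field K'] [Finite K'] [Algebra F K'] {D : ℕ}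
    {u : Kˣ} {v : K'ˣ} (hv : v ∈ Lam F K' D)
    {β0 : LinearMap.BilinForm F V} {β : LinearMap.BilinForm F W} {h : V ≃ₗ[F] V}
    (hh : h ∈ Iset β0 β D u) (φ : K' →ₗ[F] V) (h0 : φ ≠ 0) (hφ : ∀ x, h (φ x) = φ (v * x)) :
    minpoly F (v : K') = minpoly F (u : K) ∨ minpoly F (v : K') = minpoly F ((u⁻¹ : Kˣ) : K) := by
  obtain ⟨-, e, g, hg, hD, he⟩ := hh
  let p1 : ((K × K) × W) →ₗ[F] K := LinearMap.fst F _ _ ∘ₗ LinearMap.fst F _ _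
  let p2 : ((K × K) × W) →ₗ[F] K := LinearMap.snd F _ _ ∘ₗ LinearMap.fst F _ _
  let p3 : ((K × K) × W) →ₗ[F] W := LinearMap.snd F _ _
  let ee : V →ₗ[F] ((K × K) × W) := e
  have H : ∀ x, e (φ (v * x)) = Mm u g (e (φ x)) := by
    intro x; rw [← he, hφ]
  have e3 : p3 ∘ₗ ee ∘ₗ φ = 0 := by
    apply inter_zero_of_order hv g hD
    intro x
    change g (e (φ x)).2 = (e (φ (v * x))).2
    rw [H]; rfl
  have hirr : Irreducible (minpoly F (v : K')) := minpoly.irreducible (Algebra.IsIntegral.isIntegral _)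
  have hmon : (minpoly F (v : K')).Monic := minpoly.monic (Algebra.IsIntegral.isIntegral _)
  by_cases e1 : p1 ∘ₗ ee ∘ₗ φ = 0
  · by_cases e2 : p2 ∘ₗ ee ∘ₗ φ = 0
    · exfalso
      apply h0
      ext x
      have : e (φ x) = 0 := 
        Prod.ext (Prod.ext (LinearMap.congr_fun e1 x) (LinearMap.congr_fun e2 x))
          (LinearMap.congr_fun e3 x)
      simpa using this
    · right
      refine minpoly.eq_of_irreducible_of_monic hirr (inter_root _ _ _ ?_ e2) hmon
      intro x
      change ((u⁻¹ : Kˣ) : K) * (e (φ x)).1.2 = (e (φ (v * x))).1.2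
      rw [H]; rfl
  · left
    refine minpoly.eq_of_irreducible_of_monic hirr (inter_root _ _ _ ?_ e1) hmon
    intro x
    change (u : K) * (e (φ x)).1.1 = (e (φ (v * x))).1.1
    rw [H]; rfl

theorem Iset_inter {D : ℕ} {u : Kˣ}
    {β0 : LinearMap.BilinForm F V} {β : LinearMap.BilinForm F W} {h : V ≃ₗ[F] V}
    (hh : h ∈ Iset β0 β D u) : ∃ φ : K →ₗ[F] V, φ ≠ 0 ∧ ∀ x, h (φ x) = φ (u * x) := by
  obtain ⟨-, e, g, hg, hD, he⟩ := hh
  let i1 : K →ₗ[F] ((K × K) × W) := LinearMap.inl F _ _ ∘ₗ LinearMap.inl F _ _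
  refine ⟨(e.symm : ((K × K) × W) →ₗ[F] V) ∘ₗ i1, ?_, ?_⟩
  · intro h0
    have := LinearMap.congr_fun h0 1
    have h1 : e.symm ((1, 0), 0) = 0 := this
    simp at h1
  · intro x
    apply e.injective
    rw [he]
    change Mm u g (e (e.symm ((x, 0), 0))) = e (e.symm ((u * x, 0), 0))
    simp [Mm_apply]

theorem Iset_target [Finite V] [Finite W] {D B : ℕ} (L : Lev (Nat.card F) D B)
    (h2F : (2 : F) ≠ 0) {u : Kˣ} (hu : u ∈ Lam F K D)
    {β0 : LinearMap.BilinForm F V} {β : LinearMap.BilinForm F W} {h : V ≃ₗ[F] V}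
    (hh : h ∈ Iset β0 β D u) : Even (orderOf h) ∧ orderOf (h ^ (orderOf h / 2)) = 2 ∧
      Module.finrank F (LinearMap.ker (((h ^ (orderOf h / 2) : V ≃ₗ[F] V) : Module.End F V) + 1))
        ≤ 2 * Module.finrank F K := by
  obtain ⟨-, e, g, hg, hD, he⟩ := hh
  have hpw : ∀ n : ℕ, ∀ x, e ((h ^ n) x) = (Mm u g ^ n) (e x) := by
    intro n
    induction n with
    | zero => intro x; rfl
    | succ n ih => intro x; rw [pow_succ, LinearEquiv.mul_apply, ih, he, pow_succ]; rfl
  have hord : orderOf h = Nat.lcm (orderOf u) (orderOf g) := by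
    rw [← orderOf_Mm (F := F)]
    apply Nat.dvd_antisymm
    · apply orderOf_dvd_of_pow_eq_one
      apply LinearEquiv.ext
      intro x
      apply e.injective
      rw [hpw, pow_orderOf_eq_one]; rfl
    · apply orderOf_dvd_of_pow_eq_one
      apply LinearEquiv.ext
      intro x
      have := hpw (orderOf h) (e.symm x)
      rw [pow_orderOf_eq_one] at this
      simp at this
      exact this.symm
  have hDs : D ∣ orderOf h := hu.1.trans (hord ▸ Nat.dvd_lcm_left _ _)
  have hgs : orderOf g ∣ orderOf h := hord ▸ Nat.dvd_lcm_right _ _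
  have hpos : 0 < orderOf h := orderOf_pos h
  have h2 : 2 ∣ orderOf h := ((by norm_num : 2 ∣ 4).trans L.four_dvd).trans hDs
  refine ⟨even_iff_two_dvd.2 h2, ?_, ?_⟩
  · rw [orderOf_pow_of_dvd (by omega) (Nat.div_dvd_of_dvd h2), Nat.div_div_self h2 hpos.ne']
  · set s := orderOf h
    have hd : orderOf g ∣ s / 2 := dvd_half L.pow hpos.ne' hDs hgs hD
    have hg1 : g ^ (s / 2) = 1 := orderOf_dvd_iff_pow_eq_one.1 hd
    let N := LinearMap.ker (((h ^ (s / 2) : V ≃ₗ[F] V) : Module.End F V) + 1)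
    let ψ : N →ₗ[F] (K × K) := LinearMap.fst F _ _ ∘ₗ (e : V →ₗ[F] ((K × K) × W)) ∘ₗ N.subtype
    have hψ : Function.Injective ψ := by
      rw [← LinearMap.ker_eq_bot, LinearMap.ker_eq_bot']
      rintro ⟨x, hx⟩ hx0
      have hx1 : (e x).1 = 0 := hx0
      have hx2 : (h ^ (s / 2)) x + x = 0 := hx
      have hx3 := congrArg e hx2
      rw [map_add, hpw, Mm_pow, hg1, map_zero] at hx3
      have hx4 : (e x).2 + (e x).2 = 0 := (Prod.ext_iff.1 hx3).2
      rw [← two_smul F, smul_eq_zero] at hx4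
      have : e x = 0 := Prod.ext hx1 (hx4.resolve_left h2F)
      simpa using this
    have h3 := LinearMap.finrank_le_finrank_of_injective hψ
    rw [Module.finrank_prod] at h3
    change Module.finrank F N ≤ _
    omega
end

set_option linter.unusedSectionVars false

theorem lower {F V : Type*} [Field F] [Finite F] [AddCommGroup V] [Module F V] [Finite V]
    (K : ℕ → Type*) [∀ m, Field (K m)] [∀ m, Finite (K m)] [∀ m, Algebra F (K m)]
    (hK : ∀ m, 1 ≤ m → Module.finrank F (K m) = m) (h2F : (2 : F) ≠ 0)
    {D B : ℕ} (L : Lev (Nat.card F) D B) (k : ℕ)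
    (β0 : LinearMap.BilinForm F V)
    (W : ℕ → Type*) [∀ m, AddCommGroup (W m)] [∀ m, Module F (W m)] [∀ m, Finite (W m)]
    (β : ∀ m, LinearMap.BilinForm F (W m))
    (he : ∀ m, 1 ≤ m → m ≤ k → ∃ e : V ≃ₗ[F] ((K m × K m) × W m),
      ∀ x y, bm (K m) (β m) (e x) (e y) = β0 x y)
    (hgood : ∀ m, 1 ≤ m → m ≤ k → B ∣ m → (Nat.card (Spg (β m)) : ℝ) ≤
      2 * Nat.card {g : Spg (β m) // ¬ D ∣ orderOf (g : W m ≃ₗ[F] W m)}) :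
    (∑ m ∈ (Finset.Icc 1 k).filter (B ∣ ·), 1 / (16 * (m:ℝ))) * Nat.card (Spg β0) ≤
      ({h : V ≃ₗ[F] V | h ∈ Spg β0 ∧ Even (orderOf h) ∧ orderOf (h ^ (orderOf h / 2)) = 2 ∧
      Module.finrank F (LinearMap.ker (((h ^ (orderOf h / 2) : V ≃ₗ[F] V) : Module.End F V) + 1))
        ≤ 2 * k}.ncard : ℝ) := by
  classical
  set T := {h : V ≃ₗ[F] V | h ∈ Spg β0 ∧ Even (orderOf h) ∧ orderOf (h ^ (orderOf h / 2)) = 2 ∧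
      Module.finrank F (LinearMap.ker (((h ^ (orderOf h / 2) : V ≃ₗ[F] V) : Module.End F V) + 1))
        ≤ 2 * k} with hT
  have hfT : Fintype T := Fintype.ofFinite _
  have hfL : ∀ m, Fintype (Lam F (K m) D) := fun m => Fintype.ofFinite _
  set q := Nat.card F with hq
  have hq3 := L.qgt
  have hqm : ∀ m, 1 ≤ m → (0:ℝ) < ((q ^ m - 1 : ℕ) : ℝ) := by
    intro m hm
    have : 3 ≤ q ^ m := hq3.trans (Nat.le_self_pow (by omega) q)
    exact_mod_cast (by omega)
  set S := (Finset.Icc 1 k).filter (B ∣ ·) with hS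
  have hmS : ∀ m ∈ S, 1 ≤ m ∧ m ≤ k ∧ B ∣ m := by
    intro m hm
    simp only [hS, Finset.mem_filter, Finset.mem_Icc] at hm
    exact ⟨hm.1.1, hm.1.2, hm.2⟩
  -- upper bound for each element
  have key : ∀ h ∈ T, ∑ m ∈ S, ∑ u ∈ (Lam F (K m) D).toFinset,
      (if h ∈ Iset β0 (β m) D u then 1 / (2 * (m:ℝ)) else 0) ≤ 1 := by
    intro h hh
    by_cases hex : ∃ m ∈ S, ∃ u ∈ Lam F (K m) D, h ∈ Iset β0 (β m) D u
    · obtain ⟨m0, hm0, u0, hu0, hI0⟩ := hex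
      obtain ⟨h1, h2, h3⟩ := hmS m0 hm0
      have huniq : ∀ m ∈ S, ∀ v ∈ Lam F (K m) D, h ∈ Iset β0 (β m) D v →
          minpoly F (v : K m) = minpoly F (u0 : K m0) ∨
          minpoly F (v : K m) = minpoly F ((u0⁻¹ : (K m0)ˣ) : K m0) := by
        intro m hm v hv hI
        obtain ⟨φ, hφ, e⟩ := Iset_inter hI
        exact Iset_unique hv hI0 φ hφ e
      have hmm : ∀ m ∈ S, ∀ v ∈ Lam F (K m) D, h ∈ Iset β0 (β m) D v → m = m0 := by
        intro m hm v hv hI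
        have e1 := hv.2
        rw [hK m (hmS m hm).1] at e1
        rcases huniq m hm v hv hI with e | e
        · have e2 := hu0.2
          rw [hK m0 h1] at e2
          rw [← e1, e, e2]
        · have e2 := (Lam_inv hu0).2
          rw [hK m0 h1] at e2
          rw [← e1, e, e2]
      rw [Finset.sum_eq_single m0]
      · have hpos : (0:ℝ) < m0 := by exact_mod_cast h1
        rw [← Finset.sum_filter, Finset.sum_const, nsmul_eq_mul, mul_one_div,
          div_le_one (by positivity)]
        have hc := conj_card L u0 hu0
        rw [hK m0 h1] at hc
        have : ((Lam F (K m0) D).toFinset.filter fun u => h ∈ Iset β0 (β m0) D u).card ≤ 2 * m0 := by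
          rw [← hc, ← Set.ncard_coe_finset]
          apply Set.ncard_le_ncard _ (Set.toFinite _)
          intro v hv
          simp only [Finset.coe_filter, Set.mem_toFinset, Set.mem_setOf_eq] at hv
          exact huniq m0 hm0 v hv.1 hv.2
        exact_mod_cast this
      · intro m hm hne
        apply Finset.sum_eq_zero
        intro u hu
        rw [if_neg]
        intro hI
        exact hne (hmm m hm u (Set.mem_toFinset.1 hu) hI)
      · intro hcon; exact absurd hm0 hcon
    · push Not at hex
      refine le_trans (le_of_eq ?_) zero_le_one
      apply Finset.sum_eq_zero
      intro m hm
      apply Finset.sum_eq_zero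
      intro u hu
      rw [if_neg (hex m hm u (Set.mem_toFinset.1 hu))]
  have hsub : ∀ m ∈ S, ∀ u ∈ Lam F (K m) D, Iset β0 (β m) D u ⊆ T := by
    intro m hm u hu h hI
    obtain ⟨t1, t2, t3⟩ := Iset_target L h2F hu hI
    refine ⟨hI.1, t1, t2, t3.trans ?_⟩
    rw [hK m (hmS m hm).1]
    have := (hmS m hm).2.1
    omega
  calc _ ≤ ∑ m ∈ S, ∑ u ∈ (Lam F (K m) D).toFinset, ((Iset β0 (β m) D u).ncard : ℝ) / (2 * m) := by
        rw [Finset.sum_mul]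
        refine Finset.sum_le_sum fun m hm => ?_
        obtain ⟨h1, h2, h3⟩ := hmS m hm
        have hpos : (0:ℝ) < m := by exact_mod_cast h1
        have hqp := hqm m h1
        have hone : ∀ u ∈ (Lam F (K m) D).toFinset,
            (Nat.card (Spg β0) : ℝ) / (4 * m * ((q ^ m - 1 : ℕ) : ℝ)) ≤
              ((Iset β0 (β m) D u).ncard : ℝ) / (2 * m) := by
          intro u hu
          obtain ⟨e, hee⟩ := he m h1 h2
          have hc := Iset_card L (Set.mem_toFinset.1 hu) e hee
          rw [hK m h1, ← hq] at hc
          have hc' : (Nat.card (Spg β0) : ℝ) *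
            Nat.card {g : Spg (β m) // ¬ D ∣ orderOf (g : W m ≃ₗ[F] W m)} ≤
            (Iset β0 (β m) D u).ncard * ((q ^ m - 1 : ℕ) : ℝ) * Nat.card (Spg (β m)) := by
            exact_mod_cast hc
          have hg := hgood m h1 h2 h3
          have hp : (0:ℝ) < Nat.card (Spg (β m)) := by exact_mod_cast Nat.card_pos
          rw [div_le_div_iff₀ (by positivity) (by positivity)]
          have : (Nat.card (Spg β0) : ℝ) * Nat.card (Spg (β m)) ≤
            2 * ((Iset β0 (β m) D u).ncard * ((q ^ m - 1 : ℕ) : ℝ)) * Nat.card (Spg (β m)) := by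
            have h0 : (0:ℝ) ≤ Nat.card (Spg β0) := by positivity
            nlinarith [mul_le_mul_of_nonneg_left hg h0]
          have := le_of_mul_le_mul_right this hp
          nlinarith [mul_le_mul_of_nonneg_right this hpos.le]
        refine le_trans ?_ (Finset.card_nsmul_le_sum _ _ _ hone)
        rw [nsmul_eq_mul, ← Set.ncard_eq_toFinset_card']
        have h4 := Lam_ge (K := K m) L (by rw [hK m h1]; exact h3)
        rw [hK m h1, ← hq] at h4
        have h4' : ((q ^ m - 1 : ℕ) : ℝ) ≤ 4 * ((Lam F (K m) D).ncard : ℝ) := by exact_mod_cast h4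
        have h5 : (1:ℝ) / (16 * m) ≤ (Lam F (K m) D).ncard / (4 * m * ((q ^ m - 1 : ℕ) : ℝ)) := by
          rw [div_le_div_iff₀ (by positivity) (by positivity)]
          nlinarith [mul_le_mul_of_nonneg_right h4' hpos.le]
        calc _ ≤ _ := mul_le_mul_of_nonneg_right h5 (by positivity)
          _ = _ := by ring
    _ = ∑ m ∈ S, ∑ u ∈ (Lam F (K m) D).toFinset, ∑ h ∈ T.toFinset,
          (if h ∈ Iset β0 (β m) D u then 1 / (2 * (m:ℝ)) else 0) := by
        refine Finset.sum_congr rfl fun m hm => Finset.sum_congr rfl fun u hu => ?_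
        rw [← Finset.sum_filter, Finset.sum_const, nsmul_eq_mul, mul_one_div,
          ← Set.ncard_coe_finset]
        congr 3
        ext h
        simp only [Finset.coe_filter, Set.mem_toFinset, Set.mem_setOf_eq]
        exact ⟨fun hI => ⟨hsub m hm u (Set.mem_toFinset.1 hu) hI, hI⟩, fun hI => hI.2⟩
    _ = ∑ h ∈ T.toFinset, ∑ m ∈ S, ∑ u ∈ (Lam F (K m) D).toFinset,
          (if h ∈ Iset β0 (β m) D u then 1 / (2 * (m:ℝ)) else 0) := by
        rw [Finset.sum_comm (s := T.toFinset)]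
        exact Finset.sum_congr rfl fun m _ => Finset.sum_comm
    _ ≤ ∑ h ∈ T.toFinset, (1:ℝ) :=
        Finset.sum_le_sum fun h hh => key h (Set.mem_toFinset.1 hh)
    _ = _ := by
        rw [Finset.sum_const, nsmul_eq_mul, mul_one, Set.ncard_eq_toFinset_card']

/-- The standard alternating form. -/
noncomputable def bst (F : Type*) [Field F] (ι : Type*) [Fintype ι] :
    LinearMap.BilinForm F (ι ⊕ ι → F) :=
  LinearMap.mk₂ F (fun x y => ∑ i, (x (Sum.inl i) * y (Sum.inr i) - y (Sum.inl i) * x (Sum.inr i)))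
    (by intro x y z; rw [← Finset.sum_add_distrib]; refine Finset.sum_congr rfl fun i _ => ?_
        simp; ring)
    (by intro c x y; rw [smul_eq_mul, Finset.mul_sum]; refine Finset.sum_congr rfl fun i _ => ?_
        simp; ring)
    (by intro x y z; rw [← Finset.sum_add_distrib]; refine Finset.sum_congr rfl fun i _ => ?_
        simp; ring)
    (by intro c x y; rw [smul_eq_mul, Finset.mul_sum]; refine Finset.sum_congr rfl fun i _ => ?_
        simp; ring)

section
variable {F : Type*} [Field F] {ι : Type*} [Fintype ι]

theorem bst_apply (x y : ι ⊕ ι → F) :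
    bst F ι x y = ∑ i, (x (Sum.inl i) * y (Sum.inr i) - y (Sum.inl i) * x (Sum.inr i)) := rfl

theorem bst_alt : (bst F ι).IsAlt := by
  intro x
  rw [bst_apply]
  exact Finset.sum_eq_zero fun i _ => by ring

theorem bst_nd : (bst F ι).Nondegenerate := by
  classical
  have h1 : ∀ x, (∀ y, bst F ι x y = 0) → x = 0 := by
    intro x hx
    ext j
    rcases j with j | j
    · have := hx (Pi.single (Sum.inr j) 1)
      rw [bst_apply] at this
      simpa [Pi.single_apply] using this
    · have := hx (Pi.single (Sum.inl j) 1)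
      rw [bst_apply] at this
      simpa [Pi.single_apply] using this
  refine ⟨h1, ?_⟩
  intro y hy
  apply h1
  intro x
  have h2 := LinearMap.BilinForm.IsAlt.neg_eq (bst_alt (F := F) (ι := ι)) x y
  rw [hy x, neg_zero] at h2
  exact h2.symm

theorem bst_finrank (n : ℕ) : Module.finrank F (Fin n ⊕ Fin n → F) = 2 * n := by
  rw [Module.finrank_fintype_fun_eq_card]; simp; ring

end

theorem iso_exists {F K : Type*} [Field F] [Finite F] [Field K] [Finite K] [Algebra F K]
    (m n l : ℕ) (hm : Module.finrank F K = m) (hl : m + n = l) :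
    ∃ e : (Fin l ⊕ Fin l → F) ≃ₗ[F] ((K × K) × (Fin n ⊕ Fin n → F)),
      ∀ x y, bm K (bst F (Fin n)) (e x) (e y) = bst F (Fin l) x y := by
  let b : Module.Basis (Fin m) F K := Module.finBasisOfFinrankEq F K hm
  let σ : Fin m ⊕ Fin n ≃ Fin l := finSumFinEquiv.trans (finCongr hl)
  let f : ((K × K) × (Fin n ⊕ Fin n → F)) →ₗ[F] (Fin l ⊕ Fin l → F) :=
    { toFun := fun x => Sum.elim
        (fun i => Sum.elim (fun j => b.repr x.1.1 j) (fun j => x.2 (Sum.inl j)) (σ.symm i))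
        (fun i => Sum.elim (fun j => Algebra.trace F K (b j * x.1.2)) (fun j => x.2 (Sum.inr j))
          (σ.symm i))
      map_add' := by
        intro x y
        ext i
        rcases i with i | i <;> rcases h : σ.symm i with j | j <;> simp [h, mul_add]
      map_smul' := by
        intro c x
        ext i
        rcases i with i | i <;> rcases h : σ.symm i with j | j <;> simp [h] }
  have htr : ∀ a c : K, ∑ j, b.repr a j * Algebra.trace F K (b j * c) = Algebra.trace F K (a * c) := by
    intro a c
    conv_rhs => rw [← b.sum_repr a, Finset.sum_mul, map_sum]
    refine Finset.sum_congr rfl fun j _ => ?_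
    rw [smul_mul_assoc, map_smul, smul_eq_mul]
  have hf : ∀ x y, bst F (Fin l) (f x) (f y) = bm K (bst F (Fin n)) x y := by
    intro x y
    rw [bst_apply, bm_apply, bst_apply, ← σ.sum_comp, Fintype.sum_sum_type]
    simp only [f, LinearMap.coe_mk, AddHom.coe_mk, Sum.elim_inl, Sum.elim_inr, Equiv.symm_apply_apply]
    rw [Finset.sum_sub_distrib, htr, htr]
  have hinj : Function.Injective f := by
    rw [← LinearMap.ker_eq_bot, LinearMap.ker_eq_bot']
    rintro x hx
    have hx1 := fun i => congrFun hx i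
    refine Prod.ext (Prod.ext ?_ ?_) ?_
    · apply b.repr.injective
      ext j
      have := hx1 (Sum.inl (σ (Sum.inl j)))
      simpa [f] using this
    · apply tr_zero (F := F)
      intro a
      rw [← htr]
      apply Finset.sum_eq_zero
      intro j _
      have := hx1 (Sum.inr (σ (Sum.inl j)))
      simp [f] at this
      rw [this, mul_zero]
    · ext j
      rcases j with j | j
      · have := hx1 (Sum.inl (σ (Sum.inr j)))
        simpa [f] using this
      · have := hx1 (Sum.inr (σ (Sum.inr j)))
        simpa [f] using this
  have hdim : Module.finrank F ((K × K) × (Fin n ⊕ Fin n → F)) =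
      Module.finrank F (Fin l ⊕ Fin l → F) := by
    rw [Module.finrank_prod, Module.finrank_prod, bst_finrank, bst_finrank, hm]; omega
  let e := LinearEquiv.ofInjectiveOfFinrankEq f hinj hdim
  have hef : ∀ x, e x = f x := fun x => rfl
  refine ⟨e.symm, ?_⟩
  intro x y
  rw [← hf, ← hef, ← hef]
  simp

set_option linter.unusedSectionVars false

theorem sum_harm (B N : ℕ) (hB : 0 < B) (c : ℝ) :
    ∑ m ∈ (Finset.Icc 1 N).filter (B ∣ ·), 1 / (c * (m:ℝ)) =
      (harmonic (N / B) : ℝ) / (c * B) := by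
  rw [harmonic_eq_sum_Icc]
  push_cast
  rw [Finset.sum_div]
  symm
  refine Finset.sum_nbij' (fun j => B * j) (fun m => m / B) ?_ ?_ ?_ ?_ ?_
  · intro j hj
    simp only [Finset.mem_Icc, Finset.mem_filter] at hj ⊢
    refine ⟨⟨Nat.mul_pos hB hj.1, ?_⟩, dvd_mul_right _ _⟩
    exact (Nat.mul_le_mul_left B hj.2).trans (Nat.mul_div_le N B)
  · intro m hm
    simp only [Finset.mem_Icc, Finset.mem_filter] at hm ⊢
    exact ⟨Nat.div_pos (Nat.le_of_dvd hm.1.1 hm.2) hB, Nat.div_le_div_right hm.1.2⟩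
  · intro j _
    simp [hB]
  · intro m hm
    simp only [Finset.mem_filter] at hm
    exact Nat.mul_div_cancel' hm.2
  · intro j hj
    push_cast
    rw [inv_eq_one_div, div_div]
    congr 1; ring

theorem numerics (ε : ℝ) (hε : ε ∈ Set.Ioo (0 : ℝ) 1) (ℓ : ℕ)
    (h1 : ⌈(Real.log ℓ + 1) ^ 2⌉ < ⌈(ℓ : ℝ) ^ ε⌉)
    (h2 : ⌈(ℓ : ℝ) ^ ε⌉ ≤ (ℓ : ℤ) - 2 * ⌈Real.log ℓ⌉) :
    ∃ k b : ℕ, ⌈(ℓ : ℝ) ^ ε⌉ = k ∧ k ≤ ℓ ∧ 2 ≤ b ∧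
      (harmonic (ℓ / 2 ^ b) : ℝ) / (2 * (2 ^ b : ℕ)) ≤ 1 / 2 ∧
      ε / 192 < (harmonic (k / 2 ^ b) : ℝ) / (16 * (2 ^ b : ℕ)) := by
  obtain ⟨hε0, hε1⟩ := hε
  have hsq : (0:ℝ) ≤ (Real.log ℓ + 1) ^ 2 := sq_nonneg _
  have hl10 : 10 ≤ ℓ := by
    rcases Nat.lt_or_ge ℓ 3 with h | h
    · exfalso
      interval_cases ℓ
      · simp [Real.zero_rpow hε0.ne'] at h1
      · simp at h1
      · have a1 : 0 < Real.log (2:ℕ) := Real.log_pos (by norm_num)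
        have a2 : 1 ≤ ⌈Real.log (2:ℕ)⌉ := Int.one_le_ceil_iff.2 a1
        have a3 : 0 ≤ ⌈(Real.log (2:ℕ) + 1) ^ 2⌉ := Int.ceil_nonneg hsq
        push_cast at *
        omega
    · have a0 : (3:ℝ) ≤ ℓ := by exact_mod_cast h
      have a1 : 1 < Real.log ℓ := by
        rw [Real.lt_log_iff_exp_lt (by positivity)]
        have := Real.exp_one_lt_d9
        linarith
      have a2 : 1 < ⌈Real.log ℓ⌉ := Int.lt_ceil.2 (by simpa using a1)
      have a3 : 4 < ⌈(Real.log ℓ + 1) ^ 2⌉ := Int.lt_ceil.2 (by push_cast; nlinarith)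
      omega
  set L := Real.log ℓ with hL
  have hlpos : (0:ℝ) < ℓ := by exact_mod_cast (by omega : 0 < ℓ)
  have hL2 : 2 < L := by
    have a0 : (8:ℝ) ≤ ℓ := by exact_mod_cast (by omega : 8 ≤ ℓ)
    have a1 : Real.log 8 ≤ L := Real.log_le_log (by norm_num) a0
    have a2 : Real.log 8 = 3 * Real.log 2 := by
      rw [show (8:ℝ) = 2 ^ 3 by norm_num, Real.log_pow]; norm_num
    have := Real.log_two_gt_d9
    linarith
  have hk0 : 0 ≤ ⌈(ℓ : ℝ) ^ ε⌉ := Int.ceil_nonneg (by positivity)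
  obtain ⟨k, hk⟩ := Int.eq_ofNat_of_zero_le hk0
  obtain ⟨n, hn1, hn2⟩ := exists_nat_pow_near (x := L) (y := 2) (by linarith) (by norm_num)
  have hn : 1 ≤ n := by
    by_contra hc
    have : n = 0 := by omega
    subst this
    norm_num at hn2
    linarith
  set B : ℕ := 2 ^ (n + 1) with hB
  have hBr : (B : ℝ) = 2 ^ (n + 1) := by simp [hB]
  have hBL : L < B := by rw [hBr]; exact hn2
  have hB2L : (B:ℝ) ≤ 2 * L := by rw [hBr, pow_succ]; linarith
  have hB4 : (4:ℝ) ≤ B := by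
    have : 4 ≤ B := by
      calc 4 = 2 ^ 2 := rfl
        _ ≤ _ := Nat.pow_le_pow_right (by norm_num) (by omega)
    exact_mod_cast this
  have hBpos : (0:ℝ) < B := by linarith
  have hcl : 0 ≤ ⌈L⌉ := Int.ceil_nonneg (by linarith)
  have hkl : k ≤ ℓ := by omega
  have hkL : (L + 1) ^ 2 < k := by
    have a1 := Int.le_ceil ((L + 1) ^ 2)
    have a2 : ((⌈(L + 1) ^ 2⌉ : ℤ) : ℝ) < ((k : ℤ) : ℝ) := by
      rw [hk] at h1; exact_mod_cast h1
    push_cast at a2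
    linarith
  have hk9 : (9:ℝ) < k := by nlinarith
  have hkε : (ℓ:ℝ) ^ ε ≤ k := by
    have := Int.le_ceil ((ℓ:ℝ) ^ ε)
    rw [hk] at this
    exact_mod_cast this
  have hlogk : ε * L ≤ Real.log k := by
    have := Real.log_le_log (by positivity) hkε
    rwa [Real.log_rpow hlpos] at this
  refine ⟨k, n + 1, hk, hkl, by omega, ?_, ?_⟩
  · rw [← hB, div_le_div_iff₀ (by positivity) (by norm_num)]
    have : (harmonic (ℓ / B) : ℝ) ≤ B := by
      rcases Nat.eq_zero_or_pos (ℓ / B) with h0 | h0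
      · rw [h0]; simp
      · have b1 := harmonic_le_one_add_log (ℓ / B)
        have b2 : Real.log ((ℓ / B : ℕ) : ℝ) ≤ Real.log ((ℓ:ℝ) / B) :=
          Real.log_le_log (by exact_mod_cast h0) Nat.cast_div_le
        rw [Real.log_div hlpos.ne' hBpos.ne'] at b2
        have b3 : 1 ≤ Real.log B := by
          rw [Real.le_log_iff_exp_le hBpos]
          have := Real.exp_one_lt_d9
          linarith
        linarith
    linarith
  · rw [← hB]
    have c1 := log_add_one_le_harmonic (k / B)
    have c2 : (k:ℝ) / B ≤ ((k / B + 1 : ℕ) : ℝ) := by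
      push_cast
      have h3 : k < B * (k / B + 1) := Nat.lt_mul_div_succ k (by positivity)
      have : (k:ℝ) < B * ((k / B : ℕ) + 1) := by exact_mod_cast h3
      rw [div_le_iff₀ hBpos]; linarith
    have hkpos : (0:ℝ) < k := by linarith
    have c3 := Real.log_le_log (by positivity) c2
    rw [Real.log_div hkpos.ne' hBpos.ne'] at c3
    have c4 : Real.log B ≤ Real.log 2 + Real.log L := by
      rw [← Real.log_mul (by norm_num) (by linarith)]
      exact Real.log_le_log hBpos hB2L
    have c5 : 2 * Real.log L ≤ Real.log k := by
      have : Real.log (L ^ 2) ≤ Real.log k := Real.log_le_log (by positivity) (by nlinarith)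
      rw [Real.log_pow] at this
      exact_mod_cast this
    have c6 : 3 * Real.log 2 < Real.log k := by
      have a2 : Real.log 8 = 3 * Real.log 2 := by
        rw [show (8:ℝ) = 2 ^ 3 by norm_num, Real.log_pow]; norm_num
      rw [← a2]
      exact Real.log_lt_log (by norm_num) (by linarith)
    have c7 : Real.log k / 2 - Real.log 2 ≤ (harmonic (k / B) : ℝ) := by linarith
    rw [div_lt_div_iff₀ (by norm_num) (by positivity)]
    nlinarith [mul_le_mul_of_nonneg_left hB2L hε0.le]

theorem combo {F : Type*} [Field F] [Finite F] (hF : Odd (Nat.card F)) (ℓ k b : ℕ) (hb : 2 ≤ b)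
    (hkl : k ≤ ℓ) (hs : (harmonic (ℓ / 2 ^ b) : ℝ) / (2 * (2 ^ b : ℕ)) ≤ 1 / 2) :
    ((harmonic (k / 2 ^ b) : ℝ) / (16 * (2 ^ b : ℕ))) * Nat.card (Spg (bst F (Fin ℓ))) ≤
      ({h : (Fin ℓ ⊕ Fin ℓ → F) ≃ₗ[F] (Fin ℓ ⊕ Fin ℓ → F) | h ∈ Spg (bst F (Fin ℓ)) ∧
        Even (orderOf h) ∧ orderOf (h ^ (orderOf h / 2)) = 2 ∧
      Module.finrank F (LinearMap.ker
        (((h ^ (orderOf h / 2) : (Fin ℓ ⊕ Fin ℓ → F) ≃ₗ[F] (Fin ℓ ⊕ Fin ℓ → F)) :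
          Module.End F (Fin ℓ ⊕ Fin ℓ → F)) + 1)) ≤ 2 * k}.ncard : ℝ) := by
  have h1F : 1 < Nat.card F := Finite.one_lt_card
  have h3F : 3 ≤ Nat.card F := by obtain ⟨j, hj⟩ := hF; omega
  obtain ⟨D, L⟩ := Lev.exists (Nat.card F) b hF h3F hb
  obtain ⟨p, hp⟩ := CharP.exists F
  have hpp : Fact p.Prime := ⟨CharP.char_is_prime F p⟩
  have hBpos : 0 < 2 ^ b := by positivity
  have h2F : (2:F) ≠ 0 := by
    intro h0
    have hd : p ∣ 2 := (CharP.cast_eq_zero_iff F p 2).1 (by exact_mod_cast h0)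
    have hp2 : p = 2 := (Nat.prime_dvd_prime_iff_eq hpp.out Nat.prime_two).1 hd
    have : Fintype F := Fintype.ofFinite F
    have h3 := FiniteField.even_card_of_char_two (F := F) (by
      subst hp2; exact ringChar.eq_iff.2 hp)
    rw [← Nat.card_eq_fintype_card] at h3
    obtain ⟨j, hj⟩ := hF; omega
  let K : ℕ → Type := fun m => FiniteField.Extension F p (m - 1 + 1)
  let iF : ∀ m, Field (K m) := fun m => inferInstanceAs (Field (FiniteField.Extension F p (m - 1 + 1)))
  have iFin : ∀ m, Finite (K m) :=
    fun m => inferInstanceAs (Finite (FiniteField.Extension F p (m - 1 + 1)))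
  let iA : ∀ m, Algebra F (K m) :=
    fun m => inferInstanceAs (Algebra F (FiniteField.Extension F p (m - 1 + 1)))
  have hK : ∀ m, 1 ≤ m → Module.finrank F (K m) = m := by
    intro m hm
    have := FiniteField.finrank_extension F p (m - 1 + 1)
    rw [← Nat.sub_add_cancel hm]
    simpa [K] using this
  rw [← sum_harm _ _ hBpos]
  refine lower K hK h2F L k (bst F (Fin ℓ)) (fun m => Fin (ℓ - m) ⊕ Fin (ℓ - m) → F)
    (fun m => bst F (Fin (ℓ - m))) ?_ ?_
  · intro m hm hmk
    exact iso_exists m (ℓ - m) ℓ (hK m hm) (by omega)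
  · intro m hm hmk hBm
    have hbad := bad_le K hK L (bst_finrank (F := F) (ℓ - m)) bst_alt bst_nd
    have hle : ∑ j ∈ (Finset.Icc 1 (ℓ - m)).filter (2 ^ b ∣ ·), 1 / (2 * (j:ℝ)) ≤ 1 / 2 := by
      refine le_trans (Finset.sum_le_sum_of_subset_of_nonneg ?_ ?_) ((sum_harm _ _ hBpos 2).le.trans hs)
      · apply Finset.filter_subset_filter
        exact Finset.Icc_subset_Icc le_rfl (by omega)
      · intros; positivity
    have hsplit : Nat.card (Spg (bst F (Fin (ℓ - m)))) =
      Nat.card {h : Spg (bst F (Fin (ℓ - m))) // D ∣ orderOf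
        (h : (Fin (ℓ - m) ⊕ Fin (ℓ - m) → F) ≃ₗ[F] (Fin (ℓ - m) ⊕ Fin (ℓ - m) → F))} +
      Nat.card {h : Spg (bst F (Fin (ℓ - m))) // ¬ D ∣ orderOf
        (h : (Fin (ℓ - m) ⊕ Fin (ℓ - m) → F) ≃ₗ[F] (Fin (ℓ - m) ⊕ Fin (ℓ - m) → F))} := by
      classical
      have : Fintype (Spg (bst F (Fin (ℓ - m)))) := Fintype.ofFinite _
      rw [← Nat.card_sum]
      exact (Nat.card_congr (Equiv.sumCompl _)).symm
    have hsplit' : (Nat.card (Spg (bst F (Fin (ℓ - m)))) : ℝ) =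
      Nat.card {h : Spg (bst F (Fin (ℓ - m))) // D ∣ orderOf
        (h : (Fin (ℓ - m) ⊕ Fin (ℓ - m) → F) ≃ₗ[F] (Fin (ℓ - m) ⊕ Fin (ℓ - m) → F))} +
      Nat.card {h : Spg (bst F (Fin (ℓ - m))) // ¬ D ∣ orderOf
        (h : (Fin (ℓ - m) ⊕ Fin (ℓ - m) → F) ≃ₗ[F] (Fin (ℓ - m) ⊕ Fin (ℓ - m) → F))} := by
      exact_mod_cast hsplit
    have h3 := hbad.trans (mul_le_mul_of_nonneg_right hle (by positivity))
    linarith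

/-- Matrices as linear equivalences. -/
noncomputable def Phi (F ι : Type*) [Field F] [Fintype ι] [DecidableEq ι] :
    GL ι F ≃* ((ι → F) ≃ₗ[F] (ι → F)) :=
  Matrix.GeneralLinearGroup.toLin.trans (LinearMap.GeneralLinearGroup.generalLinearEquiv F (ι → F))

theorem Phi_coe {F ι : Type*} [Field F] [Fintype ι] [DecidableEq ι] (h : GL ι F) :
    ((Phi F ι h : (ι → F) ≃ₗ[F] (ι → F)) : Module.End F (ι → F)) =
      Matrix.toLin' (h : Matrix ι ι F) := rfl

theorem Phi_apply {F ι : Type*} [Field F] [Fintype ι] [DecidableEq ι] (h : GL ι F) (x : ι → F) :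
    Phi F ι h x = (h : Matrix ι ι F) *ᵥ x := rfl

theorem bst_matrix {F ι : Type*} [Field F] [Fintype ι] [DecidableEq ι]
    (J : Matrix (ι ⊕ ι) (ι ⊕ ι) F) (hJ : J = Matrix.fromBlocks 0 1 (-1) 0) (x y : ι ⊕ ι → F) :
    bst F ι x y = x ⬝ᵥ (J *ᵥ y) := by
  subst hJ
  rw [bst_apply, Matrix.fromBlocks_mulVec]
  simp only [dotProduct, Fintype.sum_sum_type, Finset.sum_sub_distrib]
  simp [sub_eq_add_neg, Matrix.neg_mulVec, mul_comm]

theorem mem_Spg_iff {F ι : Type*} [Field F] [Fintype ι] [DecidableEq ι]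
    (J : Matrix (ι ⊕ ι) (ι ⊕ ι) F) (hJ : J = Matrix.fromBlocks 0 1 (-1) 0) (h : GL (ι ⊕ ι) F) :
    Phi F (ι ⊕ ι) h ∈ Spg (bst F ι) ↔
      (h : Matrix (ι ⊕ ι) (ι ⊕ ι) F)ᵀ * J * (h : Matrix (ι ⊕ ι) (ι ⊕ ι) F) = J := by
  have key : ∀ x y, bst F ι (Phi F (ι ⊕ ι) h x) (Phi F (ι ⊕ ι) h y) =
      x ⬝ᵥ (((h : Matrix (ι ⊕ ι) (ι ⊕ ι) F)ᵀ * J * (h : Matrix (ι ⊕ ι) (ι ⊕ ι) F)) *ᵥ y) := by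
    intro x y
    rw [bst_matrix J hJ, Phi_apply, Phi_apply, ← Matrix.mulVec_mulVec, ← Matrix.mulVec_mulVec,
      Matrix.dotProduct_mulVec x, Matrix.vecMul_transpose]
  constructor
  · intro hh
    ext i j
    have h1 := hh (Pi.single i 1) (Pi.single j 1)
    rw [key, bst_matrix J hJ] at h1
    simpa using h1
  · intro hh x y
    rw [key, hh, bst_matrix J hJ]

theorem stmt13 (ε : ℝ) (hε : ε ∈ Set.Ioo (0 : ℝ) 1) (ℓ : ℕ)
    (h1 : ⌈(Real.log ℓ + 1) ^ 2⌉ < ⌈(ℓ : ℝ) ^ ε⌉)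
    (h2 : ⌈(ℓ : ℝ) ^ ε⌉ ≤ (ℓ : ℤ) - 2 * ⌈Real.log ℓ⌉)
    (F : Type*) [Field F] [Fintype F] (hF : Odd (Fintype.card F))
    (J : Matrix (Fin ℓ ⊕ Fin ℓ) (Fin ℓ ⊕ Fin ℓ) F)
    (hJ : J = Matrix.fromBlocks 0 1 (-1) 0) :
    (Nat.card {h : GL (Fin ℓ ⊕ Fin ℓ) F //
        ((h : Matrix (Fin ℓ ⊕ Fin ℓ) (Fin ℓ ⊕ Fin ℓ) F)ᵀ * J *
          (h : Matrix (Fin ℓ ⊕ Fin ℓ) (Fin ℓ ⊕ Fin ℓ) F) = J) ∧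
        Even (orderOf h) ∧ orderOf (h ^ (orderOf h / 2)) = 2 ∧
        ((negOneEigDim F ((h ^ (orderOf h / 2) : GL (Fin ℓ ⊕ Fin ℓ) F) :
            Matrix (Fin ℓ ⊕ Fin ℓ) (Fin ℓ ⊕ Fin ℓ) F) : ℤ) ≤ 2 * ⌈(ℓ : ℝ) ^ ε⌉)} : ℝ) /
      Nat.card {h : GL (Fin ℓ ⊕ Fin ℓ) F //
        (h : Matrix (Fin ℓ ⊕ Fin ℓ) (Fin ℓ ⊕ Fin ℓ) F)ᵀ * J *
          (h : Matrix (Fin ℓ ⊕ Fin ℓ) (Fin ℓ ⊕ Fin ℓ) F) = J} >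
      ε / 192 := by

  have hF' : Odd (Nat.card F) := by rw [Nat.card_eq_fintype_card]; exact hF
  obtain ⟨k, b, hk, hkl, hb, hs, hgt⟩ := numerics ε hε ℓ h1 h2
  have hc := combo hF' ℓ k b hb hkl hs
  have hden : Nat.card {h : GL (Fin ℓ ⊕ Fin ℓ) F //
        (h : Matrix (Fin ℓ ⊕ Fin ℓ) (Fin ℓ ⊕ Fin ℓ) F)ᵀ * J *
          (h : Matrix (Fin ℓ ⊕ Fin ℓ) (Fin ℓ ⊕ Fin ℓ) F) = J} = Nat.card (Spg (bst F (Fin ℓ))) :=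
    Nat.card_congr ((Phi F (Fin ℓ ⊕ Fin ℓ)).toEquiv.subtypeEquiv fun h => (mem_Spg_iff J hJ h).symm)
  have hpos : (0:ℝ) < Nat.card (Spg (bst F (Fin ℓ))) := by exact_mod_cast Nat.card_pos
  rw [gt_iff_lt, hden, lt_div_iff₀ hpos]
  refine lt_of_lt_of_le (mul_lt_mul_of_pos_right hgt hpos) (hc.trans (le_of_eq ?_))
  rw [← Nat.card_coe_set_eq]
  congr 1
  refine (Nat.card_congr ((Phi F (Fin ℓ ⊕ Fin ℓ)).toEquiv.subtypeEquiv fun h => ?_)).symm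
  have ho : ∀ g : GL (Fin ℓ ⊕ Fin ℓ) F, orderOf (Phi F (Fin ℓ ⊕ Fin ℓ) g) = orderOf g :=
    fun g => orderOf_injective (Phi F (Fin ℓ ⊕ Fin ℓ)).toMonoidHom (Phi F (Fin ℓ ⊕ Fin ℓ)).injective g
  change _ ↔ Phi F (Fin ℓ ⊕ Fin ℓ) h ∈ _
  rw [Set.mem_setOf_eq, mem_Spg_iff J hJ, ho, ← map_pow, ho, hk, Phi_coe, negOneEigDim, map_add,
    Matrix.toLin'_one]
  refine and_congr Iff.rfl (and_congr Iff.rfl (and_congr Iff.rfl ?_))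
  change _ ↔ Module.finrank F (LinearMap.ker (Matrix.toLin' _ + LinearMap.id)) ≤ 2 * k
  norm_cast
end
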